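/- arXiv:1306.6347 — 2 statements merged into one kernel-verified Lean document; each statement's English description precedes it below -/
import Mathlib

section
/- For a uniformly random alternating sign matrix of size N let Ψ_k(N) denote the sum of the column numbers of the entries equal to 1 minus the sum of the column numbers of the entries equal to −1 in the k-th row. Then for any fixed k the random variable √(8/3) · (Ψ_k(N) − N/2)/√N converges in distribution, as N → ∞, to a standard Gaussian N(0,1); moreover, for any fixed m the random vector ( √(8/3) · (Ψ_k(N) − N/2)/√N )_{k=1,…,m} converges in distribution to a vector of m independent standard Gaussian N(0,1) random variables. -/
open MeasureTheory ProbabilityTheory Filter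

/-- An alternating sign matrix: entries in `{-1,0,1}`, every row and column sums to `1`,
and every partial sum of a row (from the left) or of a column (from the top) equals `0` or `1`. -/
def IsASM {N : ℕ} (M : Matrix (Fin N) (Fin N) ℤ) : Prop :=
  (∀ i j, M i j = -1 ∨ M i j = 0 ∨ M i j = 1) ∧
  (∀ i : Fin N, ∑ j, M i j = 1) ∧
  (∀ j : Fin N, ∑ i, M i j = 1) ∧
  (∀ i m : Fin N, (∑ j ∈ Finset.univ.filter (fun j : Fin N => j ≤ m), M i j) = 0 ∨
                  (∑ j ∈ Finset.univ.filter (fun j : Fin N => j ≤ m), M i j) = 1) ∧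
  (∀ j m : Fin N, (∑ i ∈ Finset.univ.filter (fun i : Fin N => i ≤ m), M i j) = 0 ∨
                  (∑ i ∈ Finset.univ.filter (fun i : Fin N => i ≤ m), M i j) = 1)

/-- `Ψ_{r+1}(N) = ∑_j j · M_{r+1, j}` (columns numbered `1,…,N`): the sum of column numbers of
the `1`s minus the sum of the column numbers of the `-1`s in row `r` (`0`-based).
Junk value `0` when `r ≥ N`. -/
noncomputable def psiRow {N : ℕ} (M : Matrix (Fin N) (Fin N) ℤ) (r : ℕ) : ℝ :=
  if h : r < N then ∑ j : Fin N, ((j : ℕ) + 1 : ℝ) * (M ⟨r, h⟩ j : ℝ) else 0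

/-- The centered and rescaled row sums `√(8/3)·(Ψ_{r+1}(N) − N/2)/√N`. -/
noncomputable def psiScaled {N : ℕ} (M : Matrix (Fin N) (Fin N) ℤ) (r : ℕ) : ℝ :=
  Real.sqrt (8 / 3) * (psiRow M r - (N : ℝ) / 2) / Real.sqrt (N : ℝ)

section SixVertex

variable {R : Type*} [CommRing R]

/-- Boltzmann weights of a six-vertex cell: `a` and `b` are the weights of the two kinds of
zero entries, `c` is the weight of an entry `1` and `d` the weight of an entry `-1`. -/
structure CellWeights (R : Type*) where
  a : R
  b : R
  c : R
  d : R

/-- The weight of a cell with left, top, right and bottom edge states. -/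
def cellWeight (w : CellWeights R) : Bool → Bool → Bool → Bool → R
  | false, false, false, false => w.a
  | true, true, true, true => w.a
  | false, true, false, true => w.b
  | true, false, true, false => w.b
  | false, false, true, true => w.c
  | true, true, false, false => w.d
  | _, _, _, _ => 0

theorem cellWeight_transpose (w : CellWeights R) (h s h' s' : Bool) :
    cellWeight w h s h' s' = cellWeight w s h s' h' := by
  cases h <;> cases s <;> cases h' <;> cases s' <;> rfl

/-- Sequences of `n + 1` states from `x` to `y`. -/
def statePaths {ι : Type*} [Fintype ι] [DecidableEq ι] (n : ℕ) (x y : ι) :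
    Finset (Fin (n + 1) → ι) :=
  Finset.univ.filter fun p => p 0 = x ∧ p (Fin.last n) = y

theorem mem_statePaths {ι : Type*} [Fintype ι] [DecidableEq ι] {n : ℕ} {x y : ι}
    {p : Fin (n + 1) → ι} : p ∈ statePaths n x y ↔ p 0 = x ∧ p (Fin.last n) = y := by
  simp [statePaths]

theorem prod_ofFn_apply_eq_sum_statePaths {ι : Type*} [Fintype ι] [DecidableEq ι] {n : ℕ}
    (A : Fin n → Matrix ι ι R) (x y : ι) :
    (List.ofFn A).prod x y =
      ∑ p ∈ statePaths n x y, ∏ i : Fin n, A i (p i.castSucc) (p i.succ) := by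
  induction n generalizing x with
  | zero =>
    rw [statePaths, Finset.sum_filter,
      ← Equiv.sum_comp (Equiv.funUnique (Fin 1) ι).symm]
    by_cases h : x = y
    · subst h
      simp [Fin.last]
    · have : ∀ z : ι, ¬ (z = x ∧ z = y) := fun z hz => h (hz.1.symm.trans hz.2)
      simp [Fin.last, h, this]
  | succ n ih =>
    rw [List.ofFn_succ, List.prod_cons, Matrix.mul_apply]
    simp_rw [ih, statePaths, Finset.sum_filter]
    symm
    rw [← Equiv.sum_comp (Fin.consEquiv fun _ : Fin (n + 2) => ι), Fintype.sum_prod_type,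
      Finset.sum_eq_single x]
    · simp_rw [Finset.mul_sum]
      rw [Finset.sum_comm]
      refine Finset.sum_congr rfl fun p _ => ?_
      rw [Finset.sum_eq_single (p 0)]
      · simp [Fin.consEquiv, Fin.prod_univ_succ, ← Fin.succ_last]
      · intro z _ hz
        simp [hz.symm]
      · simp
    · intro z _ hz
      simp [Fin.consEquiv, hz]
    · simp

/-- The six-vertex partition function with domain wall boundary conditions; `h i` lists the
states of the horizontal edges in row `i` and `s j` those of the vertical edges in column `j`. -/
def sixVertexZ {n : ℕ} (W : Fin n → Fin n → CellWeights R) : R :=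
  ∑ h ∈ Fintype.piFinset fun _ : Fin n => statePaths n false true,
    ∑ s ∈ Fintype.piFinset fun _ : Fin n => statePaths n false true,
      ∏ i, ∏ j, cellWeight (W i j) (h i j.castSucc) (s j i.castSucc) (h i j.succ) (s j i.succ)

theorem sixVertexZ_transpose {n : ℕ} (W : Fin n → Fin n → CellWeights R) :
    sixVertexZ (fun i j => W j i) = sixVertexZ W := by
  unfold sixVertexZ
  rw [Finset.sum_comm]
  refine Finset.sum_congr rfl fun h _ => Finset.sum_congr rfl fun s _ => ?_
  rw [Finset.prod_comm]
  exact Finset.prod_congr rfl fun i _ => Finset.prod_congr rfl fun j _ =>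
    cellWeight_transpose _ _ _ _ _

/-- The monodromy matrix of a single cell, as a matrix between horizontal edge states. -/
def cellMatrix (w : CellWeights R) (s t : Bool) : Matrix Bool Bool R :=
  Matrix.of fun h h' => cellWeight w h s h' t

/-- The row transfer matrix with domain wall horizontal boundary conditions. -/
def rowMatrix {n : ℕ} (w : Fin n → CellWeights R) :
    Matrix (Fin n → Bool) (Fin n → Bool) R :=
  Matrix.of fun S S' => (List.ofFn fun j => cellMatrix (w j) (S j) (S' j)).prod false true

theorem sixVertexZ_eq_prod_rowMatrix {n : ℕ} (W : Fin n → Fin n → CellWeights R) :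
    sixVertexZ W =
      (List.ofFn fun i => rowMatrix (W i)).prod (fun _ => false) (fun _ => true) := by
  rw [prod_ofFn_apply_eq_sum_statePaths]
  simp only [rowMatrix, Matrix.of_apply, prod_ofFn_apply_eq_sum_statePaths]
  simp_rw [Finset.prod_univ_sum]
  rw [Finset.sum_comm]
  unfold sixVertexZ
  refine Finset.sum_congr rfl fun h _ => ?_
  refine Finset.sum_bij (fun s _ i j => s j i) ?_ ?_ ?_ ?_
  · intro s hs
    simp only [Fintype.mem_piFinset, mem_statePaths] at hs ⊢
    exact ⟨funext fun j => (hs j).1, funext fun j => (hs j).2⟩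
  · intro s _ s' _ hss
    funext j i
    exact congrFun (congrFun hss i) j
  · intro p hp
    rw [mem_statePaths] at hp
    refine ⟨fun j i => p i j, ?_, rfl⟩
    simp only [Fintype.mem_piFinset, mem_statePaths]
    exact fun j => ⟨congrFun hp.1 j, congrFun hp.2 j⟩
  · intro s _
    rfl

theorem sixVertexZ_comp_perm {n : ℕ} (W : Fin n → Fin n → CellWeights R)
    (hW : ∀ i j, Commute (rowMatrix (W i)) (rowMatrix (W j))) (σ : Equiv.Perm (Fin n)) :
    sixVertexZ (fun i => W (σ i)) = sixVertexZ W := by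
  rw [sixVertexZ_eq_prod_rowMatrix, sixVertexZ_eq_prod_rowMatrix]
  refine congrFun (congrFun ?_ _) _
  have hp : (List.ofFn ((fun i => rowMatrix (W i)) ∘ σ)).Perm
      (List.ofFn fun i => rowMatrix (W i)) := Equiv.Perm.ofFn_comp_perm σ _
  refine hp.prod_eq' ?_
  rw [List.pairwise_iff_getElem]
  intro i j hi hj _
  simpa using hW _ _

theorem sum_prod_ofFn {A ι : Type*} [Semiring A] [Fintype ι] {n : ℕ} (F : Fin n → ι → A) :
    ∑ S : Fin n → ι, (List.ofFn fun j => F j (S j)).prod =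
      (List.ofFn fun j => ∑ b, F j b).prod := by
  induction n with
  | zero => simp
  | succ n ih =>
    rw [← Equiv.sum_comp (Fin.consEquiv fun _ => ι), Fintype.sum_prod_type]
    simp only [List.ofFn_succ, List.prod_cons, ← ih, Finset.sum_mul_sum]
    simp [Fin.consEquiv]

open Kronecker in
theorem prod_ofFn_kronecker {ι : Type*} [Fintype ι] [DecidableEq ι] {n : ℕ}
    (A B : Fin n → Matrix ι ι R) :
    (List.ofFn fun j => A j ⊗ₖ B j).prod = (List.ofFn A).prod ⊗ₖ (List.ofFn B).prod := by
  induction n with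
  | zero => simp
  | succ n ih => simp [List.ofFn_succ, ih, Matrix.mul_kronecker_mul]

open Kronecker in
/-- The two-row monodromy matrix of a single column. -/
def doubleCellMatrix (w w' : CellWeights R) (s s' : Bool) :
    Matrix (Bool × Bool) (Bool × Bool) R :=
  ∑ t, cellMatrix w s t ⊗ₖ cellMatrix w' t s'

open Kronecker in
theorem rowMatrix_mul_apply {n : ℕ} (w w' : Fin n → CellWeights R) (S S' : Fin n → Bool) :
    (rowMatrix w * rowMatrix w') S S' =
      (List.ofFn fun j => doubleCellMatrix (w j) (w' j) (S j) (S' j)).prod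
        (false, false) (true, true) := by
  have h := sum_prod_ofFn fun j t => cellMatrix (w j) (S j) t ⊗ₖ cellMatrix (w' j) t (S' j)
  simp only [doubleCellMatrix]
  rw [← h, Matrix.mul_apply, Matrix.sum_apply]
  refine Finset.sum_congr rfl fun T _ => ?_
  rw [prod_ofFn_kronecker]
  rfl

/-- An intertwiner of six-vertex type. -/
def intertwiner (r₀ p r s : R) : Matrix (Bool × Bool) (Bool × Bool) R :=
  Matrix.of fun x y => match x, y with
    | (false, false), (false, false) => r₀
    | (true, true), (true, true) => r₀
    | (false, true), (false, true) => p
    | (false, true), (true, false) => r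
    | (true, false), (false, true) => r
    | (true, false), (true, false) => s
    | _, _ => 0

theorem intertwiner_mul_doubleCellMatrix {w w' : CellWeights R} {r₀ p r s : R}
    (hc : w.c = 1) (hc' : w'.c = 1)
    (h1 : p * (w.a * w'.b - w'.a * w.b) = w.d * r) (h2 : p * w'.d = w.d * s)
    (h3 : r * w'.d = s * (w.a * w'.b - w'.a * w.b))
    (h4 : r₀ * w.a = w'.a * p + w.b * r) (h5 : r₀ * w'.b = w'.a * r + w.b * s) (x y : Bool) :
    intertwiner r₀ p r s * doubleCellMatrix w w' x y =
      doubleCellMatrix w' w x y * intertwiner r₀ p r s := by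
  ext ⟨i, j⟩ ⟨k, l⟩
  simp only [Matrix.mul_apply, Fintype.sum_prod_type, Fintype.sum_bool, doubleCellMatrix,
    Matrix.add_apply, Matrix.kronecker_apply, cellMatrix, Matrix.of_apply]
  cases x <;> cases y <;> cases i <;> cases j <;> cases k <;> cases l <;>
    simp only [intertwiner, Matrix.of_apply, cellWeight, hc, hc', mul_zero, zero_mul, add_zero,
      zero_add, mul_one, one_mul] <;>
    first
    | ring1
    | grind

theorem intertwiner_mul_prod {n : ℕ} {w w' : Fin n → CellWeights R} {r₀ p r s : R}
    (S S' : Fin n → Bool)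
    (h : ∀ j x y, intertwiner r₀ p r s * doubleCellMatrix (w j) (w' j) x y =
      doubleCellMatrix (w' j) (w j) x y * intertwiner r₀ p r s) :
    intertwiner r₀ p r s * (List.ofFn fun j => doubleCellMatrix (w j) (w' j) (S j) (S' j)).prod =
      (List.ofFn fun j => doubleCellMatrix (w' j) (w j) (S j) (S' j)).prod *
        intertwiner r₀ p r s := by
  induction n with
  | zero => simp
  | succ n ih =>
    rw [List.ofFn_succ, List.ofFn_succ, List.prod_cons, List.prod_cons, ← mul_assoc, h,
      mul_assoc, mul_assoc]
    congr 1
    exact ih (fun j => S j.succ) (fun j => S' j.succ) (fun j => h j.succ)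

theorem mul_rowMatrix_mul_comm {n : ℕ} {w w' : Fin n → CellWeights R} {r₀ p r s : R}
    (h : ∀ j x y, intertwiner r₀ p r s * doubleCellMatrix (w j) (w' j) x y =
      doubleCellMatrix (w' j) (w j) x y * intertwiner r₀ p r s) (S S' : Fin n → Bool) :
    r₀ * (rowMatrix w * rowMatrix w') S S' = r₀ * (rowMatrix w' * rowMatrix w) S S' := by
  have := congrFun (congrFun (intertwiner_mul_prod S S' h) (false, false)) (true, true)
  rw [Matrix.mul_apply, Matrix.mul_apply] at this
  simp only [Fintype.sum_prod_type, Fintype.sum_bool] at this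
  simp only [intertwiner, Matrix.of_apply, mul_zero, zero_mul, add_zero, zero_add] at this
  rw [rowMatrix_mul_apply, rowMatrix_mul_apply, this, mul_comm]

end SixVertex

section Freezing

variable {R : Type*} [CommRing R]

theorem prod_cellMatrix_false_true {n : ℕ} (w : Fin n → CellWeights R) (S : Fin n → Bool) :
    (List.ofFn fun j => cellMatrix (w j) false (S j)).prod true true =
      if S = (fun _ => false) then ∏ j, (w j).b else 0 := by
  induction n with
  | zero => simp [Subsingleton.elim S (fun _ => false)]
  | succ n ih =>
    rw [List.ofFn_succ, List.prod_cons, Matrix.mul_apply, Fintype.sum_bool,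
      ih (fun j => w j.succ) (fun j => S j.succ), Fin.prod_univ_succ]
    have hS : S = (fun _ => false) ↔
        S 0 = false ∧ (fun j : Fin n => S j.succ) = fun _ => false := by
      simp [funext_iff, Fin.forall_fin_succ]
    rcases h : S 0 <;> simp [hS, h, cellMatrix, cellWeight]

theorem prod_cellMatrix_false_false {n : ℕ} (w : Fin n → CellWeights R) (S : Fin n → Bool) :
    (List.ofFn fun j => cellMatrix (w j) false (S j)).prod false false =
      if S = (fun _ => false) then ∏ j, (w j).a else 0 := by
  induction n with
  | zero => simp [Subsingleton.elim S (fun _ => false)]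
  | succ n ih =>
    rw [List.ofFn_succ', List.prod_concat, Matrix.mul_apply, Fintype.sum_bool,
      ih (fun j => w j.castSucc) (fun j => S j.castSucc), Fin.prod_univ_castSucc]
    have hS : S = (fun _ => false) ↔
        S (Fin.last n) = false ∧ (fun j : Fin n => S j.castSucc) = fun _ => false := by
      simp [funext_iff, Fin.forall_fin_succ', and_comm]
    rcases h : S (Fin.last n) <;> simp [hS, h, cellMatrix, cellWeight]

theorem rowMatrix_cons_true {n : ℕ} (w : Fin (n + 1) → CellWeights R)
    (S : Fin n → Bool) (S' : Fin (n + 1) → Bool) :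
    rowMatrix w (Fin.cons true S : Fin (n + 1) → Bool) S' =
      if S' 0 = true then (w 0).b * rowMatrix (fun j => w j.succ) S (fun j => S' j.succ)
      else 0 := by
  rw [rowMatrix, Matrix.of_apply, List.ofFn_succ, List.prod_cons, Matrix.mul_apply,
    Fintype.sum_bool]
  rcases h : S' 0 <;> simp [cellMatrix, cellWeight, rowMatrix]

theorem rowMatrix_snoc_true {n : ℕ} (w : Fin (n + 1) → CellWeights R)
    (S : Fin n → Bool) (S' : Fin (n + 1) → Bool) :
    rowMatrix w (Fin.snoc S true : Fin (n + 1) → Bool) S' =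
      if S' (Fin.last n) = true then
        (w (Fin.last n)).a * rowMatrix (fun j => w j.castSucc) S (fun j => S' j.castSucc)
      else 0 := by
  rw [rowMatrix, Matrix.of_apply, List.ofFn_succ', List.prod_concat, Matrix.mul_apply,
    Fintype.sum_bool]
  rcases h : S' (Fin.last n) <;> simp [cellMatrix, cellWeight, rowMatrix, mul_comm]

theorem prod_rowMatrix_cons_true {k n : ℕ} (w : Fin k → Fin (n + 1) → CellWeights R)
    (S S' : Fin n → Bool) :
    (List.ofFn fun i => rowMatrix (w i)).prod (Fin.cons true S : Fin (n + 1) → Bool)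
        (Fin.cons true S' : Fin (n + 1) → Bool) =
      (∏ i, (w i 0).b) * (List.ofFn fun i => rowMatrix fun j => w i j.succ).prod S S' := by
  induction k generalizing S with
  | zero => simp [Matrix.one_apply]
  | succ k ih =>
    rw [List.ofFn_succ, List.ofFn_succ, List.prod_cons, List.prod_cons, Matrix.mul_apply,
      Matrix.mul_apply, ← Equiv.sum_comp (Fin.consEquiv fun _ => Bool), Fintype.sum_prod_type,
      Fintype.sum_bool]
    simp only [Fin.consEquiv, Equiv.coe_fn_mk, rowMatrix_cons_true, Fin.cons_zero, Fin.cons_succ,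
      if_true, Bool.false_eq_true, if_false, zero_mul, Finset.sum_const_zero, add_zero]
    rw [Fin.prod_univ_succ, Finset.mul_sum]
    refine Finset.sum_congr rfl fun T _ => ?_
    rw [ih (fun i => w i.succ)]
    ring

theorem prod_rowMatrix_snoc_true {k n : ℕ} (w : Fin k → Fin (n + 1) → CellWeights R)
    (S S' : Fin n → Bool) :
    (List.ofFn fun i => rowMatrix (w i)).prod (Fin.snoc S true : Fin (n + 1) → Bool)
        (Fin.snoc S' true : Fin (n + 1) → Bool) =
      (∏ i, (w i (Fin.last n)).a) *
        (List.ofFn fun i => rowMatrix fun j => w i j.castSucc).prod S S' := by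
  induction k generalizing S with
  | zero => simp [Matrix.one_apply]
  | succ k ih =>
    rw [List.ofFn_succ, List.ofFn_succ, List.prod_cons, List.prod_cons, Matrix.mul_apply,
      Matrix.mul_apply, ← Equiv.sum_comp (Fin.snocEquiv fun _ => Bool), Fintype.sum_prod_type,
      Fintype.sum_bool]
    simp only [Fin.snocEquiv, Equiv.coe_fn_mk, rowMatrix_snoc_true, Fin.snoc_last,
      Fin.snoc_castSucc,
      if_true, Bool.false_eq_true, if_false, zero_mul, Finset.sum_const_zero, add_zero]
    rw [Fin.prod_univ_succ, Finset.mul_sum]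
    refine Finset.sum_congr rfl fun T _ => ?_
    rw [ih (fun i => w i.succ)]
    ring

/-- If the weight `a` of the top left corner vanishes, the first row and column are frozen. -/
theorem sixVertexZ_of_a_eq_zero {n : ℕ} (W : Fin (n + 1) → Fin (n + 1) → CellWeights R)
    (h : (W 0 0).a = 0) :
    sixVertexZ W = (W 0 0).c * (∏ j : Fin n, (W 0 j.succ).b) * (∏ i : Fin n, (W i.succ 0).b) *
      sixVertexZ fun i j => W i.succ j.succ := by
  rw [sixVertexZ_eq_prod_rowMatrix, sixVertexZ_eq_prod_rowMatrix, List.ofFn_succ, List.prod_cons,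
    Matrix.mul_apply, Finset.sum_eq_single (Fin.cons true fun _ => false)]
  · have h1 : (fun _ => true : Fin (n + 1) → Bool) = Fin.cons true fun _ => true := by
      funext j
      cases j using Fin.cases <;> rfl
    rw [h1, prod_rowMatrix_cons_true (fun i => W i.succ), rowMatrix, Matrix.of_apply,
      List.ofFn_succ, List.prod_cons, Matrix.mul_apply, Fintype.sum_bool]
    simp only [Fin.cons_succ, Fin.cons_zero, prod_cellMatrix_false_true]
    simp [cellMatrix, cellWeight, mul_assoc]
  · intro S _ hS
    have : rowMatrix (W 0) (fun _ => false) S = 0 := by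
      rw [rowMatrix, Matrix.of_apply, List.ofFn_succ, List.prod_cons, Matrix.mul_apply,
        Fintype.sum_bool, prod_cellMatrix_false_true (fun j => W 0 j.succ) (fun j => S j.succ)]
      rcases hb : S 0 with _ | _
      · simp [cellMatrix, cellWeight, h]
      · rw [if_neg]
        · simp [cellMatrix, cellWeight]
        · intro h0
          refine hS ?_
          funext j
          cases j using Fin.cases with
          | zero => exact hb
          | succ j => exact congrFun h0 j
    rw [this, zero_mul]
  · simp

/-- If the weight `b` of the top right corner vanishes, the first row and the last column are
frozen. -/
theorem sixVertexZ_of_b_eq_zero {n : ℕ} (W : Fin (n + 1) → Fin (n + 1) → CellWeights R)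
    (h : (W 0 (Fin.last n)).b = 0) :
    sixVertexZ W = (W 0 (Fin.last n)).c * (∏ j : Fin n, (W 0 j.castSucc).a) *
      (∏ i : Fin n, (W i.succ (Fin.last n)).a) * sixVertexZ fun i j => W i.succ j.castSucc := by
  rw [sixVertexZ_eq_prod_rowMatrix, sixVertexZ_eq_prod_rowMatrix, List.ofFn_succ, List.prod_cons,
    Matrix.mul_apply, Finset.sum_eq_single (Fin.snoc (fun _ => false) true)]
  · have h1 : (fun _ => true : Fin (n + 1) → Bool) = Fin.snoc (fun _ => true) true := by
      funext j
      cases j using Fin.lastCases <;> simp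
    rw [h1, prod_rowMatrix_snoc_true (fun i => W i.succ), rowMatrix, Matrix.of_apply,
      List.ofFn_succ', List.prod_concat, Matrix.mul_apply, Fintype.sum_bool]
    simp only [Fin.snoc_castSucc, Fin.snoc_last, prod_cellMatrix_false_false]
    simp [cellMatrix, cellWeight]
    ring
  · intro S _ hS
    have : rowMatrix (W 0) (fun _ => false) S = 0 := by
      rw [rowMatrix, Matrix.of_apply, List.ofFn_succ', List.prod_concat, Matrix.mul_apply,
        Fintype.sum_bool,
        prod_cellMatrix_false_false (fun j => W 0 j.castSucc) (fun j => S j.castSucc)]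
      rcases hb : S (Fin.last n) with _ | _
      · simp [cellMatrix, cellWeight, h]
      · rw [if_neg]
        · simp [cellMatrix, cellWeight]
        · intro h0
          refine hS ?_
          funext j
          cases j using Fin.lastCases with
          | last => simpa using hb
          | cast j => simpa using congrFun h0 j
    rw [this, zero_mul]
  · simp

end Freezing

section CubicWeights

variable {ω : ℂ}

/-- Six-vertex weights at the combinatorial point; `ω` is a primitive cube root of unity. -/
noncomputable def cubicWeights (ω u v : ℂ) : CellWeights ℂ where
  a := ((1 - ω ^ 2) * u + (1 - ω) * v) / 3
  b := ((1 - ω) * u + (1 - ω ^ 2) * v) / 3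
  c := 1
  d := u * v

/-- The inhomogeneous domain wall partition function at the combinatorial point. -/
noncomputable def cubicZ (ω : ℂ) {n : ℕ} (u v : Fin n → ℂ) : ℂ :=
  sixVertexZ fun i j => cubicWeights ω (u i) (v j)

theorem intertwiner_rows (hω : ω ^ 2 + ω + 1 = 0) (u u' v : ℂ) (x y : Bool) :
    intertwiner (u - (1 - ω) * (u - u') / 3) u ((ω - ω ^ 2) * (u - u') / 3) u' *
        doubleCellMatrix (cubicWeights ω u v) (cubicWeights ω u' v) x y =
      doubleCellMatrix (cubicWeights ω u' v) (cubicWeights ω u v) x y *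
        intertwiner (u - (1 - ω) * (u - u') / 3) u ((ω - ω ^ 2) * (u - u') / 3) u' := by
  apply intertwiner_mul_doubleCellMatrix rfl rfl <;> simp only [cubicWeights] <;> grind

theorem intertwiner_columns (hω : ω ^ 2 + ω + 1 = 0) (v v' u : ℂ) (x y : Bool) :
    intertwiner (v - (ω ^ 2 - 1) * (v' - v) / 3) v ((ω - ω ^ 2) * (v' - v) / 3) v' *
        doubleCellMatrix (cubicWeights ω u v) (cubicWeights ω u v') x y =
      doubleCellMatrix (cubicWeights ω u v') (cubicWeights ω u v) x y *
        intertwiner (v - (ω ^ 2 - 1) * (v' - v) / 3) v ((ω - ω ^ 2) * (v' - v) / 3) v' := by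
  apply intertwiner_mul_doubleCellMatrix rfl rfl <;> simp only [cubicWeights] <;> grind

theorem continuous_cellWeight_cubicWeights {X : Type*} [TopologicalSpace X] {f g : X → ℂ}
    (hf : Continuous f) (hg : Continuous g) (h s h' s' : Bool) :
    Continuous fun x => cellWeight (cubicWeights ω (f x) (g x)) h s h' s' := by
  cases h <;> cases s <;> cases h' <;> cases s' <;> simp only [cellWeight, cubicWeights] <;>
    fun_prop

theorem continuous_rowMatrix_cubicWeights {n : ℕ} (v : Fin n → ℂ) :
    Continuous fun u => rowMatrix fun j => cubicWeights ω u (v j) := by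
  refine continuous_matrix fun S S' => ?_
  simp only [rowMatrix, Matrix.of_apply, prod_ofFn_apply_eq_sum_statePaths, cellMatrix]
  exact continuous_finsetSum _ fun p _ => continuous_finsetProd _ fun j _ =>
    continuous_cellWeight_cubicWeights continuous_id continuous_const _ _ _ _

theorem continuous_cubicZ {X : Type*} [TopologicalSpace X] {n : ℕ} {f g : X → Fin n → ℂ}
    (hf : Continuous f) (hg : Continuous g) : Continuous fun x => cubicZ ω (f x) (g x) := by
  unfold cubicZ sixVertexZ
  exact continuous_finsetSum _ fun h _ => continuous_finsetSum _ fun s _ =>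
    continuous_finsetProd _ fun i _ => continuous_finsetProd _ fun j _ =>
      continuous_cellWeight_cubicWeights (by fun_prop) (by fun_prop) _ _ _ _

theorem commute_rowMatrix_cubicWeights (hω : ω ^ 2 + ω + 1 = 0) {n : ℕ} (u u' : ℂ)
    (v : Fin n → ℂ) :
    Commute (rowMatrix fun j => cubicWeights ω u (v j))
      (rowMatrix fun j => cubicWeights ω u' (v j)) := by
  have hcont := continuous_rowMatrix_cubicWeights (ω := ω) v
  have key : Set.EqOn
      (fun u => (rowMatrix fun j => cubicWeights ω u (v j)) *
        rowMatrix fun j => cubicWeights ω u' (v j))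
      (fun u => (rowMatrix fun j => cubicWeights ω u' (v j)) *
        rowMatrix fun j => cubicWeights ω u (v j)) {ω * u'}ᶜ := by
    intro u hu
    ext S S'
    have h := mul_rowMatrix_mul_comm (fun j => intertwiner_rows hω u u' (v j)) S S'
    refine mul_left_cancel₀ ?_ h
    intro h0
    apply hu
    have : (2 + ω) * (u - ω * u') = 0 := by grind
    rcases mul_eq_zero.1 this with h2 | h2
    · grind
    · exact sub_eq_zero.1 h2
  have := Continuous.ext_on (dense_compl_singleton (ω * u')) (hcont.matrix_mul continuous_const)
    (continuous_const.matrix_mul hcont) key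
  exact congrFun this u

theorem cubicZ_perm_left (hω : ω ^ 2 + ω + 1 = 0) {n : ℕ} (u v : Fin n → ℂ)
    (σ : Equiv.Perm (Fin n)) : cubicZ ω (fun i => u (σ i)) v = cubicZ ω u v :=
  sixVertexZ_comp_perm (fun i j => cubicWeights ω (u i) (v j))
    (fun i j => commute_rowMatrix_cubicWeights hω (u i) (u j) v) σ

theorem cubicZ_perm_right (hω : ω ^ 2 + ω + 1 = 0) {n : ℕ} (u v : Fin n → ℂ)
    (hv : ∀ i j, v i ^ 3 = v j ^ 3 → i = j)
    (σ : Equiv.Perm (Fin n)) : cubicZ ω u (fun j => v (σ j)) = cubicZ ω u v := by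
  unfold cubicZ
  rw [← sixVertexZ_transpose, ← sixVertexZ_transpose (fun i j => cubicWeights ω (u i) (v j))]
  refine sixVertexZ_comp_perm (fun j i => cubicWeights ω (u i) (v j)) (fun j k => ?_) σ
  by_cases hjk : j = k
  · rw [hjk]
  · ext S S'
    have h := mul_rowMatrix_mul_comm (fun i => intertwiner_columns hω (v j) (v k) (u i)) S S'
    refine mul_left_cancel₀ ?_ h
    intro h0
    apply hjk
    apply hv
    grind

/-- The combination of `P(x)`, `P(ωx)`, `P(ω²x)` selecting the exponents congruent to `2`
modulo `3`. -/
noncomputable def cubicSum (ω : ℂ) (P : ℂ → ℂ) (x : ℂ) : ℂ :=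
  P x + ω * P (ω * x) + ω ^ 2 * P (ω ^ 2 * x)

theorem isPrimitiveRoot_three (hω : ω ^ 2 + ω + 1 = 0) : IsPrimitiveRoot ω 3 := by
  have h1 : ω ≠ 1 := by
    rintro rfl
    norm_num at hω
  have h3 : orderOf ω = 3 := orderOf_eq_prime (by linear_combination (ω - 1) * hω) h1
  exact h3 ▸ IsPrimitiveRoot.orderOf ω

theorem cubicSum_eq_zero_of_zeros (hω : ω ^ 2 + ω + 1 = 0) {n : ℕ} (P : Polynomial ℂ)
    (hP : P.natDegree ≤ 3 * n + 1) (v : Fin (n + 1) → ℂ) (hv0 : ∀ j, v j ≠ 0)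
    (hv : ∀ i j, v i ^ 3 = v j ^ 3 → i = j)
    (h : ∀ j, cubicSum ω (fun x => P.eval x) (v j) = 0) (x : ℂ) :
    cubicSum ω (fun x => P.eval x) x = 0 := by
  set G : Polynomial ℂ := P + Polynomial.C ω * P.comp (Polynomial.C ω * Polynomial.X) +
    Polynomial.C (ω ^ 2) * P.comp (Polynomial.C (ω ^ 2) * Polynomial.X) with hG
  have hGe : ∀ x, G.eval x = cubicSum ω (fun x => P.eval x) x := by
    intro x
    simp [hG, cubicSum]
  have hω3 : ω ^ 3 = 1 := (isPrimitiveRoot_three hω).pow_eq_one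
  have hdeg : ∀ z : ℂ, (P.comp (Polynomial.C z * Polynomial.X)).natDegree ≤ 3 * n + 1 := by
    intro z
    refine Polynomial.natDegree_comp_le.trans ?_
    have : (Polynomial.C z * Polynomial.X).natDegree ≤ 1 :=
      (Polynomial.natDegree_C_mul_le _ _).trans Polynomial.natDegree_X_le
    calc P.natDegree * (Polynomial.C z * Polynomial.X).natDegree
        ≤ P.natDegree * 1 := Nat.mul_le_mul_left _ this
      _ ≤ 3 * n + 1 := by omega
  have hGdeg : G.natDegree ≤ 3 * n + 1 := by
    refine Polynomial.natDegree_add_le_of_degree_le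
      (Polynomial.natDegree_add_le_of_degree_le hP ?_) ?_ <;>
    exact (Polynomial.natDegree_C_mul_le _ _).trans (hdeg _)
  have hG0 : G = 0 := by
    refine Polynomial.eq_zero_of_natDegree_lt_card_of_eval_eq_zero G
      (f := fun q : Fin 3 × Fin (n + 1) => ω ^ (q.1 : ℕ) * v q.2) ?_ ?_ ?_
    · rintro ⟨k, j⟩ ⟨k', j'⟩ hkj
      simp only at hkj
      have hc : v j ^ 3 = v j' ^ 3 := by
        have := congrArg (· ^ 3) hkj
        simpa only [mul_pow, ← pow_mul, mul_comm _ 3, pow_mul ω 3, hω3, one_pow, one_mul] using this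
      obtain rfl := hv _ _ hc
      have hk := mul_right_cancel₀ (hv0 j) hkj
      have : k = k' := Fin.ext ((isPrimitiveRoot_three hω).pow_inj k.2 k'.2 hk)
      rw [this]
    · rintro ⟨k, j⟩
      have h1 := h j
      simp only [hGe, cubicSum] at h1 ⊢
      fin_cases k
      · simpa using h1
      · have e1 : ω * (ω * v j) = ω ^ 2 * v j := by ring
        have e2 : ω ^ 2 * (ω * v j) = v j := by linear_combination v j * hω3
        simp only [pow_one, e1, e2]
        linear_combination ω ^ 2 * h1 - (P.eval (ω * v j) + ω * P.eval (ω ^ 2 * v j)) * hω3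
      · have e1 : ω * (ω ^ 2 * v j) = v j := by linear_combination v j * hω3
        have e2 : ω ^ 2 * (ω ^ 2 * v j) = ω * v j := by linear_combination ω * v j * hω3
        simp only [e1, e2]
        linear_combination ω * h1 - P.eval (ω ^ 2 * v j) * hω3
    · simp only [Fintype.card_prod, Fintype.card_fin]
      omega
  rw [← hGe, hG0, Polynomial.eval_zero]

end CubicWeights

section FunctionalEquation

variable {ω : ℂ}

theorem exists_polynomial_cellWeight (v : ℂ) (h s h' s' : Bool) :
    ∃ P : Polynomial ℂ, P.natDegree ≤ 1 + h.toNat - h'.toNat ∧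
      ∀ x, P.eval x = cellWeight (cubicWeights ω x v) h s h' s' := by
  have linear (p q : ℂ) : ∃ P : Polynomial ℂ, P.natDegree ≤ 1 ∧ ∀ x, P.eval x = p * x + q :=
    ⟨Polynomial.C p * Polynomial.X + Polynomial.C q, Polynomial.natDegree_linear_le, by simp⟩
  have ha : ∃ P : Polynomial ℂ, P.natDegree ≤ 1 ∧
      ∀ x, P.eval x = ((1 - ω ^ 2) * x + (1 - ω) * v) / 3 := by
    obtain ⟨P, hP, hPe⟩ := linear ((1 - ω ^ 2) / 3) ((1 - ω) * v / 3)
    exact ⟨P, hP, fun x => by rw [hPe]; ring⟩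
  have hb : ∃ P : Polynomial ℂ, P.natDegree ≤ 1 ∧
      ∀ x, P.eval x = ((1 - ω) * x + (1 - ω ^ 2) * v) / 3 := by
    obtain ⟨P, hP, hPe⟩ := linear ((1 - ω) / 3) ((1 - ω ^ 2) * v / 3)
    exact ⟨P, hP, fun x => by rw [hPe]; ring⟩
  have hd : ∃ P : Polynomial ℂ, P.natDegree ≤ 2 ∧ ∀ x, P.eval x = x * v := by
    obtain ⟨P, hP, hPe⟩ := linear v 0
    exact ⟨P, hP.trans one_le_two, fun x => by rw [hPe]; ring⟩
  have h0 (d : ℕ) : ∃ P : Polynomial ℂ, P.natDegree ≤ d ∧ ∀ x, P.eval x = 0 := ⟨0, by simp⟩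
  cases h <;> cases s <;> cases h' <;> cases s' <;> simp only [cellWeight, cubicWeights] <;>
    first
    | exact h0 _
    | exact ha
    | exact hb
    | exact hd
    | exact ⟨1, by simp⟩

theorem exists_polynomial_prod_cellWeight {n : ℕ} (v : Fin (n + 1) → ℂ)
    {h : Fin (n + 2) → Bool} (hh : h ∈ statePaths (n + 1) false true) (s s' : Fin (n + 1) → Bool) :
    ∃ P : Polynomial ℂ, P.natDegree ≤ n ∧
      ∀ x, P.eval x =
        ∏ j, cellWeight (cubicWeights ω x (v j)) (h j.castSucc) (s j) (h j.succ) (s' j) := by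
  choose P hP hPe using fun j =>
    exists_polynomial_cellWeight (ω := ω) (v j) (h j.castSucc) (s j) (h j.succ) (s' j)
  refine ⟨∏ j, P j, ?_, fun x => by simp [Polynomial.eval_prod, hPe]⟩
  refine (Polynomial.natDegree_prod_le _ _).trans ((Finset.sum_le_sum fun j _ => hP j).trans ?_)
  rw [mem_statePaths] at hh
  have h1 : ∀ j : Fin (n + 1), (1 + (h j.castSucc).toNat - (h j.succ).toNat) + (h j.succ).toNat =
      1 + (h j.castSucc).toNat := fun j => by
    have := Bool.toNat_le (h j.succ)
    omega
  have h2 := Finset.sum_congr (rfl : (Finset.univ : Finset (Fin (n + 1))) = _) fun j _ => h1 j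
  rw [Finset.sum_add_distrib, Finset.sum_add_distrib] at h2
  have h3 := Fin.sum_univ_succ fun j => (h j).toNat
  have h4 := Fin.sum_univ_castSucc fun j => (h j).toNat
  rw [h3, hh.1, hh.2] at h4
  simp at h2 h4
  omega

theorem exists_polynomial_cubicZ {n : ℕ} (u : Fin n → ℂ) (v : Fin (n + 1) → ℂ) :
    ∃ P : Polynomial ℂ, P.natDegree ≤ n ∧
      ∀ x, P.eval x = cubicZ ω (Fin.cons x u : Fin (n + 1) → ℂ) v := by
  have hrow : ∀ h s : Fin (n + 1) → Fin (n + 2) → Bool, ∃ P : Polynomial ℂ,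
      h 0 ∈ statePaths (n + 1) false true → P.natDegree ≤ n ∧ ∀ x, P.eval x =
        ∏ j, cellWeight (cubicWeights ω x (v j)) (h 0 j.castSucc) (s j 0) (h 0 j.succ)
          (s j 1) := by
    intro h s
    by_cases hh : h 0 ∈ statePaths (n + 1) false true
    · obtain ⟨P, hP⟩ := exists_polynomial_prod_cellWeight (ω := ω) v hh (fun j => s j 0)
        (fun j => s j 1)
      exact ⟨P, fun _ => hP⟩
    · exact ⟨0, fun h0 => absurd h0 hh⟩
  choose P hP using hrow
  refine ⟨∑ h ∈ Fintype.piFinset fun _ : Fin (n + 1) => statePaths (n + 1) false true,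
    ∑ s ∈ Fintype.piFinset fun _ : Fin (n + 1) => statePaths (n + 1) false true,
      P h s * Polynomial.C (∏ i : Fin n, ∏ j, cellWeight (cubicWeights ω (u i) (v j))
        (h i.succ j.castSucc) (s j i.succ.castSucc) (h i.succ j.succ) (s j i.succ.succ)), ?_, ?_⟩
  · refine Polynomial.natDegree_sum_le_of_forall_le _ _ fun h hh =>
      Polynomial.natDegree_sum_le_of_forall_le _ _ fun s _ => ?_
    exact (Polynomial.natDegree_mul_C_le _ _).trans (hP h s (Fintype.mem_piFinset.1 hh 0)).1
  · intro x
    simp only [Polynomial.eval_finsetSum, cubicZ, sixVertexZ]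
    refine Finset.sum_congr rfl fun h hh => Finset.sum_congr rfl fun s _ => ?_
    rw [Polynomial.eval_mul, Polynomial.eval_C, (hP h s (Fintype.mem_piFinset.1 hh 0)).2]
    exact (Fin.prod_univ_succ fun i : Fin (n + 1) => ∏ j, cellWeight
      (cubicWeights ω ((Fin.cons x u : Fin (n + 1) → ℂ) i) (v j)) (h i j.castSucc)
      (s j i.castSucc) (h i j.succ) (s j i.succ)).symm

theorem cubicZ_cons_insertNth (hω : ω ^ 2 + ω + 1 = 0) {n : ℕ} (i : Fin (n + 1)) (x : ℂ)
    (u : Fin n → ℂ) (v : Fin (n + 1) → ℂ) :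
    cubicZ ω (Fin.insertNth i x u : Fin (n + 1) → ℂ) v =
      cubicZ ω (Fin.cons x u : Fin (n + 1) → ℂ) v := by
  rw [← cubicZ_perm_left hω _ v i.cycleRange.symm]
  congr 1
  funext k
  cases k using Fin.cases <;> simp

theorem cubicZ_of_eq_mul (hω : ω ^ 2 + ω + 1 = 0) {n : ℕ} (u : Fin n → ℂ) (v : Fin (n + 1) → ℂ)
    (hv : ∀ i j, v i ^ 3 = v j ^ 3 → i = j) (j : Fin (n + 1)) :
    cubicZ ω (Fin.cons (ω * v j) u : Fin (n + 1) → ℂ) v =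
      (∏ l, (cubicWeights ω (ω * v j) (v (j.succAbove l))).b) *
        (∏ i, (cubicWeights ω (u i) (v j)).b) * cubicZ ω u fun l => v (j.succAbove l) := by
  rw [← cubicZ_perm_right hω _ v hv j.cycleRange.symm, cubicZ, sixVertexZ_of_a_eq_zero]
  · simp [cubicWeights, cubicZ]
  · simp only [cubicWeights, Fin.cons_zero, Fin.cycleRange_symm_zero]
    grind

theorem cubicZ_of_eq_sq_mul (hω : ω ^ 2 + ω + 1 = 0) {n : ℕ} (u : Fin n → ℂ)
    (v : Fin (n + 1) → ℂ) (hv : ∀ i j, v i ^ 3 = v j ^ 3 → i = j) (j : Fin (n + 1)) :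
    cubicZ ω (Fin.cons (ω ^ 2 * v j) u : Fin (n + 1) → ℂ) v =
      (∏ l, (cubicWeights ω (ω ^ 2 * v j) (v (j.succAbove l))).a) *
        (∏ i, (cubicWeights ω (u i) (v j)).a) * cubicZ ω u fun l => v (j.succAbove l) := by
  rw [← cubicZ_perm_right hω _ v hv ((finRotate (n + 1)).trans j.cycleRange.symm), cubicZ,
    sixVertexZ_of_b_eq_zero]
  · simp [cubicWeights, cubicZ]
  · simp only [cubicWeights, Fin.cons_zero, Equiv.trans_apply, finRotate_last,
      Fin.cycleRange_symm_zero]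
    grind

theorem cubicSum_cubicZ_of_injective (hω : ω ^ 2 + ω + 1 = 0) {n : ℕ} (u : Fin n → ℂ)
    (v : Fin (n + 1) → ℂ) (hv0 : ∀ j, v j ≠ 0) (hv : ∀ i j, v i ^ 3 = v j ^ 3 → i = j) (x : ℂ) :
    cubicSum ω (fun x => cubicZ ω (Fin.cons x u : Fin (n + 1) → ℂ) v *
      (∏ j, (x - v j)) * ∏ i, (x - u i)) x = 0 := by
  obtain ⟨P, hP, hPe⟩ := exists_polynomial_cubicZ (ω := ω) u v
  have hQe : (fun x => cubicZ ω (Fin.cons x u : Fin (n + 1) → ℂ) v *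
      (∏ j, (x - v j)) * ∏ i, (x - u i)) =
      fun x => (P * (∏ j, (Polynomial.X - Polynomial.C (v j))) *
        ∏ i, (Polynomial.X - Polynomial.C (u i))).eval x := by
    funext x
    simp [Polynomial.eval_prod, hPe]
  rw [hQe]
  refine cubicSum_eq_zero_of_zeros hω _ ?_ v hv0 hv (fun j => ?_) x
  · refine Polynomial.natDegree_mul_le_of_le (m := n + (n + 1)) (n := n)
      (Polynomial.natDegree_mul_le_of_le (m := n) (n := n + 1) hP ?_) ?_ |>.trans (by omega)
    · rw [Polynomial.natDegree_finsetProd_X_sub_C_eq_card]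
      simp
    · rw [Polynomial.natDegree_finsetProd_X_sub_C_eq_card]
      simp
  · rw [← hQe]
    simp only [cubicSum, cubicZ_of_eq_mul hω u v hv, cubicZ_of_eq_sq_mul hω u v hv]
    rw [Fin.prod_univ_succAbove _ j, Fin.prod_univ_succAbove _ j, Fin.prod_univ_succAbove _ j]
    have e1 : (∏ l, (cubicWeights ω (ω * v j) (v (j.succAbove l))).b) *
        (∏ l, (ω * v j - v (j.succAbove l))) = ((1 - ω ^ 2) / 3) ^ n *
          ∏ l, (v (j.succAbove l) - ω ^ 2 * v j) * (ω * v j - v (j.succAbove l)) := by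
      conv_rhs => rw [← Fin.prod_const, ← Finset.prod_mul_distrib]
      rw [← Finset.prod_mul_distrib]
      refine Finset.prod_congr rfl fun l _ => ?_
      simp only [cubicWeights]
      grind
    have e2 : (∏ l, (cubicWeights ω (ω ^ 2 * v j) (v (j.succAbove l))).a) *
        (∏ l, (ω ^ 2 * v j - v (j.succAbove l))) = ((1 - ω) / 3) ^ n *
          ∏ l, (v (j.succAbove l) - ω ^ 2 * v j) * (ω * v j - v (j.succAbove l)) := by
      conv_rhs => rw [← Fin.prod_const, ← Finset.prod_mul_distrib]
      rw [← Finset.prod_mul_distrib]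
      refine Finset.prod_congr rfl fun l _ => ?_
      simp only [cubicWeights]
      grind
    have e3 : (∏ i, (cubicWeights ω (u i) (v j)).b) * (∏ i, (ω * v j - u i)) =
        ((1 - ω) / 3) ^ n * ∏ i, (u i - ω ^ 2 * v j) * (ω * v j - u i) := by
      conv_rhs => rw [← Fin.prod_const, ← Finset.prod_mul_distrib]
      rw [← Finset.prod_mul_distrib]
      refine Finset.prod_congr rfl fun l _ => ?_
      simp only [cubicWeights]
      grind
    have e4 : (∏ i, (cubicWeights ω (u i) (v j)).a) * (∏ i, (ω ^ 2 * v j - u i)) =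
        ((1 - ω ^ 2) / 3) ^ n * ∏ i, (u i - ω ^ 2 * v j) * (ω * v j - u i) := by
      conv_rhs => rw [← Fin.prod_const, ← Finset.prod_mul_distrib]
      rw [← Finset.prod_mul_distrib]
      refine Finset.prod_congr rfl fun l _ => ?_
      simp only [cubicWeights]
      grind
    rw [sub_self, zero_mul, mul_zero, zero_mul, zero_add]
    set K := cubicZ ω u fun l => v (j.succAbove l)
    have hc : ω * (ω * v j - v j) + ω ^ 2 * (ω ^ 2 * v j - v j) = 0 := by grind
    calc _ = ω * (ω * v j - v j) * K * (((∏ l, (cubicWeights ω (ω * v j) (v (j.succAbove l))).b) *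
        (∏ l, (ω * v j - v (j.succAbove l)))) * ((∏ i, (cubicWeights ω (u i) (v j)).b) *
          (∏ i, (ω * v j - u i)))) + ω ^ 2 * (ω ^ 2 * v j - v j) * K *
          (((∏ l, (cubicWeights ω (ω ^ 2 * v j) (v (j.succAbove l))).a) *
        (∏ l, (ω ^ 2 * v j - v (j.succAbove l)))) * ((∏ i, (cubicWeights ω (u i) (v j)).a) *
          (∏ i, (ω ^ 2 * v j - u i)))) := by ring
      _ = 0 := by
        rw [e1, e2, e3, e4]
        linear_combination K * ((1 - ω ^ 2) / 3) ^ n * ((1 - ω) / 3) ^ n *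
          (∏ l, (v (j.succAbove l) - ω ^ 2 * v j) * (ω * v j - v (j.succAbove l))) *
          (∏ i, (u i - ω ^ 2 * v j) * (ω * v j - u i)) * hc

/-- The functional equation of the partition function in one spectral parameter, at the
homogeneous column parameters. -/
theorem cubicSum_cubicZ (hω : ω ^ 2 + ω + 1 = 0) {n : ℕ} (u : Fin n → ℂ) (x : ℂ) :
    cubicSum ω (fun x => cubicZ ω (Fin.cons x u : Fin (n + 1) → ℂ) (fun _ => 1) *
      (x - 1) ^ (n + 1) * ∏ i, (x - u i)) x = 0 := by
  set V : ℝ → Fin (n + 1) → ℂ := fun ε j => 1 + ε * (j : ℕ) with hV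
  have hVc : Continuous V := by fun_prop
  set F : ℝ → ℂ := fun ε => cubicSum ω (fun x => cubicZ ω (Fin.cons x u : Fin (n + 1) → ℂ) (V ε) *
      (∏ j, (x - V ε j)) * ∏ i, (x - u i)) x with hF
  have hFc : Continuous F := by
    have := fun y : ℂ => continuous_cubicZ (ω := ω)
      (continuous_const : Continuous fun _ : ℝ => (Fin.cons y u : Fin (n + 1) → ℂ)) hVc
    simp only [hF, cubicSum]
    fun_prop
  have h0 : ∀ ε ∈ Set.Ioi (0 : ℝ), F ε = 0 := by
    intro ε hε
    have hε : 0 < ε := hε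
    refine cubicSum_cubicZ_of_injective hω u (V ε) (fun j => ?_) (fun i j hij => ?_) x
    · have : (1 + ε * (j : ℕ) : ℝ) ≠ 0 := by positivity
      simpa [hV] using mod_cast this
    · have h3 : (1 + ε * (i : ℕ) : ℝ) ^ 3 = (1 + ε * (j : ℕ)) ^ 3 := by
        simp only [hV] at hij
        exact_mod_cast hij
      have := (pow_left_inj₀ (by positivity) (by positivity) (by norm_num)).1 h3
      exact Fin.ext (by exact_mod_cast mul_left_cancel₀ hε.ne' (add_left_cancel this))
  have : F 0 = 0 := by
    have hcl : IsClosed {ε : ℝ | F ε = 0} := isClosed_eq hFc continuous_const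
    have := closure_minimal h0 hcl
    rw [closure_Ioi] at this
    exact this Set.self_mem_Ici
  simpa [hF, hV, Finset.prod_const] using this

end FunctionalEquation

section EdgeIntegral

/-- The weighted integral of `y ^ n` along the segment from `b` to `a`. -/
noncomputable def edgeIntegral (n : ℕ) (a b : ℂ) : ℂ :=
  ∫ p in (0 : ℝ)..1, ((1 - p) * b + p * a) ^ n * (p * (1 - p)) ^ n

theorem edgeIntegral_mul (n : ℕ) (r a b : ℂ) :
    edgeIntegral n (r * a) (r * b) = r ^ n * edgeIntegral n a b := by
  rw [edgeIntegral, edgeIntegral, ← intervalIntegral.integral_const_mul]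
  refine intervalIntegral.integral_congr fun p _ => ?_
  have : (1 - (p : ℂ)) * (r * b) + p * (r * a) = r * ((1 - p) * b + p * a) := by ring
  simp only [this, mul_pow]
  ring

theorem exists_derivative_eq (P : Polynomial ℂ) : ∃ Q : Polynomial ℂ, Q.derivative = P := by
  induction P using Polynomial.induction_on' with
  | add p q hp hq =>
    obtain ⟨p', rfl⟩ := hp
    obtain ⟨q', rfl⟩ := hq
    exact ⟨p' + q', by simp⟩
  | monomial k a =>
    refine ⟨Polynomial.monomial (k + 1) (a / (k + 1)), ?_⟩
    rw [Polynomial.derivative_monomial, Nat.add_sub_cancel]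
    congr 1
    push_cast
    exact div_mul_cancel₀ _ (Nat.cast_add_one_ne_zero k)

theorem sub_pow_mul_edgeIntegral (n : ℕ) (a b c : ℂ) {Γ : Polynomial ℂ}
    (hΓ : ∀ z, Γ.derivative.eval z = ((z - a) * (z - b) * (z - c)) ^ n) :
    (a - b) ^ (2 * n + 1) * edgeIntegral n (a - c) (b - c) =
      (-1) ^ n * (Γ.eval a - Γ.eval b) := by
  have h1 : ∀ p ∈ Set.uIcc (0 : ℝ) 1, HasDerivAt (fun p : ℝ => Γ.eval (b + p * (a - b)))
      (((b + p * (a - b) - a) * (b + p * (a - b) - b) * (b + p * (a - b) - c)) ^ n *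
        (a - b)) p := by
    intro p _
    rw [← hΓ]
    have h2 : HasDerivAt (fun p : ℝ => b + (p : ℂ) * (a - b)) (a - b) p := by
      simpa using (((hasDerivAt_id p).ofReal_comp.mul_const (a - b)).const_add b)
    exact (Γ.hasDerivAt _).comp p h2
  have h3 := intervalIntegral.integral_eq_sub_of_hasDerivAt h1
    (Continuous.intervalIntegrable (by fun_prop) _ _)
  simp only [Complex.ofReal_one, one_mul, Complex.ofReal_zero, zero_mul, add_zero,
    add_sub_cancel] at h3
  rw [← h3, edgeIntegral, ← intervalIntegral.integral_const_mul,
    ← intervalIntegral.integral_const_mul]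
  refine intervalIntegral.integral_congr fun p _ => ?_
  have h4 : (b + p * (a - b) - a) * (b + p * (a - b) - b) * (b + p * (a - b) - c) =
      (-1) * (a - b) ^ 2 * (((1 - p) * (b - c) + p * (a - c)) * (p * (1 - p))) := by ring
  simp only [h4, mul_pow _ _ n, ← pow_mul]
  have h5 : ((-1 : ℂ) ^ n) * (-1) ^ n = 1 := by rw [← mul_pow]; simp
  linear_combination (-((a - b) ^ (2 * n + 1)) * ((1 - p) * (b - c) + p * (a - c)) ^ n *
    (p ^ n * (1 - p) ^ n)) * h5

theorem edgeIntegral_triangle (n : ℕ) (a b : ℂ) :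
    (a - b) ^ (2 * n + 1) * edgeIntegral n a b + b ^ (2 * n + 1) * edgeIntegral n (b - a) (-a) +
      (-a) ^ (2 * n + 1) * edgeIntegral n (-b) (a - b) = 0 := by
  obtain ⟨Γ, hΓ⟩ := exists_derivative_eq ((Polynomial.X * (Polynomial.X - Polynomial.C a) *
    (Polynomial.X - Polynomial.C b)) ^ n)
  have hΓ' : ∀ z, Γ.derivative.eval z = (z * (z - a) * (z - b)) ^ n := fun z => by simp [hΓ]
  have h1 := sub_pow_mul_edgeIntegral n a b 0 (Γ := Γ) fun z => by rw [hΓ']; ring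
  have h2 := sub_pow_mul_edgeIntegral n b 0 a (Γ := Γ) fun z => by rw [hΓ']; ring
  have h3 := sub_pow_mul_edgeIntegral n 0 a b (Γ := Γ) fun z => by rw [hΓ']; ring
  simp only [sub_zero, zero_sub] at h1 h2 h3
  rw [h1, h2, h3]
  ring

variable {ω : ℂ}

/-- The one-variable partition function with its prefactor, as a function of the spectral
parameter. -/
noncomputable def edgeFun (ω : ℂ) (n : ℕ) (x : ℂ) : ℂ :=
  (x - 1) ^ (2 * n + 1) * edgeIntegral n (cubicWeights ω x 1).a (cubicWeights ω x 1).b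

theorem cubicSum_edgeFun (hω : ω ^ 2 + ω + 1 = 0) (n : ℕ) (x : ℂ) :
    cubicSum ω (edgeFun ω n) x = 0 := by
  set a := (cubicWeights ω x 1).a with ha
  set b := (cubicWeights ω x 1).b with hb
  have h3 : ω ^ 3 = 1 := by linear_combination (ω - 1) * hω
  simp only [cubicWeights] at ha hb
  have e1 : edgeIntegral n (cubicWeights ω (ω * x) 1).a (cubicWeights ω (ω * x) 1).b =
      (ω ^ 2) ^ n * edgeIntegral n (b - a) (-a) := by
    rw [← edgeIntegral_mul]
    congr 1 <;> simp only [cubicWeights, ha, hb] <;> grind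
  have e2 : edgeIntegral n (cubicWeights ω (ω ^ 2 * x) 1).a (cubicWeights ω (ω ^ 2 * x) 1).b =
      ω ^ n * edgeIntegral n (-b) (a - b) := by
    rw [← edgeIntegral_mul]
    congr 1 <;> simp only [cubicWeights, ha, hb] <;> grind
  have hk : ω * (1 - ω) ≠ 0 := by
    intro h
    have : (3 : ℂ) = 0 := by linear_combination (2 + ω) * ω ^ 2 * h + ω ^ 3 * hω - 3 * h3
    norm_num at this
  set κ := ω * (1 - ω) / 3 with hκ
  have d0 : κ * (x - 1) = a - b := by simp only [ha, hb, hκ]; ring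
  have d1 : κ * (ω * x - 1) = ω ^ 2 * b := by simp only [hb, hκ]; grind
  have d2 : κ * (ω ^ 2 * x - 1) = ω * (-a) := by simp only [ha, hκ]; grind
  have hκ0 : κ ^ (2 * n + 1) ≠ 0 := pow_ne_zero _ (div_ne_zero hk (by norm_num))
  apply mul_left_cancel₀ hκ0
  rw [mul_zero]
  simp only [cubicSum, edgeFun, e1, e2]
  have h6 : (ω ^ 2) ^ (2 * n + 1) * (ω ^ 2) ^ n = ω ^ 2 := by
    calc _ = (ω ^ 3) ^ (2 * n) * ω ^ 2 := by ring
      _ = _ := by rw [h3]; ring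
  have h7 : ω ^ (2 * n + 1) * ω ^ n = ω := by
    calc _ = (ω ^ 3) ^ n * ω := by ring
      _ = _ := by rw [h3]; ring
  calc _ = (κ * (x - 1)) ^ (2 * n + 1) * edgeIntegral n a b +
        ω * (κ * (ω * x - 1)) ^ (2 * n + 1) * ((ω ^ 2) ^ n * edgeIntegral n (b - a) (-a)) +
        ω ^ 2 * (κ * (ω ^ 2 * x - 1)) ^ (2 * n + 1) * (ω ^ n * edgeIntegral n (-b) (a - b)) := by
        simp only [mul_pow κ]; ring
    _ = (a - b) ^ (2 * n + 1) * edgeIntegral n a b +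
        ω * ((ω ^ 2) ^ (2 * n + 1) * (ω ^ 2) ^ n) * b ^ (2 * n + 1) *
          edgeIntegral n (b - a) (-a) +
        ω ^ 2 * (ω ^ (2 * n + 1) * ω ^ n) * (-a) ^ (2 * n + 1) *
          edgeIntegral n (-b) (a - b) := by
        rw [d0, d1, d2, mul_pow _ b, mul_pow _ (-a)]; ring
    _ = 0 := by
        rw [h6, h7]
        linear_combination edgeIntegral_triangle n a b + (b ^ (2 * n + 1) *
          edgeIntegral n (b - a) (-a) + (-a) ^ (2 * n + 1) * edgeIntegral n (-b) (a - b)) * h3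

theorem exists_polynomial_edgeIntegral (n : ℕ) (p q r s : ℂ) :
    ∃ P : Polynomial ℂ, P.natDegree ≤ n ∧
      ∀ x, P.eval x = edgeIntegral n (p * x + q) (r * x + s) := by
  set L : Polynomial ℂ := Polynomial.C p * Polynomial.X + Polynomial.C q
  set M : Polynomial ℂ := Polynomial.C r * Polynomial.X + Polynomial.C s
  refine ⟨∑ k ∈ Finset.range (n + 1), L ^ k * M ^ (n - k) * Polynomial.C
    (∫ t in (0 : ℝ)..1, ((t : ℂ) ^ k * (1 - t) ^ (n - k) * n.choose k * (t * (1 - t)) ^ n)), ?_, ?_⟩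
  · refine Polynomial.natDegree_sum_le_of_forall_le _ _ fun k hk => ?_
    refine (Polynomial.natDegree_mul_C_le _ _).trans ?_
    have hk : k ≤ n := Finset.mem_range_succ_iff.1 hk
    refine (Polynomial.natDegree_mul_le_of_le
      (Polynomial.natDegree_pow_le_of_le k Polynomial.natDegree_linear_le)
      (Polynomial.natDegree_pow_le_of_le (n - k) Polynomial.natDegree_linear_le)).trans ?_
    omega
  · intro x
    simp only [Polynomial.eval_finsetSum, Polynomial.eval_mul, Polynomial.eval_C,
      Polynomial.eval_pow, edgeIntegral]
    simp only [← intervalIntegral.integral_const_mul]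
    rw [← intervalIntegral.integral_finsetSum
      fun k _ => Continuous.intervalIntegrable (by fun_prop) _ _]
    refine intervalIntegral.integral_congr fun t _ => ?_
    rw [add_comm ((1 - (t : ℂ)) * _), add_pow, Finset.sum_mul]
    refine Finset.sum_congr rfl fun k _ => ?_
    simp only [L, M, Polynomial.eval_add, Polynomial.eval_mul, Polynomial.eval_C,
      Polynomial.eval_X, mul_pow]
    ring

theorem exists_polynomial_cubic_edgeIntegral (ω : ℂ) (n : ℕ) :
    ∃ P : Polynomial ℂ, P.natDegree ≤ n ∧ ∀ x, P.eval x =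
      edgeIntegral n (cubicWeights ω x 1).a (cubicWeights ω x 1).b := by
  obtain ⟨P, hP, hPe⟩ := exists_polynomial_edgeIntegral n ((1 - ω ^ 2) / 3) ((1 - ω) / 3)
    ((1 - ω) / 3) ((1 - ω ^ 2) / 3)
  refine ⟨P, hP, fun x => ?_⟩
  rw [hPe]
  simp only [cubicWeights]
  congr 1 <;> ring

theorem edgeIntegral_one_one_pos (n : ℕ) : ∃ r : ℝ, 0 < r ∧ edgeIntegral n 1 1 = r := by
  refine ⟨∫ p in (0 : ℝ)..1, (p * (1 - p)) ^ n, ?_, ?_⟩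
  · refine intervalIntegral.intervalIntegral_pos_of_pos_on
      (Continuous.intervalIntegrable (by fun_prop) _ _) (fun p hp => ?_) one_pos
    have := hp.1
    have := sub_pos.2 hp.2
    positivity
  · rw [← intervalIntegral.integral_ofReal, edgeIntegral]
    refine intervalIntegral.integral_congr fun p _ => ?_
    simp

theorem continuous_edgeIntegral (n : ℕ) (b : ℂ) : Continuous fun a => edgeIntegral n a b := by
  obtain ⟨P, -, hP⟩ := exists_polynomial_edgeIntegral n 1 0 0 b
  have : (fun a => edgeIntegral n a b) = fun x => P.eval x := by
    funext x
    simp [hP]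
  rw [this]
  exact P.continuous

end EdgeIntegral

section FunctionalEquationSolutions

open Polynomial in
/-- A polynomial vanishing at `1` to an order at least its number of terms is zero. -/
theorem eq_zero_of_card_support_le_of_dvd {d : ℕ} :
    ∀ f : Polynomial ℂ, f.support.card ≤ d → (X - 1) ^ d ∣ f → f = 0 := by
  induction d with
  | zero =>
    intro f hf _
    exact Polynomial.support_eq_empty.1 (Finset.card_eq_zero.1 (Nat.le_zero.1 hf))
  | succ d ih =>
    rintro f hf ⟨g, rfl⟩
    set f := (X - 1) ^ (d + 1) * g with hfg
    by_contra hne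
    obtain ⟨j, hj⟩ := Polynomial.support_nonempty.2 hne
    set T := X * derivative f - C (j : ℂ) * f with hT
    have hcoeff : ∀ k, T.coeff k = ((k : ℂ) - j) * f.coeff k := by
      intro k
      rw [hT, coeff_sub, coeff_C_mul, mul_comm X]
      cases k with
      | zero => simp
      | succ k => rw [coeff_mul_X, coeff_derivative]; push_cast; ring
    have hT0 : T = 0 := by
      refine ih T ?_ ⟨X * (C ((d : ℂ) + 1) * g + (X - 1) * derivative g) -
        C (j : ℂ) * ((X - 1) * g), ?_⟩
      · have hsub : T.support ⊆ f.support.erase j := by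
          intro k hk
          rw [Polynomial.mem_support_iff, hcoeff] at hk
          rw [Finset.mem_erase, Polynomial.mem_support_iff]
          refine ⟨?_, right_ne_zero_of_mul hk⟩
          rintro rfl
          simp at hk
        have := Finset.card_le_card hsub
        rw [Finset.card_erase_of_mem hj] at this
        omega
      · rw [hT, hfg, derivative_mul, derivative_pow]
        simp only [Nat.cast_add, Nat.cast_one, Nat.add_sub_cancel, derivative_sub, derivative_X,
          derivative_one, map_add, map_one]
        ring
    have hmon : ∀ k, k ≠ j → f.coeff k = 0 := by
      intro k hk
      have := hcoeff k
      rw [hT0, coeff_zero, eq_comm, mul_eq_zero, sub_eq_zero] at this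
      exact this.resolve_left (by exact_mod_cast hk)
    have hf1 : f = monomial j (f.coeff j) := by
      ext k
      rw [coeff_monomial]
      split_ifs with h
      · rw [h]
      · exact hmon k (Ne.symm h)
    have h1 : f.eval 1 = 0 := by simp [hfg]
    rw [hf1, eval_monomial, one_pow, mul_one] at h1
    exact (Polynomial.mem_support_iff.1 hj) h1

variable {ω : ℂ}

open Polynomial in
theorem coeff_eq_zero_of_cubicSum (hω : ω ^ 2 + ω + 1 = 0) (f : Polynomial ℂ)
    (hf : ∀ x, cubicSum ω (fun x => f.eval x) x = 0) (j : ℕ) : f.coeff (3 * j + 2) = 0 := by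
  have h0 : f + C ω * f.comp (C ω * X) + C (ω ^ 2) * f.comp (C (ω ^ 2) * X) = 0 := by
    refine Polynomial.funext fun x => ?_
    simpa [cubicSum] using hf x
  have h1 := congrArg (fun P => P.coeff (3 * j + 2)) h0
  simp only [coeff_add, coeff_C_mul, comp_C_mul_X_coeff, coeff_zero] at h1
  have h3 : ω ^ 3 = 1 := (isPrimitiveRoot_three hω).pow_eq_one
  have e1 : ω ^ (3 * j + 2) = ω ^ 2 := by rw [pow_add, pow_mul, h3, one_pow, one_mul]
  have e2 : (ω ^ 2) ^ (3 * j + 2) = ω := by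
    rw [← pow_mul, mul_comm, pow_mul, e1]
    linear_combination ω * h3
  rw [e1, e2] at h1
  have : 3 * f.coeff (3 * j + 2) = 0 := by
    linear_combination h1 - 2 * f.coeff (3 * j + 2) * h3
  exact (mul_eq_zero.1 this).resolve_left (by norm_num)

theorem cubicWeights_one_one (hω : ω ^ 2 + ω + 1 = 0) : (cubicWeights ω 1 1).a = 1 ∧
    (cubicWeights ω 1 1).b = 1 := by
  simp only [cubicWeights]
  constructor <;> linear_combination (-1 / 3) * hω

theorem cubicSum_cube_mul (hω : ω ^ 2 + ω + 1 = 0) (g f : ℂ → ℂ) (x : ℂ) :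
    cubicSum ω (fun x => g (x ^ 3) * f x) x = g (x ^ 3) * cubicSum ω f x := by
  have h3 : ω ^ 3 = 1 := (isPrimitiveRoot_three hω).pow_eq_one
  have e1 : (ω * x) ^ 3 = x ^ 3 := by rw [mul_pow, h3, one_mul]
  have e2 : (ω ^ 2 * x) ^ 3 = x ^ 3 := by
    rw [mul_pow, ← pow_mul, mul_comm 2 3, pow_mul ω 3, h3]
    ring
  simp only [cubicSum, e1, e2]
  ring

open Polynomial in
/-- The solutions of the functional equation with a zero of high order at `1` are combinations
of the functions `(x ^ 3 - 1) ^ k * edgeFun ω (N - 1 - k) x`. -/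
theorem exists_eq_sum_edgeFun (hω : ω ^ 2 + ω + 1 = 0) {N : ℕ} {m : ℕ} : m ≤ N →
    ∀ f : Polynomial ℂ, f.natDegree + 2 ≤ 3 * N → (∀ x, cubicSum ω (fun x => f.eval x) x = 0) →
    (X - 1) ^ (2 * N - m) ∣ f →
    ∃ c : ℕ → ℂ, ∀ x, f.eval x =
      ∑ k ∈ Finset.range m, c k * ((x ^ 3 - 1) ^ k * edgeFun ω (N - 1 - k) x) := by
  induction m with
  | zero =>
    intro _ f hdeg hf hd
    have hf0 : f = 0 := by
      refine eq_zero_of_card_support_le_of_dvd f ?_ hd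
      have hsub : f.support ⊆ ((Finset.range N).image fun j => 3 * j) ∪
          (Finset.range N).image fun j => 3 * j + 1 := by
        intro k hk
        have hk1 := Polynomial.le_natDegree_of_mem_supp k hk
        have hk2 : k % 3 ≠ 2 := by
          intro h
          have := coeff_eq_zero_of_cubicSum hω f hf (k / 3)
          rw [show 3 * (k / 3) + 2 = k by omega] at this
          exact Polynomial.mem_support_iff.1 hk this
        simp only [Finset.mem_union, Finset.mem_image, Finset.mem_range]
        by_cases h0 : k % 3 = 0
        · exact Or.inl ⟨k / 3, by omega, by omega⟩
        · exact Or.inr ⟨k / 3, by omega, by omega⟩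
      refine (Finset.card_le_card hsub).trans ((Finset.card_union_le _ _).trans ?_)
      have h1 := Finset.card_image_le (s := Finset.range N) (f := fun j => 3 * j)
      have h2 := Finset.card_image_le (s := Finset.range N) (f := fun j => 3 * j + 1)
      rw [Finset.card_range] at h1 h2
      omega
    exact ⟨0, by simp [hf0]⟩
  | succ m ih =>
    rintro hm f hdeg hf ⟨g, rfl⟩
    obtain ⟨P, hP, hPe⟩ := exists_polynomial_cubic_edgeIntegral ω (N - 1 - m)
    set E : Polynomial ℂ := (X ^ 3 - 1) ^ m * ((X - 1) ^ (2 * (N - 1 - m) + 1) * P) with hE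
    set G : Polynomial ℂ := (X ^ 2 + X + 1) ^ m * P with hG
    have hEe : ∀ x, E.eval x = (x ^ 3 - 1) ^ m * edgeFun ω (N - 1 - m) x := by
      intro x
      simp [hE, edgeFun, hPe]
    have hEG : E = (X - 1) ^ (2 * N - (m + 1)) * G := by
      rw [show 2 * N - (m + 1) = m + (2 * (N - 1 - m) + 1) by omega, hE, hG,
        show (X ^ 3 - 1 : Polynomial ℂ) = (X - 1) * (X ^ 2 + X + 1) by ring, mul_pow, pow_add]
      ring
    have hG1 : G.eval 1 ≠ 0 := by
      obtain ⟨r, hr, hre⟩ := edgeIntegral_one_one_pos (N - 1 - m)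
      have h3 : ((1 : ℂ) + 1 + 1) ^ m ≠ 0 := pow_ne_zero _ (by norm_num)
      simpa [hG, hPe, cubicWeights_one_one hω, hre, hr.ne'] using h3
    set c₀ := g.eval 1 / G.eval 1 with hc₀
    have hX1 : (X - 1 : Polynomial ℂ).natDegree ≤ 1 := natDegree_X_sub_C_le (1 : ℂ)
    have hEdeg : E.natDegree + 2 ≤ 3 * N := by
      have h1 : (X ^ 3 - 1 : Polynomial ℂ).natDegree ≤ 3 :=
        (natDegree_sub_le _ _).trans (by simp)
      have h2 := natDegree_mul_le_of_le (natDegree_pow_le_of_le m h1)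
        (natDegree_mul_le_of_le (natDegree_pow_le_of_le (2 * (N - 1 - m) + 1) hX1) hP)
      rw [← hE] at h2
      omega
    have hdeg' : ((X - 1) ^ (2 * N - (m + 1)) * g - C c₀ * E).natDegree + 2 ≤ 3 * N := by
      have h1 := natDegree_sub_le ((X - 1) ^ (2 * N - (m + 1)) * g) (C c₀ * E)
      have h2 := natDegree_C_mul_le c₀ E
      have := max_le (a := ((X - 1) ^ (2 * N - (m + 1)) * g).natDegree)
        (b := (C c₀ * E).natDegree) (c := 3 * N - 2) (by omega) (by omega)
      omega
    have hsum' : ∀ x, cubicSum ω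
        (fun x => ((X - 1) ^ (2 * N - (m + 1)) * g - C c₀ * E).eval x) x = 0 := by
      intro x
      have h1 := hf x
      have h2 := cubicSum_cube_mul hω (fun y => (y - 1) ^ m) (edgeFun ω (N - 1 - m)) x
      rw [cubicSum_edgeFun hω, mul_zero] at h2
      simp only [cubicSum, eval_sub, eval_C, Polynomial.eval_mul (p := C c₀), hEe] at h1 h2 ⊢
      linear_combination h1 - c₀ * h2
    have hdvd' : (X - 1) ^ (2 * N - m) ∣ (X - 1) ^ (2 * N - (m + 1)) * g - C c₀ * E := by
      have hroot : (g - C c₀ * G).IsRoot 1 := by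
        simp [hc₀, div_mul_cancel₀ _ hG1]
      obtain ⟨k, hk⟩ := dvd_iff_isRoot.2 hroot
      refine ⟨k, ?_⟩
      rw [show 2 * N - m = (2 * N - (m + 1)) + 1 by omega, pow_succ, hEG]
      rw [C_1] at hk
      linear_combination (X - 1) ^ (2 * N - (m + 1)) * hk
    obtain ⟨c, hc⟩ := ih (by omega) _ hdeg' hsum' hdvd'
    refine ⟨fun k => if k = m then c₀ else c k, fun x => ?_⟩
    have hcx := hc x
    rw [Polynomial.eval_sub, Polynomial.eval_mul (p := C c₀), eval_C, sub_eq_iff_eq_add] at hcx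
    rw [hcx, Finset.sum_range_succ, hEe]
    congr 1
    · refine Finset.sum_congr rfl fun k hk => ?_
      simp only [if_neg (Finset.mem_range.1 hk).ne]
    · simp only [if_pos]

end FunctionalEquationSolutions

section DeterminantFormula

theorem mul_det_eq_mul_det_of_antisymmetric {m : ℕ} {e : Fin m → ℂ → ℂ} {F : (Fin m → ℂ) → ℂ}
    (hspan : ∀ X i, ∃ c : Fin m → ℂ, ∀ x, F (Function.update X i x) = ∑ k, c k * e k x)
    (hperm : ∀ X (σ : Equiv.Perm (Fin m)), F (X ∘ σ) = (Equiv.Perm.sign σ : ℤ) * F X)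
    (X Y : Fin m → ℂ) :
    F X * (Matrix.of fun i k => e k (Y i)).det = F Y * (Matrix.of fun i k => e k (X i)).det := by
  set D : (Fin m → ℂ) → ℂ := fun X => (Matrix.of fun i k => e k (X i)).det with hD
  have hDperm : ∀ X (σ : Equiv.Perm (Fin m)), D (X ∘ σ) = (Equiv.Perm.sign σ : ℤ) * D X := by
    intro X σ
    exact Matrix.det_permute σ (Matrix.of fun i k => e k (X i))
  have hDspan : ∀ X i, ∃ c : Fin m → ℂ, ∀ x, D (Function.update X i x) = ∑ k, c k * e k x := by
    intro X i
    refine ⟨fun k => (Matrix.of fun i k => e k (X i)).adjugate k i, fun x => ?_⟩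
    have h1 : (Matrix.of fun l k => e k (Function.update X i x l)) =
        (Matrix.of fun l k => e k (X l)).updateRow i (fun k => e k x) := by
      ext l k
      by_cases h : l = i
      · subst h
        simp
      · simp [h]
    simp only [hD, h1]
    rw [Matrix.det_eq_sum_mul_adjugate_row _ i]
    refine Finset.sum_congr rfl fun k _ => ?_
    rw [Matrix.updateRow_self, mul_comm, Matrix.adjugate_apply, Matrix.adjugate_apply,
      Matrix.updateRow_idem]
  have hrep : ∀ G : (Fin m → ℂ) → ℂ,
      (∀ X (σ : Equiv.Perm (Fin m)), G (X ∘ σ) = (Equiv.Perm.sign σ : ℤ) * G X) →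
      ∀ X i j, i ≠ j → X i = X j → G X = 0 := by
    intro G hG X i j hij hX
    have h1 := hG X (Equiv.swap i j)
    have h2 : X ∘ Equiv.swap i j = X := by
      funext l
      simp only [Function.comp_apply, Equiv.swap_apply_def]
      split_ifs with h3 h4
      · rw [h3, hX]
      · rw [h4, hX]
      · rfl
    rw [h2, Equiv.Perm.sign_swap hij] at h1
    have : 2 * G X = 0 := by
      push_cast at h1
      linear_combination h1
    exact (mul_eq_zero.1 this).resolve_left two_ne_zero
  have main : ∀ Y, D Y ≠ 0 → ∀ X, F X * D Y = F Y * D X := by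
    intro Y hY X
    set H : (Fin m → ℂ) → ℂ := fun X => F X * D Y - F Y * D X with hH
    have key : ∀ s : Finset (Fin m), ∀ X, (∀ i ∉ s, ∃ j, X i = Y j) → H X = 0 := by
      intro s
      induction s using Finset.induction_on with
      | empty =>
        intro X hX
        choose τ hτ using fun i => hX i (Finset.notMem_empty i)
        have hXτ : X = Y ∘ τ := funext hτ
        by_cases hinj : Function.Injective τ
        · set σ := Equiv.ofBijective τ (Finite.injective_iff_bijective.1 hinj)
          have hσ : X = Y ∘ σ := hXτ
          simp only [hH, hσ, hperm Y σ, hDperm Y σ]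
          ring
        · rw [Function.Injective] at hinj
          push Not at hinj
          obtain ⟨i, j, hij, hne⟩ := hinj
          have hXij : X i = X j := by rw [hτ, hτ, hij]
          simp only [hH, hrep F hperm X i j hne hXij, hrep D hDperm X i j hne hXij]
          ring
      | insert i s _ ih =>
        intro X hX
        obtain ⟨c, hc⟩ := hspan X i
        obtain ⟨d, hd⟩ := hDspan X i
        have hHx : ∀ x, H (Function.update X i x) =
            ∑ k, e k x * (c k * D Y - F Y * d k) := by
          intro x
          simp only [hH, hc, hd]
          rw [Finset.sum_mul, Finset.mul_sum, ← Finset.sum_sub_distrib]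
          exact Finset.sum_congr rfl fun k _ => by ring
        have hzero : (fun k => c k * D Y - F Y * d k) = 0 := by
          refine Matrix.eq_zero_of_mulVec_eq_zero hY (funext fun j => ?_)
          have h1 : H (Function.update X i (Y j)) = 0 := by
            refine ih _ fun l hl => ?_
            by_cases hli : l = i
            · subst hli
              exact ⟨j, by simp⟩
            · rw [Function.update_of_ne hli]
              exact hX l (by simp [hli, hl])
          rw [hHx] at h1
          exact h1
        rw [← Function.update_eq_self i X, hHx]
        refine Finset.sum_eq_zero fun k _ => ?_
        rw [congrFun hzero k, Pi.zero_apply, mul_zero]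
    exact sub_eq_zero.1 (key Finset.univ X fun i hi => absurd (Finset.mem_univ i) hi)
  by_cases hY : D Y = 0
  · by_cases hX : D X = 0
    · change F X * D Y = F Y * D X
      rw [hX, hY, mul_zero, mul_zero]
    · exact (main X hX Y).symm
  · exact main Y hY X

theorem exists_det_vandermonde_update {m : ℕ} (X : Fin m → ℂ) (i : Fin m) :
    ∃ C : ℂ, ∀ x, (Matrix.vandermonde (Function.update X i x)).det =
      C * ∏ k, if k = i then 1 else x - X k := by
  cases m with
  | zero => exact i.elim0
  | succ l =>
    refine ⟨(Equiv.Perm.sign i.cycleRange : ℤ) * (-1) ^ l *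
      (Matrix.vandermonde (i.removeNth X)).det, fun x => ?_⟩
    have h1 : Function.update X i x = (Fin.cons x (i.removeNth X) : Fin (l + 1) → ℂ) ∘
        i.cycleRange := by
      rw [← Fin.insertNth_removeNth]
      funext k
      obtain ⟨k, rfl⟩ := i.cycleRange.symm.surjective k
      cases k using Fin.cases <;> simp
    have h2 := Matrix.det_permute i.cycleRange
      (Matrix.vandermonde (Fin.cons x (i.removeNth X) : Fin (l + 1) → ℂ))
    have h3 : Matrix.vandermonde (Function.update X i x) =
        (Matrix.vandermonde (Fin.cons x (i.removeNth X) : Fin (l + 1) → ℂ)).submatrix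
          i.cycleRange id := by
      rw [h1]
      rfl
    rw [h3, h2, Matrix.det_vandermonde, Fin.prod_univ_succ, Fin.prod_Ioi_zero]
    simp only [Fin.cons_zero, Fin.cons_succ, Fin.prod_Ioi_succ]
    rw [← Matrix.det_vandermonde, Fin.prod_univ_succAbove _ i, if_pos rfl, one_mul]
    have h4 : ∀ k, i.removeNth X k - x = (-1) * (x - X (i.succAbove k)) := fun k => by
      simp [Fin.removeNth_apply]
    simp only [h4, Finset.prod_mul_distrib, Fin.prod_const, Fin.succAbove_ne, if_false]
    ring

variable {ω : ℂ}

theorem exists_polynomial_cubicZ_update (hω : ω ^ 2 + ω + 1 = 0) {N : ℕ} (U : Fin N → ℂ)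
    (i : Fin N) : ∃ P : Polynomial ℂ, P.natDegree + 1 ≤ N ∧
      (∀ x, P.eval x = cubicZ ω (Function.update U i x) fun _ => 1) ∧
      ∀ x, cubicSum ω (fun x => P.eval x * (x - 1) ^ N * ∏ k, if k = i then 1 else x - U k) x =
        0 := by
  cases N with
  | zero => exact i.elim0
  | succ n =>
    obtain ⟨P, hP, hPe⟩ := exists_polynomial_cubicZ (ω := ω) (i.removeNth U) fun _ => 1
    refine ⟨P, by omega, fun x => ?_, fun x => ?_⟩
    · rw [hPe, ← cubicZ_cons_insertNth hω i, Fin.insertNth_removeNth]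
    · have h := cubicSum_cubicZ hω (i.removeNth U) x
      simp only [← hPe] at h
      have e : ∀ y, (∏ k, if k = i then 1 else y - U k) = ∏ k, (y - i.removeNth U k) := by
        intro y
        rw [Fin.prod_univ_succAbove _ i]
        simp [Fin.succAbove_ne, Fin.removeNth_apply]
      simpa only [e] using h

theorem exists_cubicZ_append_update (hω : ω ^ 2 + ω + 1 = 0) {m r : ℕ} (X : Fin m → ℂ)
    (i : Fin m) : ∃ c : ℕ → ℂ, ∀ x,
      cubicZ ω (Fin.append (Function.update X i x) fun _ : Fin r => 1) (fun _ => 1) *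
        (x - 1) ^ (2 * r + m) * (∏ k, if k = i then 1 else x - X k) =
      ∑ k ∈ Finset.range m, c k * ((x ^ 3 - 1) ^ k * edgeFun ω (m + r - 1 - k) x) := by
  set U : Fin (m + r) → ℂ := Fin.append X fun _ => 1 with hU
  obtain ⟨P, hP, hPe, hPs⟩ := exists_polynomial_cubicZ_update hω U (i.castAdd r)
  have hupd : ∀ x, Function.update U (i.castAdd r) x =
      Fin.append (Function.update X i x) fun _ : Fin r => 1 := by
    intro x
    funext k
    induction k using Fin.addCases with
    | left k =>
      by_cases hk : k = i
      · subst hk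
        simp
      · rw [Function.update_of_ne (by simpa using hk)]
        simp [hU, hk]
    | right k =>
      rw [Function.update_of_ne]
      · simp [hU]
      · intro h
        have := congrArg Fin.val h
        simp at this
        omega
  have hprod : ∀ x, (∏ k, if k = i.castAdd r then 1 else x - U k) =
      (∏ k, if k = i then 1 else x - X k) * (x - 1) ^ r := by
    intro x
    rw [Fin.prod_univ_add]
    have h1 : ∀ k : Fin r, Fin.natAdd m k ≠ i.castAdd r := fun k h => by
      have := congrArg Fin.val h
      simp at this
      omega
    simp [hU, h1, Finset.prod_const]
  set f : Polynomial ℂ := P * (Polynomial.X - 1) ^ (m + r) *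
    ((∏ k, if k = i then 1 else Polynomial.X - Polynomial.C (X k)) * (Polynomial.X - 1) ^ r)
    with hf
  have hfe : ∀ x, f.eval x = P.eval x * (x - 1) ^ (m + r) *
      ∏ k, if k = i.castAdd r then 1 else x - U k := by
    intro x
    rw [hprod, hf]
    simp only [Polynomial.eval_mul, Polynomial.eval_pow, Polynomial.eval_sub, Polynomial.eval_X,
      Polynomial.eval_one, Polynomial.eval_prod]
    congr 3
    funext k
    split_ifs <;> simp
  have hdeg : f.natDegree + 2 ≤ 3 * (m + r) := by
    have hX1 : ∀ l, ((Polynomial.X - 1 : Polynomial ℂ) ^ l).natDegree ≤ l * 1 := fun l =>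
      Polynomial.natDegree_pow_le_of_le l (Polynomial.natDegree_X_sub_C_le (1 : ℂ))
    have h1 : (∏ k, if k = i then 1 else Polynomial.X - Polynomial.C (X k)).natDegree ≤ m - 1 := by
      have h3 : (∏ k, if k = i then 1 else Polynomial.X - Polynomial.C (X k)) =
          ∏ k ∈ Finset.univ.erase i, (Polynomial.X - Polynomial.C (X k)) := by
        rw [← Finset.mul_prod_erase _ _ (Finset.mem_univ i), if_pos rfl, one_mul]
        exact Finset.prod_congr rfl fun k hk => if_neg (Finset.ne_of_mem_erase hk)
      rw [h3, Polynomial.natDegree_finsetProd_X_sub_C_eq_card, Finset.card_erase_of_mem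
        (Finset.mem_univ i), Finset.card_univ, Fintype.card_fin]
    have h2 := Polynomial.natDegree_mul_le_of_le
      (Polynomial.natDegree_mul_le_of_le (le_refl P.natDegree) (hX1 (m + r)))
      (Polynomial.natDegree_mul_le_of_le h1 (hX1 r))
    rw [← hf] at h2
    have := i.pos
    omega
  have hdvd : (Polynomial.X - 1) ^ (2 * (m + r) - m) ∣ f := by
    refine ⟨P * ∏ k, if k = i then 1 else Polynomial.X - Polynomial.C (X k), ?_⟩
    rw [hf, show 2 * (m + r) - m = (m + r) + r by omega, pow_add]
    ring
  obtain ⟨c, hc⟩ := exists_eq_sum_edgeFun hω (Nat.le_add_right m r) f hdeg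
    (fun x => by simpa only [hfe] using hPs x) hdvd
  refine ⟨c, fun x => ?_⟩
  rw [← hc, hfe, hprod, hPe, hupd]
  ring

theorem cubicZ_append_comp_perm (hω : ω ^ 2 + ω + 1 = 0) {m r : ℕ} (X : Fin m → ℂ)
    (σ : Equiv.Perm (Fin m)) (Y : Fin r → ℂ) (v : Fin (m + r) → ℂ) :
    cubicZ ω (Fin.append (X ∘ σ) Y) v = cubicZ ω (Fin.append X Y) v := by
  rw [← cubicZ_perm_left hω (Fin.append X Y) v
    ((finSumFinEquiv.symm.trans (Equiv.sumCongr σ (Equiv.refl _))).trans finSumFinEquiv)]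
  congr 1
  funext k
  induction k using Fin.addCases <;> simp

/-- The determinant formula for the partition function, in the form of a symmetric identity
that avoids the normalization constant. -/
theorem cubicZ_mul_det_edgeFun (hω : ω ^ 2 + ω + 1 = 0) {m r : ℕ} (X Y : Fin m → ℂ) :
    cubicZ ω (Fin.append X fun _ : Fin r => 1) (fun _ => 1) *
        (∏ i, (X i - 1) ^ (2 * r + m)) * (Matrix.vandermonde X).det *
        (Matrix.of fun i k : Fin m =>
          (Y i ^ 3 - 1) ^ (m - 1 - k : ℕ) * edgeFun ω (r + k) (Y i)).det =
      cubicZ ω (Fin.append Y fun _ : Fin r => 1) (fun _ => 1) *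
        (∏ i, (Y i - 1) ^ (2 * r + m)) * (Matrix.vandermonde Y).det *
        (Matrix.of fun i k : Fin m =>
          (X i ^ 3 - 1) ^ (m - 1 - k : ℕ) * edgeFun ω (r + k) (X i)).det := by
  refine mul_det_eq_mul_det_of_antisymmetric
    (e := fun (k : Fin m) x => (x ^ 3 - 1) ^ (m - 1 - k : ℕ) * edgeFun ω (r + k) x)
    (F := fun X => cubicZ ω (Fin.append X fun _ : Fin r => 1) (fun _ => 1) *
        (∏ i, (X i - 1) ^ (2 * r + m)) * (Matrix.vandermonde X).det) ?_ ?_ X Y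
  · intro X i
    obtain ⟨c, hc⟩ := exists_cubicZ_append_update hω (r := r) X i
    obtain ⟨C, hC⟩ := exists_det_vandermonde_update X i
    refine ⟨fun k => C * (∏ l ∈ Finset.univ.erase i, (X l - 1) ^ (2 * r + m)) * c (m - 1 - k),
      fun x => ?_⟩
    have h1 : ∏ l, (Function.update X i x l - 1) ^ (2 * r + m) =
        (x - 1) ^ (2 * r + m) * ∏ l ∈ Finset.univ.erase i, (X l - 1) ^ (2 * r + m) := by
      rw [← Finset.mul_prod_erase _ _ (Finset.mem_univ i), Function.update_self]
      congr 1
      refine Finset.prod_congr rfl fun l hl => ?_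
      rw [Function.update_of_ne (Finset.ne_of_mem_erase hl)]
    calc _ = C * (∏ l ∈ Finset.univ.erase i, (X l - 1) ^ (2 * r + m)) *
        (cubicZ ω (Fin.append (Function.update X i x) fun _ : Fin r => 1) (fun _ => 1) *
        (x - 1) ^ (2 * r + m) * (∏ k, if k = i then 1 else x - X k)) := by
          rw [h1, hC]
          ring
      _ = _ := by
          rw [hc, ← Fin.sum_univ_eq_sum_range (fun k =>
            c k * ((x ^ 3 - 1) ^ k * edgeFun ω (m + r - 1 - k) x)), ← Equiv.sum_comp Fin.revPerm,
            Finset.mul_sum]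
          refine Finset.sum_congr rfl fun k _ => ?_
          have h2 : ((Fin.revPerm k : Fin m) : ℕ) = m - 1 - k := by
            simp [Fin.val_rev]
            omega
          have h3 : m + r - 1 - (m - 1 - k : ℕ) = r + k := by omega
          rw [h2, h3]
          ring
  · intro X σ
    have h1 : (Matrix.vandermonde (X ∘ σ)).det =
        (Equiv.Perm.sign σ : ℤ) * (Matrix.vandermonde X).det :=
      Matrix.det_permute σ (Matrix.vandermonde X)
    have h2 : ∏ i, ((X ∘ σ) i - 1) ^ (2 * r + m) = ∏ i, (X i - 1) ^ (2 * r + m) :=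
      Equiv.prod_comp σ fun i => (X i - 1) ^ (2 * r + m)
    simp only [h1, h2, cubicZ_append_comp_perm hω]
    ring

end DeterminantFormula

section TiltedPartitionFunction

/-- The weights tilting a row of an alternating sign matrix: `t` for the entries `0` at which the
horizontal and vertical states agree, `t ^ 2 - t + 1` for the entries `-1`, and `1` otherwise. -/
noncomputable def tiltWeights (t : ℂ) : CellWeights ℂ where
  a := t
  b := 1
  c := 1
  d := t ^ 2 - t + 1

/-- The generating function of alternating sign matrices with rows tilted by `T`. -/
noncomputable def tiltedZ {N : ℕ} (T : Fin N → ℂ) : ℂ :=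
  sixVertexZ fun i _ : Fin N => tiltWeights (T i)

/-- The denominator in the change from the ratio `t` of the weights to the spectral parameter. -/
noncomputable def gaugeDenom (ω t : ℂ) : ℂ := (t + 1 + (ω - ω ^ 2) * (t - 1)) / 2

/-- The spectral parameter for which the ratio of the first two weights is `t`. -/
noncomputable def spectralPoint (ω t : ℂ) : ℂ := 1 + (ω ^ 2 - ω) * (t - 1) / gaugeDenom ω t

variable {ω : ℂ}

theorem gaugeDenom_one : gaugeDenom ω 1 = 1 := by
  norm_num [gaugeDenom]

theorem spectralPoint_one : spectralPoint ω 1 = 1 := by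
  simp [spectralPoint]

theorem cubicWeights_spectralPoint (hω : ω ^ 2 + ω + 1 = 0) {t : ℂ} (ht : gaugeDenom ω t ≠ 0) :
    cubicWeights ω (spectralPoint ω t) 1 =
      ⟨t / gaugeDenom ω t, 1 / gaugeDenom ω t, 1, (t ^ 2 - t + 1) / gaugeDenom ω t ^ 2⟩ := by
  have h2 : spectralPoint ω t * gaugeDenom ω t =
      gaugeDenom ω t + (ω ^ 2 - ω) * (t - 1) := by
    rw [spectralPoint]
    field_simp
  have h3 : gaugeDenom ω t = (t + 1 + (ω - ω ^ 2) * (t - 1)) / 2 := rfl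
  simp only [cubicWeights, CellWeights.mk.injEq, true_and]
  set g := gaugeDenom ω t
  set x := spectralPoint ω t
  refine ⟨?_, ?_, ?_⟩
  · rw [eq_div_iff ht]
    grind
  · rw [eq_div_iff ht]
    grind
  · rw [eq_div_iff (pow_ne_zero 2 ht)]
    grind

theorem prod_cellWeight_cubicWeights (hω : ω ^ 2 + ω + 1 = 0) {N : ℕ} {t : ℂ}
    (ht : gaugeDenom ω t ≠ 0) {h : Fin (N + 1) → Bool} (hh : h ∈ statePaths N false true)
    (s s' : Fin N → Bool) :
    (∏ j, cellWeight (cubicWeights ω (spectralPoint ω t) 1) (h j.castSucc) (s j) (h j.succ)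
      (s' j)) * gaugeDenom ω t ^ (N - 1) =
    ∏ j, cellWeight (tiltWeights t) (h j.castSucc) (s j) (h j.succ) (s' j) := by
  set g := gaugeDenom ω t with hg
  have hcell : ∀ h s h' s' : Bool, cellWeight (cubicWeights ω (spectralPoint ω t) 1) h s h' s' *
      g * g ^ h.toNat = cellWeight (tiltWeights t) h s h' s' * g ^ h'.toNat := by
    intro h s h' s'
    rw [cubicWeights_spectralPoint hω ht]
    cases h <;> cases s <;> cases h' <;> cases s' <;> simp [cellWeight, tiltWeights, ← hg, ht]
    field_simp
  have h1 : (∏ j : Fin N, (cellWeight (cubicWeights ω (spectralPoint ω t) 1) (h j.castSucc) (s j)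
      (h j.succ) (s' j) * g * g ^ (h j.castSucc).toNat)) = ∏ j : Fin N,
      (cellWeight (tiltWeights t) (h j.castSucc) (s j) (h j.succ) (s' j) *
        g ^ (h j.succ).toNat) := Finset.prod_congr rfl fun j _ => hcell _ _ _ _
  simp only [Finset.prod_mul_distrib, Fin.prod_const] at h1
  rw [mem_statePaths] at hh
  have h2 : ∏ j : Fin N, g ^ (h j.succ).toNat = (∏ j : Fin N, g ^ (h j.castSucc).toNat) * g := by
    have h3 := Fin.prod_univ_succ fun j => g ^ (h j).toNat
    have h4 := Fin.prod_univ_castSucc fun j => g ^ (h j).toNat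
    rw [h3, hh.1, hh.2] at h4
    simpa using h4
  have hN : N ≠ 0 := by
    rintro rfl
    have := hh.1.symm.trans hh.2
    simp at this
  have hg0 : (∏ j : Fin N, g ^ (h j.castSucc).toNat) * g ≠ 0 :=
    mul_ne_zero (Finset.prod_ne_zero_iff.2 fun j _ => pow_ne_zero _ ht) ht
  apply mul_right_cancel₀ hg0
  rw [h2] at h1
  rw [← h1, ← mul_pow_sub_one hN g]
  ring

theorem cubicZ_spectralPoint (hω : ω ^ 2 + ω + 1 = 0) {N : ℕ} {T : Fin N → ℂ}
    (hT : ∀ i, gaugeDenom ω (T i) ≠ 0) :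
    cubicZ ω (fun i => spectralPoint ω (T i)) (fun _ => 1) * ∏ i, gaugeDenom ω (T i) ^ (N - 1) =
      tiltedZ T := by
  rw [cubicZ, tiltedZ, sixVertexZ, sixVertexZ, Finset.sum_mul]
  refine Finset.sum_congr rfl fun h hh => ?_
  rw [Finset.sum_mul]
  refine Finset.sum_congr rfl fun s _ => ?_
  rw [← Finset.prod_mul_distrib]
  exact Finset.prod_congr rfl fun i _ =>
    prod_cellWeight_cubicWeights hω (hT i) (Fintype.mem_piFinset.1 hh i) _ _

theorem det_vandermonde_spectralPoint {m : ℕ} {t : Fin m → ℂ}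
    (ht : ∀ i, gaugeDenom ω (t i) ≠ 0) :
    (Matrix.vandermonde fun i => spectralPoint ω (t i)).det * ∏ i, gaugeDenom ω (t i) ^ (m - 1) =
      (∏ i : Fin m, ∏ _j ∈ Finset.Ioi i, (ω ^ 2 - ω)) * (Matrix.vandermonde t).det := by
  have h1 : (Matrix.vandermonde fun i => spectralPoint ω (t i)).det =
      (Matrix.vandermonde fun i => (ω ^ 2 - ω) * (t i - 1) / gaugeDenom ω (t i)).det := by
    rw [← Matrix.det_vandermonde_add (fun i => (ω ^ 2 - ω) * (t i - 1) / gaugeDenom ω (t i)) 1]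
    simp only [spectralPoint, add_comm (1 : ℂ)]
  have h2 := Matrix.det_projVandermonde (fun i => (ω ^ 2 - ω) * (t i - 1))
    fun i => gaugeDenom ω (t i)
  have h3 : Matrix.projVandermonde (fun i => (ω ^ 2 - ω) * (t i - 1))
      (fun i => gaugeDenom ω (t i)) = Matrix.of fun i j => gaugeDenom ω (t i) ^ (m - 1) *
        Matrix.vandermonde (fun i => (ω ^ 2 - ω) * (t i - 1) / gaugeDenom ω (t i)) i j := by
    ext i j
    have hj : m - 1 = j + (j.rev : ℕ) := by
      rw [Fin.val_rev]
      omega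
    rw [Matrix.projVandermonde_apply, Matrix.of_apply, Matrix.vandermonde_apply, div_pow, hj,
      pow_add]
    have := pow_ne_zero (j : ℕ) (ht i)
    field_simp
  rw [h3, Matrix.det_mul_column] at h2
  rw [h1, mul_comm, h2, Matrix.det_vandermonde, ← Finset.prod_mul_distrib]
  refine Finset.prod_congr rfl fun i _ => ?_
  rw [← Finset.prod_mul_distrib]
  refine Finset.prod_congr rfl fun j _ => ?_
  simp only [gaugeDenom]
  ring

theorem edgeFun_spectralPoint (hω : ω ^ 2 + ω + 1 = 0) {t : ℂ} (ht : gaugeDenom ω t ≠ 0)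
    {m k r : ℕ} (hk : k + 1 ≤ m) :
    (spectralPoint ω t ^ 3 - 1) ^ (m - 1 - k) * edgeFun ω (r + k) (spectralPoint ω t) *
      gaugeDenom ω t ^ (2 * m - 2 + r) =
    (spectralPoint ω t - 1) ^ (2 * r + m) * (3 ^ (m - 1 - k) * (ω ^ 2 - ω) ^ k) *
      (t ^ (m - 1 - k) * (t - 1) ^ k * edgeIntegral (r + k) t 1) := by
  obtain ⟨l, rfl⟩ := Nat.exists_eq_add_of_le hk
  rw [show k + 1 + l - 1 - k = l by omega]
  have h1 : spectralPoint ω t ^ 3 - 1 =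
      (spectralPoint ω t - 1) * (3 * t) / gaugeDenom ω t ^ 2 := by
    have h2 := cubicWeights_spectralPoint hω ht
    have h3 : spectralPoint ω t ^ 2 + spectralPoint ω t + 1 =
        3 * ((cubicWeights ω (spectralPoint ω t) 1).a * (cubicWeights ω (spectralPoint ω t) 1).b)
        := by
      simp only [cubicWeights]
      grind
    rw [h2] at h3
    calc spectralPoint ω t ^ 3 - 1 =
        (spectralPoint ω t - 1) * (spectralPoint ω t ^ 2 + spectralPoint ω t + 1) := by ring
      _ = _ := by
        rw [h3]
        field_simp
  have h4 : edgeFun ω (r + k) (spectralPoint ω t) = (spectralPoint ω t - 1) ^ (2 * (r + k) + 1) *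
      ((1 / gaugeDenom ω t) ^ (r + k) * edgeIntegral (r + k) t 1) := by
    rw [edgeFun, ← edgeIntegral_mul, cubicWeights_spectralPoint hω ht]
    congr 2
    · simp
      ring
    · simp
  have h5 : (spectralPoint ω t - 1) * gaugeDenom ω t = (ω ^ 2 - ω) * (t - 1) := by
    rw [spectralPoint]
    field_simp
    ring
  have h6 : (spectralPoint ω t - 1) ^ k * gaugeDenom ω t ^ k =
      (ω ^ 2 - ω) ^ k * (t - 1) ^ k := by
    rw [← mul_pow, h5, mul_pow]
  rw [h1, h4, show 2 * (k + 1 + l) - 2 + r = 2 * l + (r + k) + k by omega, div_pow, div_pow,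
    mul_pow, mul_pow, one_pow]
  calc _ = (spectralPoint ω t - 1) ^ (l + (2 * (r + k) + 1)) * 3 ^ l * t ^ l *
        edgeIntegral (r + k) t 1 * gaugeDenom ω t ^ k := by
        field_simp
        ring
    _ = (spectralPoint ω t - 1) ^ (2 * r + (k + 1 + l)) * 3 ^ l * t ^ l *
        edgeIntegral (r + k) t 1 * ((spectralPoint ω t - 1) ^ k * gaugeDenom ω t ^ k) := by
        ring
    _ = _ := by
        rw [h6]
        ring

/-- The determinant in the formula for the tilted partition function. -/
noncomputable def tiltDet {m : ℕ} (r : ℕ) (t : Fin m → ℂ) : ℂ :=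
  (Matrix.of fun i k : Fin m =>
    t i ^ (m - 1 - k : ℕ) * (t i - 1) ^ (k : ℕ) * edgeIntegral (r + k) (t i) 1).det

theorem det_edgeFun_spectralPoint (hω : ω ^ 2 + ω + 1 = 0) {m r : ℕ} {t : Fin m → ℂ}
    (ht : ∀ i, gaugeDenom ω (t i) ≠ 0) :
    (Matrix.of fun i k : Fin m => (spectralPoint ω (t i) ^ 3 - 1) ^ (m - 1 - k : ℕ) *
      edgeFun ω (r + k) (spectralPoint ω (t i))).det *
        ∏ i, gaugeDenom ω (t i) ^ (2 * m - 2 + r) =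
    (∏ i, (spectralPoint ω (t i) - 1) ^ (2 * r + m)) *
      (∏ k : Fin m, (3 ^ (m - 1 - k : ℕ) * (ω ^ 2 - ω) ^ (k : ℕ))) * tiltDet r t := by
  rw [tiltDet, mul_comm, ← Matrix.det_mul_column, mul_assoc, ← Matrix.det_mul_row,
    ← Matrix.det_mul_column]
  congr 1
  ext i k
  simp only [Matrix.of_apply]
  rw [mul_comm, edgeFun_spectralPoint hω (ht i) (by omega), mul_assoc]

/-- Up to a constant, the tilted partition function is a ratio of determinants. -/
theorem tiltedZ_mul_tiltDet (hω : ω ^ 2 + ω + 1 = 0) {m r : ℕ} {t s : Fin m → ℂ}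
    (ht : ∀ i, gaugeDenom ω (t i) ≠ 0) (hs : ∀ i, gaugeDenom ω (s i) ≠ 0)
    (ht1 : ∀ i, t i ≠ 1) (hs1 : ∀ i, s i ≠ 1) :
    tiltedZ (Fin.append t fun _ : Fin r => 1) * (Matrix.vandermonde t).det * tiltDet r s =
      tiltedZ (Fin.append s fun _ : Fin r => 1) * (Matrix.vandermonde s).det * tiltDet r t := by
  have hκ : ω ^ 2 - ω ≠ 0 := by
    intro h
    have : (3 : ℂ) = 0 := by linear_combination 4 * hω - (2 * ω + 1) * (hω - h)
    norm_num at this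
  have hX : ∀ {t : Fin m → ℂ}, (∀ i, gaugeDenom ω (t i) ≠ 0) → (∀ i, t i ≠ 1) →
      ∏ i, (spectralPoint ω (t i) - 1) ^ (2 * r + m) ≠ 0 := by
    intro t ht ht1
    refine Finset.prod_ne_zero_iff.2 fun i _ => pow_ne_zero _ ?_
    rw [spectralPoint, add_sub_cancel_left]
    exact div_ne_zero (mul_ne_zero hκ (sub_ne_zero.2 (ht1 i))) (ht i)
  have hZ : ∀ {t : Fin m → ℂ}, (∀ i, gaugeDenom ω (t i) ≠ 0) →
      cubicZ ω (Fin.append (fun i => spectralPoint ω (t i)) fun _ : Fin r => 1) (fun _ => 1) *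
        ∏ i, gaugeDenom ω (t i) ^ (m + r - 1) = tiltedZ (Fin.append t fun _ : Fin r => 1) := by
    intro t ht
    rw [← cubicZ_spectralPoint hω]
    · congr 1
      · congr 1
        funext k
        induction k using Fin.addCases <;> simp [spectralPoint_one]
      · simp [Fin.prod_univ_add, gaugeDenom_one]
    · intro k
      induction k using Fin.addCases <;> simp [gaugeDenom_one, ht]
  have hgg : ∀ t : Fin m → ℂ, (∏ i, gaugeDenom ω (t i) ^ (m + r - 1)) *
      ∏ i, gaugeDenom ω (t i) ^ (m - 1) = ∏ i, gaugeDenom ω (t i) ^ (2 * m - 2 + r) := by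
    intro t
    rw [← Finset.prod_mul_distrib]
    refine Finset.prod_congr rfl fun i _ => ?_
    rw [← pow_add]
    congr 1
    have := i.pos
    omega
  set K := ∏ k : Fin m, ((3 : ℂ) ^ (m - 1 - k : ℕ) * (ω ^ 2 - ω) ^ (k : ℕ)) with hK
  have hK0 : K ≠ 0 := Finset.prod_ne_zero_iff.2 fun k _ =>
    mul_ne_zero (pow_ne_zero _ (by norm_num)) (pow_ne_zero _ hκ)
  set C := ∏ i : Fin m, ∏ _j ∈ Finset.Ioi i, (ω ^ 2 - ω) with hC
  have hC0 : C ≠ 0 := Finset.prod_ne_zero_iff.2 fun i _ => Finset.prod_ne_zero_iff.2 fun _ _ => hκ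
  have main := cubicZ_mul_det_edgeFun hω (r := r) (fun i => spectralPoint ω (t i))
    fun i => spectralPoint ω (s i)
  have hVt := det_vandermonde_spectralPoint ht
  have hVs := det_vandermonde_spectralPoint hs
  have hDt := det_edgeFun_spectralPoint hω (r := r) ht
  have hDs := det_edgeFun_spectralPoint hω (r := r) hs
  rw [← hC] at hVt hVs
  rw [← hK] at hDt hDs
  rw [← hgg] at hDt hDs
  have h0 := mul_ne_zero (mul_ne_zero (hX ht ht1) (hX hs hs1)) (mul_ne_zero hK0 hC0)
  apply mul_left_cancel₀ h0
  rw [← hZ ht, ← hZ hs]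
  set Pt := ∏ i, (spectralPoint ω (t i) - 1) ^ (2 * r + m)
  set Ps := ∏ i, (spectralPoint ω (s i) - 1) ^ (2 * r + m)
  set gt := ∏ i, gaugeDenom ω (t i) ^ (m + r - 1)
  set gs := ∏ i, gaugeDenom ω (s i) ^ (m + r - 1)
  set gt' := ∏ i, gaugeDenom ω (t i) ^ (m - 1)
  set gs' := ∏ i, gaugeDenom ω (s i) ^ (m - 1)
  set Zt := cubicZ ω (Fin.append (fun i => spectralPoint ω (t i)) fun _ : Fin r => 1) fun _ => 1
  set Zs := cubicZ ω (Fin.append (fun i => spectralPoint ω (s i)) fun _ : Fin r => 1) fun _ => 1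
  generalize (Matrix.vandermonde fun i => spectralPoint ω (t i)).det = Vt at main hVt
  generalize (Matrix.vandermonde fun i => spectralPoint ω (s i)).det = Vs at main hVs
  generalize (Matrix.of fun i k : Fin m => (spectralPoint ω (t i) ^ 3 - 1) ^ (m - 1 - k : ℕ) *
    edgeFun ω (r + k) (spectralPoint ω (t i))).det = Dt at main hDt
  generalize (Matrix.of fun i k : Fin m => (spectralPoint ω (s i) ^ 3 - 1) ^ (m - 1 - k : ℕ) *
    edgeFun ω (r + k) (spectralPoint ω (s i))).det = Ds at main hDs
  calc _ = Zt * Pt * gt * (C * (Matrix.vandermonde t).det) * (Ps * K * tiltDet r s) := by ring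
    _ = gt * gt' * gs * gs' * (Zt * Pt * Vt * Ds) := by
        rw [← hVt, ← hDs]
        ring
    _ = Zs * Ps * gs * (C * (Matrix.vandermonde s).det) * (Pt * K * tiltDet r t) := by
        rw [main, ← hVs, ← hDt]
        ring
    _ = _ := by ring

end TiltedPartitionFunction

section AlternatingSignMatrices

variable {N : ℕ}

/-- The sum of the entries of `v` strictly before position `j`. -/
def partialSum (v : Fin N → ℤ) (j : Fin (N + 1)) : ℤ :=
  ∑ k ∈ Finset.univ.filter fun k : Fin N => k.castSucc < j, v k

theorem partialSum_zero (v : Fin N → ℤ) : partialSum v 0 = 0 := by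
  simp [partialSum]

theorem partialSum_succ (v : Fin N → ℤ) (j : Fin N) :
    partialSum v j.succ = ∑ k ∈ Finset.univ.filter (fun k : Fin N => k ≤ j), v k := by
  simp only [partialSum, Fin.castSucc_lt_succ_iff]

theorem partialSum_succ_eq_add (v : Fin N → ℤ) (j : Fin N) :
    partialSum v j.succ = partialSum v j.castSucc + v j := by
  rw [partialSum_succ, partialSum, add_comm, ← Finset.sum_insert (by simp)]
  congr 1
  ext k
  simp [le_iff_eq_or_lt]

theorem partialSum_last (v : Fin N → ℤ) : partialSum v (Fin.last N) = ∑ k, v k := by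
  simp [partialSum, Fin.castSucc_lt_last]

theorem partialSum_eq_of_sub {v : Fin N → ℤ} {f : Fin (N + 1) → ℤ} (h0 : f 0 = 0)
    (hf : ∀ j : Fin N, v j = f j.succ - f j.castSucc) (j : Fin (N + 1)) : partialSum v j = f j := by
  induction j using Fin.induction with
  | zero => rw [partialSum_zero, h0]
  | succ j ih => rw [partialSum_succ_eq_add, ih, hf, add_sub_cancel]

/-- The states of the horizontal edges in the row of entries `v`. -/
def edgeStates (v : Fin N → ℤ) (j : Fin (N + 1)) : Bool :=
  decide (partialSum v j = 1)

theorem IsASM.transpose {M : Matrix (Fin N) (Fin N) ℤ} (hM : IsASM M) : IsASM M.transpose :=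
  ⟨fun i j => hM.1 j i, hM.2.2.1, hM.2.1, hM.2.2.2.2, hM.2.2.2.1⟩

theorem IsASM.toNat_edgeStates {M : Matrix (Fin N) (Fin N) ℤ} (hM : IsASM M) (i : Fin N)
    (j : Fin (N + 1)) : ((edgeStates (M i) j).toNat : ℤ) = partialSum (M i) j := by
  have h : partialSum (M i) j = 0 ∨ partialSum (M i) j = 1 := by
    induction j using Fin.cases with
    | zero => exact .inl (partialSum_zero _)
    | succ j =>
      rw [partialSum_succ]
      exact hM.2.2.2.1 i j
  rcases h with h | h <;> simp [edgeStates, h]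

theorem IsASM.edgeStates_mem {M : Matrix (Fin N) (Fin N) ℤ} (hM : IsASM M) (i : Fin N) :
    edgeStates (M i) ∈ statePaths N false true := by
  rw [mem_statePaths]
  simp [edgeStates, partialSum_zero, partialSum_last, hM.2.1]

theorem IsASM.apply_eq {M : Matrix (Fin N) (Fin N) ℤ} (hM : IsASM M) (i j : Fin N) :
    M i j = (edgeStates (M i) j.succ).toNat - (edgeStates (M i) j.castSucc).toNat := by
  rw [hM.toNat_edgeStates, hM.toNat_edgeStates, partialSum_succ_eq_add, add_sub_cancel_left]

theorem cellWeight_eq_zero {R : Type*} [CommRing R] (w : CellWeights R) {h s h' s' : Bool}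
    (hne : (h'.toNat : ℤ) - h.toNat ≠ s'.toNat - s.toNat) : cellWeight w h s h' s' = 0 := by
  cases h <;> cases s <;> cases h' <;> cases s' <;> simp_all [cellWeight]

theorem finite_setOf_isASM (N : ℕ) : {M : Matrix (Fin N) (Fin N) ℤ | IsASM M}.Finite := by
  refine Set.Finite.subset (Set.Finite.pi' fun _ : Fin N => Set.Finite.pi' fun _ : Fin N =>
    Set.toFinite ({-1, 0, 1} : Set ℤ)) fun M hM i j => ?_
  simpa using hM.1 i j

/-- The finite set of alternating sign matrices. -/
noncomputable def asmFinset (N : ℕ) : Finset (Matrix (Fin N) (Fin N) ℤ) :=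
  (finite_setOf_isASM N).toFinset

theorem mem_asmFinset {M : Matrix (Fin N) (Fin N) ℤ} : M ∈ asmFinset N ↔ IsASM M := by
  simp [asmFinset]

/-- The weight of a matrix in the six-vertex model. -/
def asmWeight {R : Type*} [CommRing R] (W : Fin N → Fin N → CellWeights R)
    (M : Matrix (Fin N) (Fin N) ℤ) : R :=
  ∏ i, ∏ j, cellWeight (W i j) (edgeStates (M i) j.castSucc)
    (edgeStates (M.transpose j) i.castSucc) (edgeStates (M i) j.succ)
    (edgeStates (M.transpose j) i.succ)

theorem sixVertexZ_eq_sum_asmWeight {R : Type*} [CommRing R]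
    (W : Fin N → Fin N → CellWeights R) :
    sixVertexZ W = ∑ M ∈ asmFinset N, asmWeight W M := by
  rw [sixVertexZ, ← Finset.sum_product']
  symm
  refine Finset.sum_of_injOn
    (fun M => (fun i => edgeStates (M i), fun j => edgeStates (M.transpose j))) ?_ ?_ ?_ ?_
  · intro M hM M' hM' h
    rw [Finset.mem_coe, mem_asmFinset] at hM hM'
    ext i j
    have h1 : edgeStates (M i) = edgeStates (M' i) := congrFun (congrArg Prod.fst h) i
    rw [hM.apply_eq, hM'.apply_eq, h1]
  · intro M hM
    rw [Finset.mem_coe, mem_asmFinset] at hM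
    simp only [Finset.coe_product, Set.mem_prod, Finset.mem_coe, Fintype.mem_piFinset]
    exact ⟨hM.edgeStates_mem, hM.transpose.edgeStates_mem⟩
  · rintro ⟨h, s⟩ hhs hnot
    simp only [Finset.mem_product, Fintype.mem_piFinset, mem_statePaths] at hhs
    obtain ⟨hh, hs⟩ := hhs
    by_contra hne
    have hcell : ∀ i j : Fin N, ((h i j.succ).toNat : ℤ) - (h i j.castSucc).toNat =
        (s j i.succ).toNat - (s j i.castSucc).toNat := by
      intro i j
      by_contra hij
      exact hne (Finset.prod_eq_zero (Finset.mem_univ i) (Finset.prod_eq_zero (Finset.mem_univ j)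
        (cellWeight_eq_zero _ hij)))
    set M : Matrix (Fin N) (Fin N) ℤ :=
      Matrix.of fun i j => ((h i j.succ).toNat : ℤ) - (h i j.castSucc).toNat with hM
    have hrow : ∀ i j, partialSum (M i) j = (h i j).toNat := fun i =>
      partialSum_eq_of_sub (f := fun j => ((h i j).toNat : ℤ)) (by simp [hh i]) fun j => rfl
    have hcol : ∀ j i, partialSum (M.transpose j) i = (s j i).toNat := fun j =>
      partialSum_eq_of_sub (f := fun i => ((s j i).toNat : ℤ)) (by simp [hs j]) fun i => hcell i j
    refine hnot ⟨M, ?_, ?_⟩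
    · rw [Finset.mem_coe, mem_asmFinset]
      refine ⟨fun i j => ?_, fun i => ?_, fun j => ?_, fun i j => ?_, fun j i => ?_⟩
      · simp only [hM, Matrix.of_apply]
        cases h i j.succ <;> cases h i j.castSucc <;> simp
      · rw [← partialSum_last, hrow, (hh i).2]
        simp
      · refine (partialSum_last (M.transpose j)).symm.trans ?_
        rw [hcol, (hs j).2]
        simp
      · rw [← partialSum_succ, hrow]
        cases h i j.succ <;> simp
      · have := partialSum_succ (M.transpose j) i
        simp only [Matrix.transpose_apply] at this
        rw [← this, hcol]
        cases s j i.succ <;> simp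
    · refine Prod.ext ?_ ?_
      · funext i j
        simp only [edgeStates, hrow]
        cases h i j <;> simp
      · funext j i
        simp only [edgeStates, hcol]
        cases s j i <;> simp
  · intro M _
    rfl

theorem IsASM.psiRow_eq {M : Matrix (Fin N) (Fin N) ℤ} (hM : IsASM M) (i : Fin N) :
    psiRow M i = ∑ j : Fin N, (1 - (edgeStates (M i) j.castSucc).toNat : ℝ) := by
  set f : Fin (N + 1) → ℝ := fun j => (edgeStates (M i) j).toNat with hf
  have h0 : f (Fin.last N) = 1 := by simp [hf, edgeStates, partialSum_last, hM.2.1]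
  have h1 : ∀ j : Fin N, (M i j : ℝ) = f j.succ - f j.castSucc := by
    intro j
    have := hM.apply_eq i j
    rw [this]
    push_cast
    rfl
  have h2 := Fin.sum_univ_succ fun j : Fin (N + 1) => ((j : ℕ) : ℝ) * f j
  have h3 := Fin.sum_univ_castSucc fun j : Fin (N + 1) => ((j : ℕ) : ℝ) * f j
  rw [h2] at h3
  simp only [Fin.val_zero, Nat.cast_zero, zero_mul, zero_add, Fin.val_succ, Fin.val_castSucc,
    Fin.val_last, h0, mul_one] at h3
  rw [psiRow, dif_pos i.2, Finset.sum_sub_distrib]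
  simp only [Fin.eta, h1, mul_sub, Finset.sum_sub_distrib, Finset.sum_const, Finset.card_univ,
    Fintype.card_fin, nsmul_eq_mul, mul_one]
  push_cast at h3
  rw [h3]
  simp only [add_mul, Finset.sum_add_distrib, one_mul]
  ring

theorem IsASM.sum_edgeStates_transpose {M : Matrix (Fin N) (Fin N) ℤ} (hM : IsASM M)
    (i : Fin (N + 1)) : ∑ j, (edgeStates (M.transpose j) i).toNat = (i : ℕ) := by
  zify
  simp only [hM.transpose.toNat_edgeStates]
  induction i using Fin.induction with
  | zero => simp [partialSum_zero]
  | succ i ih =>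
    simp only [partialSum_succ_eq_add, Finset.sum_add_distrib, ih, Matrix.transpose_apply, hM.2.1]
    simp

theorem exists_cellWeight_tiltWeights {t : ℂ} (ht : ‖t‖ = 1) {h s h' s' : Bool}
    (hc : (h'.toNat : ℤ) - h.toNat = s'.toNat - s.toNat) :
    ∃ κ : ℂ, cellWeight (tiltWeights t) h s h' s' = t ^ (1 - h.toNat) * (1 + κ) ∧
      ‖κ‖ ≤ (s.toNat + s'.toNat) * ‖t - 1‖ := by
  have h0 : t ≠ 0 := by
    rintro rfl
    simp at ht
  have h1 : ‖t⁻¹ - 1‖ = ‖t - 1‖ := by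
    rw [show t⁻¹ - 1 = -(t⁻¹ * (t - 1)) by field_simp; ring, norm_neg, norm_mul, norm_inv, ht]
    simp
  have h2 : ‖t ^ 2 - t‖ = ‖t - 1‖ := by
    rw [show t ^ 2 - t = t * (t - 1) by ring, norm_mul, ht, one_mul]
  have h3 := norm_nonneg (t - 1)
  cases h <;> cases s <;> cases h' <;> cases s' <;> simp at hc <;>
    simp only [cellWeight, tiltWeights, Bool.toNat_true, Bool.toNat_false]
  · exact ⟨0, by simp, by simp⟩
  · exact ⟨t⁻¹ - 1, by simp [h0], by simp [h1]⟩
  · exact ⟨t⁻¹ - 1, by simp [h0], by simp [h1]; linarith⟩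
  · exact ⟨0, by simp, by simp⟩
  · exact ⟨t ^ 2 - t, by simp; ring, by simp [h2]⟩
  · exact ⟨t - 1, by simp, by simp; linarith⟩

theorem IsASM.norm_asmWeight_sub_le {M : Matrix (Fin N) (Fin N) ℤ} (hM : IsASM M)
    (θ : Fin N → ℝ) :
    ‖asmWeight (fun i _ => tiltWeights (Complex.exp (Complex.I * θ i))) M -
      Complex.exp (Complex.I * (∑ i, θ i * psiRow M i : ℝ))‖ ≤
      Real.exp (∑ i : Fin N, (2 * (i : ℕ) + 1) * |θ i|) - 1 := by
  have hcell : ∀ i j : Fin N, ((edgeStates (M i) j.succ).toNat : ℤ) -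
      (edgeStates (M i) j.castSucc).toNat = (edgeStates (M.transpose j) i.succ).toNat -
        (edgeStates (M.transpose j) i.castSucc).toNat := fun i j =>
    (hM.apply_eq i j).symm.trans (hM.transpose.apply_eq j i)
  have ht : ∀ i, ‖Complex.exp (Complex.I * θ i)‖ = 1 := fun i => by
    rw [mul_comm, Complex.norm_exp_ofReal_mul_I]
  choose κ hκ hκn using fun i j => exists_cellWeight_tiltWeights (ht i) (hcell i j)
  have h1 : ∀ i, ∏ j : Fin N, Complex.exp (Complex.I * θ i) ^
      (1 - (edgeStates (M i) j.castSucc).toNat) =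
        Complex.exp (Complex.I * (θ i * psiRow M i : ℝ)) := by
    intro i
    rw [Finset.prod_pow_eq_pow_sum, ← Complex.exp_nat_mul, hM.psiRow_eq]
    congr 1
    have : ((∑ j : Fin N, (1 - (edgeStates (M i) j.castSucc).toNat) : ℕ) : ℂ) =
        ∑ j : Fin N, (1 - (edgeStates (M i) j.castSucc).toNat : ℂ) := by
      rw [Nat.cast_sum]
      refine Finset.sum_congr rfl fun j _ => ?_
      rw [Nat.cast_sub (Bool.toNat_le _)]
      simp
    rw [this]
    push_cast
    ring
  have h2 : asmWeight (fun i _ => tiltWeights (Complex.exp (Complex.I * θ i))) M =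
      Complex.exp (Complex.I * (∑ i, θ i * psiRow M i : ℝ)) *
        ∏ p : Fin N × Fin N, (1 + κ p.1 p.2) := by
    rw [asmWeight, Fintype.prod_prod_type, Complex.ofReal_sum, Finset.mul_sum, Complex.exp_sum,
      ← Finset.prod_mul_distrib]
    refine Finset.prod_congr rfl fun i _ => ?_
    rw [← h1, ← Finset.prod_mul_distrib]
    exact Finset.prod_congr rfl fun j _ => hκ i j
  have h3 : ∑ p : Fin N × Fin N, ‖κ p.1 p.2‖ ≤ ∑ i : Fin N, (2 * (i : ℕ) + 1) * |θ i| := by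
    rw [Fintype.sum_prod_type]
    refine Finset.sum_le_sum fun i _ => ?_
    calc ∑ j, ‖κ i j‖ ≤ ∑ j, (((edgeStates (M.transpose j) i.castSucc).toNat : ℝ) +
          (edgeStates (M.transpose j) i.succ).toNat) * ‖Complex.exp (Complex.I * θ i) - 1‖ :=
          Finset.sum_le_sum fun j _ => hκn i j
      _ = (2 * (i : ℕ) + 1) * ‖Complex.exp (Complex.I * θ i) - 1‖ := by
          rw [← Finset.sum_mul, Finset.sum_add_distrib, ← Nat.cast_sum, ← Nat.cast_sum,
            hM.sum_edgeStates_transpose, hM.sum_edgeStates_transpose, Fin.val_castSucc,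
            Fin.val_succ]
          push_cast
          ring
      _ ≤ _ := by
          gcongr
          simpa using Real.norm_exp_I_mul_ofReal_sub_one_le (x := θ i)
  rw [h2, ← mul_sub_one, norm_mul, mul_comm Complex.I, Complex.norm_exp_ofReal_mul_I, one_mul]
  refine (Finset.norm_prod_one_add_sub_one_le _ _).trans ?_
  gcongr

theorem norm_tiltedZ_sub_le (θ : Fin N → ℝ) :
    ‖tiltedZ (fun i => Complex.exp (Complex.I * θ i)) -
      ∑ M ∈ asmFinset N, Complex.exp (Complex.I * (∑ i, θ i * psiRow M i : ℝ))‖ ≤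
      (asmFinset N).card * (Real.exp (∑ i : Fin N, (2 * (i : ℕ) + 1) * |θ i|) - 1) := by
  rw [tiltedZ, sixVertexZ_eq_sum_asmWeight, ← Finset.sum_sub_distrib, ← nsmul_eq_mul]
  exact (norm_sum_le _ _).trans (Finset.sum_le_card_nsmul _ _ _ fun M hM =>
    (mem_asmFinset.1 hM).norm_asmWeight_sub_le θ)

theorem tiltedZ_one : tiltedZ (fun _ : Fin N => 1) = (asmFinset N).card := by
  have h := norm_tiltedZ_sub_le (N := N) fun _ => 0
  simp only [Complex.ofReal_zero, mul_zero, Complex.exp_zero, zero_mul, Finset.sum_const_zero,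
    Finset.sum_const, nsmul_eq_mul, mul_one, abs_zero, Real.exp_zero, sub_self] at h
  exact sub_eq_zero.1 (norm_le_zero_iff.1 h)

theorem isASM_one : IsASM (1 : Matrix (Fin N) (Fin N) ℤ) := by
  refine ⟨fun i j => ?_, fun i => ?_, fun j => ?_, fun i m => ?_, fun j m => ?_⟩
  · by_cases h : i = j <;> simp [Matrix.one_apply, h]
  · simp [Matrix.one_apply]
  · simp [Matrix.one_apply]
  · by_cases h : i ≤ m <;> simp [Matrix.one_apply, h]
  · by_cases h : j ≤ m <;> simp [Matrix.one_apply, h]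

theorem card_asmFinset_pos (N : ℕ) : 0 < (asmFinset N).card :=
  Finset.card_pos.2 ⟨1, mem_asmFinset.2 isASM_one⟩

theorem continuous_tiltedZ : Continuous (tiltedZ : (Fin N → ℂ) → ℂ) := by
  unfold tiltedZ sixVertexZ
  refine continuous_finsetSum _ fun h _ => continuous_finsetSum _ fun s _ =>
    continuous_finsetProd _ fun i _ => continuous_finsetProd _ fun j _ => ?_
  cases h i j.castSucc <;> cases s j i.castSucc <;> cases h i j.succ <;> cases s j i.succ <;>
    simp only [cellWeight, tiltWeights] <;> fun_prop

end AlternatingSignMatrices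

section Laplace

/-- The centred and rescaled integrand of `edgeIntegral`. -/
noncomputable def laplaceIntegrand (n : ℕ) (u y : ℝ) : ℂ :=
  (Set.Ioc (-√n) √n).indicator (fun y : ℝ =>
    (Real.cos (u / 2) + Complex.I * (y / √n * Real.sin (u / 2) : ℝ)) ^ n *
      ((1 - y ^ 2 / n : ℝ) : ℂ) ^ n) y

theorem edgeIntegral_exp_eq {n : ℕ} (hn : n ≠ 0) (u : ℝ) :
    edgeIntegral n (Complex.exp (Complex.I * u)) 1 * Complex.exp (-(Complex.I * (u * n / 2))) =
      ((2 * √n)⁻¹ * (1 / 4) ^ n : ℝ) * ∫ y, laplaceIntegrand n u y := by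
  have hn0 : (0 : ℝ) < n := by positivity
  have hs : 0 < √(n : ℝ) := Real.sqrt_pos.2 hn0
  have hs2 : √(n : ℝ) ^ 2 = n := Real.sq_sqrt hn0.le
  have hc : (2 * √(n : ℝ))⁻¹ ≠ 0 := by positivity
  have h1 := intervalIntegral.integral_comp_mul_add (a := -√(n : ℝ)) (b := √(n : ℝ))
    (fun p : ℝ => ((1 - (p : ℂ)) * 1 + p * Complex.exp (Complex.I * u)) ^ n *
      ((p : ℂ) * (1 - p)) ^ n) hc (1 / 2)
  have e1 : (2 * √(n : ℝ))⁻¹ * -√n + 1 / 2 = 0 := by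
    field_simp
    norm_num
  have e2 : (2 * √(n : ℝ))⁻¹ * √n + 1 / 2 = 1 := by
    field_simp
    norm_num
  rw [e1, e2, inv_inv] at h1
  have h2 : edgeIntegral n (Complex.exp (Complex.I * u)) 1 = ((2 * √n)⁻¹ : ℝ) •
      ∫ p in -√(n : ℝ)..√n, ((1 - (((2 * √n)⁻¹ * p + 1 / 2 : ℝ) : ℂ)) * 1 +
        ((2 * √n)⁻¹ * p + 1 / 2 : ℝ) * Complex.exp (Complex.I * u)) ^ n *
          ((((2 * √n)⁻¹ * p + 1 / 2 : ℝ) : ℂ) * (1 - ((2 * √n)⁻¹ * p + 1 / 2 : ℝ))) ^ n := by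
    rw [h1, smul_smul, inv_mul_cancel₀ (by positivity), one_smul, edgeIntegral]
  have h3 : ∀ p : ℝ, (((1 - (((2 * √n)⁻¹ * p + 1 / 2 : ℝ) : ℂ)) * 1 +
        ((2 * √n)⁻¹ * p + 1 / 2 : ℝ) * Complex.exp (Complex.I * u)) ^ n *
          ((((2 * √n)⁻¹ * p + 1 / 2 : ℝ) : ℂ) * (1 - ((2 * √n)⁻¹ * p + 1 / 2 : ℝ))) ^ n) *
        Complex.exp (-(Complex.I * (u * n / 2))) = ((1 / 4) ^ n : ℝ) *
        ((Real.cos (u / 2) + Complex.I * (p / √n * Real.sin (u / 2) : ℝ)) ^ n *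
          ((1 - p ^ 2 / n : ℝ) : ℂ) ^ n) := by
    intro p
    have e3 : Complex.exp (-(Complex.I * (u * n / 2))) =
        Complex.exp (-(Complex.I * (u / 2))) ^ n := by
      rw [← Complex.exp_nat_mul]
      congr 1
      ring
    have e4 : ((1 - (((2 * √n)⁻¹ * p + 1 / 2 : ℝ) : ℂ)) * 1 +
        ((2 * √n)⁻¹ * p + 1 / 2 : ℝ) * Complex.exp (Complex.I * u)) *
          Complex.exp (-(Complex.I * (u / 2))) =
        Real.cos (u / 2) + Complex.I * (p / √n * Real.sin (u / 2) : ℝ) := by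
      have e5 : Complex.exp (Complex.I * u) = Complex.exp (Complex.I * (u / 2)) *
          Complex.exp (Complex.I * (u / 2)) := by
        rw [← Complex.exp_add]
        congr 1
        ring
      have e6 : Complex.exp (Complex.I * (u / 2)) * Complex.exp (-(Complex.I * (u / 2))) = 1 := by
        rw [← Complex.exp_add, add_neg_cancel, Complex.exp_zero]
      push_cast
      rw [Complex.cos, Complex.sin, e5, show (u : ℂ) / 2 * Complex.I = Complex.I * (u / 2) by ring,
        show -((u : ℂ) / 2) * Complex.I = -(Complex.I * (u / 2)) by ring]
      set E := Complex.exp (Complex.I * (u / 2))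
      set F := Complex.exp (-(Complex.I * (u / 2)))
      have hsc : ((√n : ℝ) : ℂ) ≠ 0 := by exact_mod_cast hs.ne'
      field_simp
      linear_combination ((p : ℂ) * E + √n * E) * e6 + (p * E - p * F) * Complex.I_sq
    have e7 : ((((2 * √n)⁻¹ * p + 1 / 2 : ℝ) : ℂ) * (1 - ((2 * √n)⁻¹ * p + 1 / 2 : ℝ))) =
        ((1 / 4 : ℝ) : ℂ) * ((1 - p ^ 2 / n : ℝ) : ℂ) := by
      rw [← Complex.ofReal_one, ← Complex.ofReal_sub, ← Complex.ofReal_mul, ← Complex.ofReal_mul]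
      congr 1
      rw [show p ^ 2 / n = (p / √n) ^ 2 by rw [div_pow, hs2]]
      field_simp
      ring
    rw [e3, e7, ← e4, mul_pow, mul_pow, Complex.ofReal_pow]
    ring
  rw [h2, smul_mul_assoc, ← intervalIntegral.integral_mul_const]
  simp only [h3]
  rw [intervalIntegral.integral_const_mul, Complex.real_smul, ← mul_assoc, ← Complex.ofReal_mul,
    intervalIntegral.integral_of_le (by linarith), ← integral_indicator measurableSet_Ioc]
  rfl

theorem norm_laplaceIntegrand_le (n : ℕ) (u y : ℝ) :
    ‖laplaceIntegrand n u y‖ ≤ Real.exp (-1 * y ^ 2) := by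
  rw [laplaceIntegrand, Set.indicator_apply]
  split_ifs with hy
  · have hs : 0 < √(n : ℝ) := by
      have := hy.1.trans_le hy.2
      linarith
    have hn0 : (0 : ℝ) < n := Real.sqrt_pos.1 hs
    have hy2 : (y / √n) ^ 2 ≤ 1 := by
      rw [div_pow, div_le_one (by positivity), sq_le_sq, abs_of_pos hs, abs_le]
      exact ⟨hy.1.le, hy.2⟩
    have h1 : ‖(Real.cos (u / 2) + Complex.I * (y / √n * Real.sin (u / 2) : ℝ) : ℂ)‖ ≤ 1 := by
      rw [← sq_le_one_iff₀ (norm_nonneg _), mul_comm, Complex.sq_norm, Complex.normSq_add_mul_I,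
        ← Real.cos_sq_add_sin_sq (u / 2), mul_pow]
      gcongr
      exact mul_le_of_le_one_left (sq_nonneg _) hy2
    have h2 : (0 : ℝ) ≤ 1 - y ^ 2 / n := by
      rw [div_pow, Real.sq_sqrt hn0.le] at hy2
      linarith
    rw [norm_mul, norm_pow, norm_pow, Complex.norm_of_nonneg h2]
    calc _ ≤ 1 ^ n * Real.exp (-(y ^ 2 / n)) ^ n := by
          gcongr
          have := Real.add_one_le_exp (-(y ^ 2 / n))
          linarith
      _ = _ := by
          rw [one_pow, one_mul, ← Real.exp_nat_mul]
          congr 1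
          field_simp
  · simp [Real.exp_nonneg]

theorem tendsto_laplaceIntegrand {u : ℕ → ℝ} {θ : ℝ}
    (hu : Tendsto (fun n : ℕ => √n * u n) atTop (nhds θ)) (y : ℝ) :
    Tendsto (fun n => laplaceIntegrand n (u n) y) atTop
      (nhds (Complex.exp (-(θ ^ 2 / 8)) * (Complex.exp (Complex.I * (θ / 2 : ℝ) * y) *
        Complex.exp (-1 * (y : ℂ) ^ 2)))) := by
  have hsq : Tendsto (fun n : ℕ => √(n : ℝ)) atTop atTop :=
    Real.tendsto_sqrt_atTop.comp tendsto_natCast_atTop_atTop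
  have hu0 : Tendsto u atTop (nhds 0) := by
    have := hu.mul (tendsto_inv_atTop_zero.comp hsq)
    rw [mul_zero] at this
    refine this.congr' ?_
    filter_upwards [eventually_gt_atTop 0] with n hn
    have : 0 < √(n : ℝ) := Real.sqrt_pos.2 (by exact_mod_cast hn)
    simp only [Function.comp_apply]
    field_simp
  have hsin : Tendsto (fun n : ℕ => √n * Real.sin (u n / 2)) atTop (nhds (θ / 2)) := by
    have h1 : Tendsto (fun n => Real.sinc (u n / 2)) atTop (nhds 1) := by
      have := (Real.continuous_sinc.tendsto 0).comp (by simpa using hu0.div_const 2 :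
        Tendsto (fun n => u n / 2) atTop (nhds 0))
      simpa [Function.comp_def] using this
    have h2 := (hu.div_const 2).mul h1
    rw [mul_one] at h2
    refine h2.congr fun n => ?_
    by_cases h : u n / 2 = 0
    · have : u n = 0 := by linarith
      simp [this]
    · rw [Real.sinc_of_ne_zero h]
      have : u n ≠ 0 := fun h' => h (by simp [h'])
      field_simp
  have hcos : Tendsto (fun n : ℕ => (n : ℝ) * (Real.cos (u n / 2) - 1)) atTop
      (nhds (-(θ ^ 2 / 8))) := by
    have h1 : Tendsto (fun n : ℕ => -(√n * Real.sin (u n / 2)) ^ 2 / (1 + Real.cos (u n / 2)))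
        atTop (nhds (-(θ / 2) ^ 2 / (1 + Real.cos 0))) := by
      refine (hsin.pow 2).neg.div ((tendsto_const_nhds).add
        ((Real.continuous_cos.tendsto 0).comp ?_)) (by norm_num)
      simpa using hu0.div_const 2
    rw [Real.cos_zero, show -(θ / 2) ^ 2 / (1 + 1) = -(θ ^ 2 / 8) by ring] at h1
    have h2 : ∀ᶠ n in atTop, 0 < 1 + Real.cos (u n / 2) := by
      have : Tendsto (fun n => 1 + Real.cos (u n / 2)) atTop (nhds (1 + Real.cos 0)) := by
        refine (tendsto_const_nhds).add ((Real.continuous_cos.tendsto 0).comp ?_)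
        simpa using hu0.div_const 2
      exact this.eventually (lt_mem_nhds (by norm_num))
    refine h1.congr' ?_
    filter_upwards [h2] with n hn
    rw [div_eq_iff hn.ne', mul_pow, Real.sq_sqrt (Nat.cast_nonneg n), Real.sin_sq]
    ring
  have h1 : Tendsto (fun n : ℕ => (Real.cos (u n / 2) +
      Complex.I * (y / √n * Real.sin (u n / 2) : ℝ) : ℂ) ^ n) atTop
      (nhds (Complex.exp ((-(θ ^ 2 / 8) : ℝ) + Complex.I * ((y * (θ / 2) : ℝ) : ℂ)))) := by
    have h3 := Complex.tendsto_one_add_pow_exp_of_tendsto (g := fun n => (Real.cos (u n / 2) - 1 +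
      Complex.I * (y / √n * Real.sin (u n / 2) : ℝ) : ℂ))
      (t := (-(θ ^ 2 / 8) : ℝ) + Complex.I * ((y * (θ / 2) : ℝ) : ℂ)) ?_
    · refine h3.congr fun n => ?_
      congr 1
      ring
    · have h4 := ((Complex.continuous_ofReal.tendsto _).comp hcos).add
        (((Complex.continuous_ofReal.tendsto _).comp (hsin.const_mul y)).const_mul Complex.I)
      refine h4.congr' ?_
      filter_upwards [eventually_gt_atTop 0] with n hn
      have hs : 0 < √(n : ℝ) := Real.sqrt_pos.2 (by exact_mod_cast hn)
      have hs2 : (n : ℝ) * (y / √n * Real.sin (u n / 2)) = y * (√n * Real.sin (u n / 2)) := by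
        have := Real.sq_sqrt (Nat.cast_nonneg (α := ℝ) n)
        field_simp
        rw [this]
        ring
      simp only [Function.comp_apply, ← hs2]
      push_cast
      ring
  have h2 : Tendsto (fun n : ℕ => ((1 - y ^ 2 / n : ℝ) : ℂ) ^ n) atTop
      (nhds (Complex.exp (-1 * (y : ℂ) ^ 2))) := by
    have h3 := Complex.tendsto_one_add_pow_exp_of_tendsto (g := fun n : ℕ => -((y : ℂ) ^ 2 / n))
      (t := -1 * (y : ℂ) ^ 2) ?_
    · refine h3.congr fun n => ?_
      push_cast
      ring
    · refine tendsto_const_nhds.congr' ?_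
      filter_upwards [eventually_gt_atTop 0] with n hn
      have : (n : ℂ) ≠ 0 := by exact_mod_cast hn.ne'
      field_simp
  have h3 := h1.mul h2
  rw [Complex.exp_add, mul_assoc] at h3
  have e1 : Complex.I * ((y * (θ / 2) : ℝ) : ℂ) = Complex.I * (θ / 2 : ℝ) * y := by
    push_cast
    ring
  rw [e1] at h3
  push_cast at h3 ⊢
  refine h3.congr' ?_
  filter_upwards [hsq.eventually_gt_atTop |y|] with n hn
  rw [laplaceIntegrand, Set.indicator_of_mem]
  · push_cast
    rfl
  · exact ⟨(abs_lt.1 hn).1, (abs_lt.1 hn).2.le⟩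

theorem tendsto_integral_laplaceIntegrand {u : ℕ → ℝ} {θ : ℝ}
    (hu : Tendsto (fun n : ℕ => √n * u n) atTop (nhds θ)) :
    Tendsto (fun n => ∫ y, laplaceIntegrand n (u n) y) atTop
      (nhds ((Real.pi / 1 : ℂ) ^ (1 / 2 : ℂ) * Complex.exp (-(3 * θ ^ 2 / 16)))) := by
  have h1 := tendsto_integral_filter_of_dominated_convergence (μ := volume)
    (fun y : ℝ => Real.exp (-1 * y ^ 2)) (F := fun n y => laplaceIntegrand n (u n) y)
    (l := atTop) ?_ (Eventually.of_forall fun n => Eventually.of_forall fun y =>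
      norm_laplaceIntegrand_le n (u n) y) (integrable_exp_neg_mul_sq one_pos)
      (Eventually.of_forall fun y => tendsto_laplaceIntegrand hu y)
  · rw [integral_const_mul, fourierIntegral_gaussian (by norm_num)] at h1
    convert h1 using 2
    rw [mul_left_comm, ← Complex.exp_add]
    congr 2
    push_cast
    ring
  · refine Eventually.of_forall fun n => ?_
    refine Measurable.aestronglyMeasurable ?_
    exact Measurable.indicator (by fun_prop) measurableSet_Ioc

/-- The Gaussian limit of the normalized edge integrals. -/
theorem tendsto_edgeIntegral_div {u : ℕ → ℝ} {θ : ℝ}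
    (hu : Tendsto (fun n : ℕ => √n * u n) atTop (nhds θ)) :
    Tendsto (fun n : ℕ => edgeIntegral n (Complex.exp (Complex.I * u n)) 1 / edgeIntegral n 1 1 *
      Complex.exp (-(Complex.I * (u n * n / 2)))) atTop
      (nhds (Complex.exp (-(3 * θ ^ 2 / 16)))) := by
  have hK : (Real.pi / 1 : ℂ) ^ (1 / 2 : ℂ) ≠ 0 := by
    rw [div_one, Complex.cpow_ne_zero_iff_of_exponent_ne_zero (by norm_num)]
    exact_mod_cast Real.pi_ne_zero
  have h0 := tendsto_integral_laplaceIntegrand (u := fun _ => 0) (θ := 0) (by simp)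
  have h1 := (tendsto_integral_laplaceIntegrand hu).div h0
    (mul_ne_zero hK (Complex.exp_ne_zero _))
  rw [Complex.ofReal_zero, zero_pow two_ne_zero, mul_zero, zero_div, neg_zero, Complex.exp_zero,
    mul_one, mul_div_cancel_left₀ _ hK] at h1
  refine h1.congr' ?_
  filter_upwards [eventually_ne_atTop 0] with n hn
  have h2 := edgeIntegral_exp_eq hn 0
  simp only [Complex.ofReal_zero, mul_zero, Complex.exp_zero, zero_mul, zero_div, neg_zero,
    mul_one] at h2
  have hn0 : (0 : ℝ) < n := by positivity
  have hc : (((2 * √n)⁻¹ * (1 / 4) ^ n : ℝ) : ℂ) ≠ 0 := by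
    have := Real.sqrt_pos.2 hn0
    exact_mod_cast (by positivity : ((2 * √(n : ℝ))⁻¹ * (1 / 4) ^ n) ≠ 0)
  rw [div_mul_eq_mul_div, edgeIntegral_exp_eq hn, h2, mul_div_mul_left _ _ hc]
  rfl

end Laplace

section DeterminantLimit

variable {m : ℕ}

/-- The determinant with the edge integrals normalized to be `1` at `1`. -/
noncomputable def normTiltDet (r : ℕ) (t : Fin m → ℂ) : ℂ :=
  (Matrix.of fun i k : Fin m => t i ^ (m - 1 - k : ℕ) * (t i - 1) ^ (k : ℕ) *
    (edgeIntegral (r + k) (t i) 1 / edgeIntegral (r + k) 1 1)).det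

theorem edgeIntegral_one_one_ne_zero (n : ℕ) : edgeIntegral n 1 1 ≠ 0 := by
  obtain ⟨r, hr, h⟩ := edgeIntegral_one_one_pos n
  rw [h]
  exact_mod_cast hr.ne'

theorem tiltDet_eq_mul_normTiltDet (r : ℕ) (t : Fin m → ℂ) :
    tiltDet r t = (∏ k : Fin m, edgeIntegral (r + k) 1 1) * normTiltDet r t := by
  rw [tiltDet, normTiltDet, ← Matrix.det_mul_row]
  congr 1
  ext i k
  have := edgeIntegral_one_one_ne_zero (r + k)
  simp only [Matrix.of_apply]
  field_simp

theorem prod_pow_mul_det_vandermonde (c : ℂ) (t : Fin m → ℂ) :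
    (∏ k : Fin m, c ^ (k : ℕ)) * (Matrix.vandermonde t).det =
      (Matrix.vandermonde fun i => c * (t i - 1)).det := by
  rw [← Matrix.det_vandermonde_sub t 1, ← Matrix.det_mul_row]
  congr 1
  ext i k
  simp [Matrix.vandermonde_apply, mul_pow]

variable {α : Type*} {l : Filter α} {t : α → Fin m → ℂ} {c : α → ℂ} {a : Fin m → ℂ}

theorem tendsto_det_vandermonde (hc : ∀ i, Tendsto (fun x => c x * (t x i - 1)) l (nhds (a i))) :
    Tendsto (fun x => (∏ k : Fin m, c x ^ (k : ℕ)) * (Matrix.vandermonde (t x)).det) l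
      (nhds (Matrix.vandermonde a).det) := by
  simp only [prod_pow_mul_det_vandermonde]
  refine ((continuous_id.matrix_det).tendsto (Matrix.vandermonde a)).comp ?_
  exact tendsto_pi_nhds.2 fun i => tendsto_pi_nhds.2 fun k => (hc i).pow k

theorem tendsto_det_mul {H : α → Fin m → Fin m → ℂ} {G : Fin m → ℂ}
    (ht : ∀ i, Tendsto (fun x => t x i) l (nhds 1))
    (hc : ∀ i, Tendsto (fun x => c x * (t x i - 1)) l (nhds (a i)))
    (hH : ∀ i k, Tendsto (fun x => H x i k) l (nhds (G i))) :
    Tendsto (fun x => (∏ k : Fin m, c x ^ (k : ℕ)) * (Matrix.of fun i k : Fin m =>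
      t x i ^ (m - 1 - k : ℕ) * (t x i - 1) ^ (k : ℕ) * H x i k).det) l
      (nhds ((∏ i, G i) * (Matrix.vandermonde a).det)) := by
  rw [← Matrix.det_mul_column]
  simp only [← Matrix.det_mul_row]
  refine ((continuous_id.matrix_det).tendsto _).comp ?_
  refine tendsto_pi_nhds.2 fun i => tendsto_pi_nhds.2 fun k => ?_
  have h := (((ht i).pow (m - 1 - k)).mul ((hc i).pow k)).mul (hH i k)
  rw [one_pow, one_mul, mul_comm (a i ^ (k : ℕ))] at h
  refine h.congr fun x => ?_
  simp only [Matrix.of_apply, mul_pow]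
  ring

theorem tiltedZ_mul_det_vandermonde {ω : ℂ} (hω : ω ^ 2 + ω + 1 = 0) {r : ℕ} {t : Fin m → ℂ}
    (ht : ∀ i, gaugeDenom ω (t i) ≠ 0) (ht1 : ∀ i, t i ≠ 1) :
    tiltedZ (Fin.append t fun _ : Fin r => 1) * (Matrix.vandermonde t).det =
      (asmFinset (m + r)).card * normTiltDet r t := by
  set c : ℕ → ℂ := fun n => n
  set a : Fin m → ℂ := fun i => (i : ℕ) + 1
  set s : ℕ → Fin m → ℂ := fun n i => 1 + a i / n
  have ha : ∀ i, a i ≠ 0 := fun i => Nat.cast_add_one_ne_zero _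
  have hs : ∀ i, Tendsto (fun n => s n i) atTop (nhds 1) := by
    intro i
    simpa using (tendsto_const_div_atTop_nhds_zero_nat (a i)).const_add 1
  have hc : ∀ i, Tendsto (fun n => c n * (s n i - 1)) atTop (nhds (a i)) := by
    intro i
    refine tendsto_const_nhds.congr' ?_
    filter_upwards [eventually_ne_atTop 0] with n hn
    have : (n : ℂ) ≠ 0 := Nat.cast_ne_zero.2 hn
    simp only [c, s]
    field_simp
    ring
  have hV := tendsto_det_vandermonde hc
  have hD := tendsto_det_mul (H := fun n i k => edgeIntegral (r + k) (s n i) 1 /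
    edgeIntegral (r + k) 1 1) (G := fun _ => 1) hs hc fun i k => by
      have := (((continuous_edgeIntegral (r + k) 1).tendsto 1).comp (hs i)).div_const
        (edgeIntegral (r + k) 1 1)
      rwa [div_self (edgeIntegral_one_one_ne_zero _)] at this
  rw [Finset.prod_const_one, one_mul] at hD
  have hZ : Tendsto (fun n => tiltedZ (Fin.append (s n) fun _ : Fin r => 1)) atTop
      (nhds (asmFinset (m + r)).card) := by
    rw [← tiltedZ_one]
    refine (continuous_tiltedZ.tendsto _).comp (tendsto_pi_nhds.2 fun k => ?_)
    induction k using Fin.addCases with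
    | left i => simpa using hs i
    | right i => simp
  have hV0 : (Matrix.vandermonde a).det ≠ 0 := by
    rw [Matrix.det_vandermonde_ne_zero_iff]
    intro i j hij
    simpa [a, Fin.val_inj] using hij
  have hg : ∀ᶠ n in atTop, ∀ i, gaugeDenom ω (s n i) ≠ 0 := by
    refine eventually_all.2 fun i => ?_
    have h1 : Continuous (gaugeDenom ω) := by
      unfold gaugeDenom
      fun_prop
    have h2 := (h1.tendsto 1).comp (hs i)
    rw [gaugeDenom_one] at h2
    exact h2.eventually_ne one_ne_zero
  have h1 := (hD.const_mul (tiltedZ (Fin.append t fun _ : Fin r => 1) *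
    (Matrix.vandermonde t).det))
  have h2 := (hZ.mul hV).mul_const (normTiltDet r t)
  have h3 := tendsto_nhds_unique_of_eventuallyEq h1 h2 (by
    filter_upwards [hg, eventually_ne_atTop 0] with n hn hn0
    have h4 := tiltedZ_mul_tiltDet hω (r := r) ht hn ht1 fun i => by
      simpa [s] using ⟨ha i, hn0⟩
    rw [tiltDet_eq_mul_normTiltDet, tiltDet_eq_mul_normTiltDet] at h4
    have h5 : ∏ k : Fin m, edgeIntegral (r + k) 1 1 ≠ 0 :=
      Finset.prod_ne_zero_iff.2 fun k _ => edgeIntegral_one_one_ne_zero _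
    have h6 : tiltedZ (Fin.append t fun _ : Fin r => 1) * (Matrix.vandermonde t).det *
        normTiltDet r (s n) = tiltedZ (Fin.append (s n) fun _ : Fin r => 1) *
          (Matrix.vandermonde (s n)).det * normTiltDet r t := by
      apply mul_left_cancel₀ h5
      linear_combination h4
    change _ * ((∏ k : Fin m, c n ^ (k : ℕ)) * normTiltDet r (s n)) = _
    linear_combination (∏ k : Fin m, c n ^ (k : ℕ)) * h6)
  apply mul_right_cancel₀ hV0
  linear_combination h3

end DeterminantLimit

section CharacteristicFunction

variable {m : ℕ}

/-- The characteristic function of the scaled row sums of a uniform alternating sign matrix. -/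
noncomputable def psiCharFun (N : ℕ) (θ : Fin m → ℝ) : ℂ :=
  (∑ M ∈ asmFinset N, Complex.exp (Complex.I * (∑ k : Fin m, θ k * psiScaled M k : ℝ))) /
    (asmFinset N).card

theorem exp_append (r : ℕ) (u : Fin m → ℝ) :
    (fun i => Complex.exp (Complex.I * (Fin.append u (fun _ : Fin r => 0) i : ℝ))) =
      Fin.append (fun k => Complex.exp (Complex.I * u k)) fun _ : Fin r => 1 := by
  funext i
  induction i using Fin.addCases <;> simp

theorem psiCharFun_add (r : ℕ) (θ : Fin m → ℝ) :
    psiCharFun (m + r) θ = (∏ k : Fin m, Complex.exp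
      (-(Complex.I * (√(8 / 3) * θ k * √(m + r : ℕ) / 2 : ℝ)))) *
      ((∑ M ∈ asmFinset (m + r), Complex.exp (Complex.I * (∑ i : Fin (m + r), Fin.append
        (fun k => √(8 / 3) * θ k / √(m + r : ℕ)) (fun _ : Fin r => 0) i * psiRow M i : ℝ))) /
          (asmFinset (m + r)).card) := by
  rw [psiCharFun, ← Complex.exp_sum, ← mul_div_assoc, Finset.mul_sum]
  congr 1
  refine Finset.sum_congr rfl fun M _ => ?_
  rw [← Complex.exp_add]
  congr 1
  simp only [Fin.sum_univ_add, Fin.append_left, Fin.append_right, zero_mul,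
    Finset.sum_const_zero, add_zero, Fin.val_castAdd]
  rw [Finset.sum_neg_distrib, ← Finset.mul_sum, ← Complex.ofReal_sum, ← mul_neg, ← mul_add,
    ← Complex.ofReal_neg, ← Complex.ofReal_add, ← Finset.sum_neg_distrib,
    ← Finset.sum_add_distrib]
  congr 2
  refine Finset.sum_congr rfl fun k _ => ?_
  rw [psiScaled, mul_div_assoc, sub_div, div_right_comm, Real.div_sqrt]
  ring

theorem norm_psiCharFun_add_sub_le (r : ℕ) (θ : Fin m → ℝ) :
    ‖psiCharFun (m + r) θ - (∏ k : Fin m, Complex.exp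
      (-(Complex.I * (√(8 / 3) * θ k * √(m + r : ℕ) / 2 : ℝ)))) *
      (tiltedZ (Fin.append (fun k => Complex.exp
        (Complex.I * (√(8 / 3) * θ k / √(m + r : ℕ) : ℝ))) fun _ : Fin r => 1) /
          (asmFinset (m + r)).card)‖ ≤
      Real.exp (∑ k : Fin m, (2 * (k : ℕ) + 1) * |√(8 / 3) * θ k / √(m + r : ℕ)|) - 1 := by
  have h1 := norm_tiltedZ_sub_le (Fin.append (fun k : Fin m => √(8 / 3) * θ k / √(m + r : ℕ))
    fun _ : Fin r => 0)
  have h2 : ∑ i : Fin (m + r), (2 * ((i : ℕ) : ℝ) + 1) * |Fin.append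
      (fun k : Fin m => √(8 / 3) * θ k / √(m + r : ℕ)) (fun _ : Fin r => 0) i| =
      ∑ k : Fin m, (2 * ((k : ℕ) : ℝ) + 1) * |√(8 / 3) * θ k / √(m + r : ℕ)| := by
    rw [Fin.sum_univ_add]
    simp only [Fin.append_left, Fin.append_right, abs_zero, mul_zero, Finset.sum_const_zero,
      add_zero, Fin.val_castAdd]
  rw [exp_append, h2] at h1
  have hA : (0 : ℝ) < (asmFinset (m + r)).card := Nat.cast_pos.2 (card_asmFinset_pos _)
  have hE : ‖∏ k : Fin m, Complex.exp
      (-(Complex.I * (√(8 / 3) * θ k * √(m + r : ℕ) / 2 : ℝ)))‖ = 1 := by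
    rw [norm_prod]
    refine Finset.prod_eq_one fun k _ => ?_
    rw [mul_comm, ← neg_mul, ← Complex.ofReal_neg, Complex.norm_exp_ofReal_mul_I]
  rw [psiCharFun_add, ← mul_sub, norm_mul, hE, one_mul, ← sub_div, norm_div, Complex.norm_natCast,
    div_le_iff₀ hA, norm_sub_rev, mul_comm]
  exact h1

variable {θ : Fin m → ℝ}

theorem tendsto_sqrt_add_atTop (m : ℕ) : Tendsto (fun r : ℕ => √((m + r : ℕ) : ℝ)) atTop atTop :=
  Real.tendsto_sqrt_atTop.comp (tendsto_natCast_atTop_atTop.comp (tendsto_add_atTop_nat m)) |>.congr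
    fun r => by simp [add_comm]

theorem tendsto_mul_exp_sub_one {c : ℕ → ℝ} (hc : Tendsto c atTop atTop) (φ : ℝ) :
    Tendsto (fun r => (c r : ℂ) * (Complex.exp (Complex.I * (φ / c r : ℝ)) - 1)) atTop
      (nhds (Complex.I * φ)) := by
  have h1 : HasDerivAt (fun x : ℝ => Complex.exp (Complex.I * (φ * x : ℝ))) (Complex.I * φ) 0 := by
    have h2 : HasDerivAt (fun x : ℝ => Complex.I * ((φ * x : ℝ) : ℂ)) (Complex.I * φ) 0 := by
      simpa using (((hasDerivAt_id (0 : ℝ)).const_mul φ).ofReal_comp.const_mul Complex.I)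
    simpa using h2.cexp
  have h3 : Tendsto (fun r => (c r)⁻¹) atTop (nhdsWithin 0 {0}ᶜ) := tendsto_nhdsWithin_iff.2
    ⟨tendsto_inv_atTop_zero.comp hc, (hc.eventually_gt_atTop 0).mono fun r hr => (inv_pos.2 hr).ne'⟩
  refine (h1.tendsto_slope_zero.comp h3).congr fun r => ?_
  simp [div_eq_mul_inv]

theorem tendsto_exp_div {c : ℕ → ℝ} (hc : Tendsto c atTop atTop) (φ : ℝ) :
    Tendsto (fun r => Complex.exp (Complex.I * (φ / c r : ℝ))) atTop (nhds 1) := by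
  have h1 : Continuous fun x : ℝ => Complex.exp (Complex.I * x) := by fun_prop
  simpa [Function.comp_def] using (h1.tendsto 0).comp (hc.const_div_atTop φ)

theorem tendsto_centred_edgeIntegral (m k : ℕ) (φ : ℝ) :
    Tendsto (fun r : ℕ => edgeIntegral (r + k)
      (Complex.exp (Complex.I * (φ / √(m + r : ℕ) : ℝ))) 1 / edgeIntegral (r + k) 1 1 *
        Complex.exp (-(Complex.I * (φ * √(m + r : ℕ) / 2 : ℝ)))) atTop
      (nhds (Complex.exp (-(3 * φ ^ 2 / 16)))) := by
  have hu : Tendsto (fun n : ℕ => √n * (φ / √(n + (m - k : ℝ)))) atTop (nhds φ) := by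
    have h1 := (Real.continuous_sqrt.tendsto 1).comp (tendsto_natCast_div_add_atTop (m - k : ℝ))
    have h2 := h1.const_mul φ
    rw [Real.sqrt_one, mul_one] at h2
    refine h2.congr fun n => ?_
    rw [Function.comp_apply, Real.sqrt_div (Nat.cast_nonneg n)]
    ring
  have h1 := (tendsto_edgeIntegral_div hu).comp (tendsto_add_atTop_nat k)
  have h2 := tendsto_exp_div (tendsto_sqrt_add_atTop m) (φ * (k - m) / 2)
  have h3 := h1.mul h2
  rw [mul_one] at h3
  refine h3.congr' ?_
  filter_upwards [(tendsto_sqrt_add_atTop m).eventually_gt_atTop 0] with r hr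
  have e1 : ((r + k : ℕ) : ℝ) + (m - k : ℝ) = (m + r : ℕ) := by
    push_cast
    ring
  simp only [Function.comp_apply, e1]
  rw [mul_assoc, ← Complex.exp_add]
  congr 2
  have e2 : √((m + r : ℕ) : ℝ) ^ 2 = m + r := by
    rw [Real.sq_sqrt (Nat.cast_nonneg _)]
    push_cast
    rfl
  have e3 : φ / √((m + r : ℕ) : ℝ) * (r + k : ℕ) / 2 - φ * (k - m) / 2 / √((m + r : ℕ) : ℝ) =
      φ * √((m + r : ℕ) : ℝ) / 2 := by
    push_cast at hr e2 ⊢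
    field_simp
    rw [e2]
    ring
  rw [← e3]
  push_cast
  ring

theorem tendsto_psiCharFun_of_injective (hθ : Function.Injective θ) (hθ0 : ∀ k, θ k ≠ 0) :
    Tendsto (fun N => psiCharFun N θ) atTop (nhds (∏ k, Complex.exp (-(θ k ^ 2 / 2 : ℝ)))) := by
  obtain ⟨ω, hω⟩ : ∃ ω : ℂ, ω ^ 2 + ω + 1 = 0 := by
    obtain ⟨s, hs⟩ := IsAlgClosed.exists_pow_nat_eq (-3 : ℂ) two_pos
    exact ⟨(-1 + s) / 2, by linear_combination hs / 4⟩
  set φ : Fin m → ℝ := fun k => √(8 / 3) * θ k with hφ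
  have hκ : √(8 / 3 : ℝ) ≠ 0 := (Real.sqrt_pos.2 (by norm_num)).ne'
  set c : ℕ → ℝ := fun r => √(m + r : ℕ) with hc
  have hcT : Tendsto c atTop atTop := tendsto_sqrt_add_atTop m
  set t : ℕ → Fin m → ℂ := fun r k => Complex.exp (Complex.I * (φ k / c r : ℝ)) with ht
  set e : ℕ → Fin m → ℂ := fun r k => Complex.exp (-(Complex.I * (φ k * c r / 2 : ℝ))) with he
  have ht1 : ∀ k, Tendsto (fun r => t r k) atTop (nhds 1) := fun k => tendsto_exp_div hcT (φ k)
  have hct : ∀ k, Tendsto (fun r => (c r : ℂ) * (t r k - 1)) atTop (nhds (Complex.I * φ k)) :=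
    fun k => tendsto_mul_exp_sub_one hcT (φ k)
  have hV := tendsto_det_vandermonde hct
  have hD := tendsto_det_mul (H := fun r i k => edgeIntegral (r + k) (t r i) 1 /
    edgeIntegral (r + k) 1 1 * e r i) ht1 hct fun i k =>
      tendsto_centred_edgeIntegral m k (φ i)
  have hV0 : (Matrix.vandermonde fun k => Complex.I * (φ k : ℂ)).det ≠ 0 := by
    rw [Matrix.det_vandermonde_ne_zero_iff]
    intro i j hij
    exact hθ (by simpa [hφ, hκ] using hij)
  have hg : ∀ᶠ r in atTop, ∀ i, gaugeDenom ω (t r i) ≠ 0 := by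
    refine eventually_all.2 fun i => ?_
    have h1 : Continuous (gaugeDenom ω) := by
      unfold gaugeDenom
      fun_prop
    have h2 := (h1.tendsto 1).comp (ht1 i)
    rw [gaugeDenom_one] at h2
    exact h2.eventually_ne one_ne_zero
  have hne : ∀ᶠ r in atTop, ∀ i, t r i ≠ 1 := by
    refine eventually_all.2 fun i => ?_
    have h0 : Complex.I * (φ i : ℂ) ≠ 0 := by simp [hφ, hθ0 i]
    filter_upwards [(hct i).eventually_ne h0] with r hr h
    simp [h] at hr
  have hZ : Tendsto (fun r => (∏ k, e r k) * (tiltedZ (Fin.append (t r) fun _ : Fin r => 1) /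
      (asmFinset (m + r)).card)) atTop (nhds (∏ k, Complex.exp (-(3 * φ k ^ 2 / 16)))) := by
    have h1 := hD.div hV hV0
    rw [mul_div_cancel_right₀ _ hV0] at h1
    refine h1.congr' ?_
    filter_upwards [hg, hne, hV.eventually_ne hV0] with r hr hr1 hr2
    have h2 := tiltedZ_mul_det_vandermonde hω (r := r) hr hr1
    have hA : ((asmFinset (m + r)).card : ℂ) ≠ 0 := Nat.cast_ne_zero.2 (card_asmFinset_pos _).ne'
    have h3 : (Matrix.of fun i k : Fin m => t r i ^ (m - 1 - k : ℕ) * (t r i - 1) ^ (k : ℕ) *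
        (edgeIntegral (r + k) (t r i) 1 / edgeIntegral (r + k) 1 1 * e r i)).det =
          (∏ k, e r k) * normTiltDet r (t r) := by
      rw [normTiltDet, ← Matrix.det_mul_column]
      congr 1
      ext i k
      simp only [Matrix.of_apply]
      ring
    obtain ⟨hr3, hr4⟩ := mul_ne_zero_iff.1 hr2
    rw [Pi.div_apply, h3, mul_div_mul_left _ _ hr3, div_eq_iff hr4]
    field_simp
    linear_combination -(∏ k, e r k) * h2
  have hlim : ∀ k, Complex.exp (-(3 * φ k ^ 2 / 16)) = Complex.exp (-(θ k ^ 2 / 2 : ℝ)) := by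
    intro k
    congr 2
    have h1 : √(8 / 3 : ℝ) ^ 2 = 8 / 3 := Real.sq_sqrt (by norm_num)
    have h2 : 3 * φ k ^ 2 / 16 = θ k ^ 2 / 2 := by
      simp only [hφ, mul_pow, h1]
      ring
    rw [← h2]
    push_cast
    rfl
  simp only [hlim] at hZ
  rw [← tendsto_add_atTop_iff_nat m]
  have herr : Tendsto (fun r => Real.exp (∑ k : Fin m, (2 * (k : ℕ) + 1) * |φ k / c r|) - 1) atTop
      (nhds 0) := by
    have h1 : Tendsto (fun r => ∑ k : Fin m, (2 * (k : ℕ) + 1) * |φ k / c r|) atTop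
        (nhds (∑ k : Fin m, (2 * (k : ℕ) + 1) * |0|)) :=
      tendsto_finsetSum _ fun k _ => ((hcT.const_div_atTop (φ k)).abs).const_mul _
    have h2 := ((Real.continuous_exp.tendsto _).comp h1).sub_const 1
    simpa using h2
  have hdiff := squeeze_zero_norm (fun r => norm_psiCharFun_add_sub_le r θ) herr
  have h1 := hdiff.add hZ
  rw [zero_add] at h1
  refine h1.congr fun r => ?_
  rw [add_comm r m]
  exact sub_add_cancel _ _

end CharacteristicFunction

section Convergence

variable {m : ℕ}

theorem norm_psiCharFun_shift_sub_le (N : ℕ) (θ δ : Fin m → ℝ) :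
    ‖psiCharFun N (θ + δ) - psiCharFun N θ‖ ≤ √(2 - 2 * (psiCharFun N δ).re) := by
  set x : Matrix (Fin N) (Fin N) ℤ → ℝ := fun M => ∑ k : Fin m, θ k * psiScaled M k
  set y : Matrix (Fin N) (Fin N) ℤ → ℝ := fun M => ∑ k : Fin m, δ k * psiScaled M k
  have hA : (0 : ℝ) < (asmFinset N).card := Nat.cast_pos.2 (card_asmFinset_pos N)
  have hadd : ∀ M, ∑ k : Fin m, (θ + δ) k * psiScaled M k = x M + y M := fun M => by
    simp only [x, y, Pi.add_apply, add_mul, Finset.sum_add_distrib]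
  have hdiff : psiCharFun N (θ + δ) - psiCharFun N θ =
      (∑ M ∈ asmFinset N, Complex.exp (Complex.I * (x M : ℝ)) *
        (Complex.exp (Complex.I * (y M : ℝ)) - 1)) / (asmFinset N).card := by
    rw [psiCharFun, psiCharFun, ← sub_div, ← Finset.sum_sub_distrib]
    congr 1
    refine Finset.sum_congr rfl fun M _ => ?_
    rw [hadd, Complex.ofReal_add, mul_add, Complex.exp_add, mul_sub, mul_one]
  have hsq : ∀ M, ‖Complex.exp (Complex.I * (y M : ℝ)) - 1‖ ^ 2 = 2 - 2 * Real.cos (y M) :=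
    fun M => by
      rw [← Complex.normSq_eq_norm_sq, mul_comm, Complex.exp_mul_I, ← Complex.ofReal_cos,
        ← Complex.ofReal_sin, Complex.normSq_apply]
      simp only [Complex.sub_re, Complex.add_re, Complex.mul_re, Complex.ofReal_re,
        Complex.ofReal_im, Complex.I_re, Complex.I_im, Complex.one_re, Complex.sub_im,
        Complex.add_im, Complex.mul_im, Complex.one_im]
      linear_combination Real.sin_sq_add_cos_sq (y M)
  have hre : 2 - 2 * (psiCharFun N δ).re =
      (∑ M ∈ asmFinset N, (2 - 2 * Real.cos (y M))) / (asmFinset N).card := by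
    rw [psiCharFun, Complex.div_natCast_re, Complex.re_sum, Finset.sum_sub_distrib,
      ← Finset.mul_sum, Finset.sum_const, nsmul_eq_mul, sub_div, mul_div_cancel_left₀ _ hA.ne',
      mul_div_assoc]
    congr 3
    refine Finset.sum_congr rfl fun M _ => ?_
    rw [mul_comm, Complex.exp_ofReal_mul_I_re]
  refine Real.le_sqrt_of_sq_le ?_
  rw [hdiff, hre, norm_div, Complex.norm_natCast, div_pow, div_le_div_iff₀ (pow_pos hA 2) hA]
  have h1 : ‖∑ M ∈ asmFinset N, Complex.exp (Complex.I * (x M : ℝ)) *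
        (Complex.exp (Complex.I * (y M : ℝ)) - 1)‖ ≤
      ∑ M ∈ asmFinset N, ‖Complex.exp (Complex.I * (y M : ℝ)) - 1‖ := by
    refine norm_sum_le_of_le _ fun M _ => ?_
    rw [norm_mul, mul_comm Complex.I, Complex.norm_exp_ofReal_mul_I, one_mul]
  have h2 := (pow_le_pow_left₀ (norm_nonneg _) h1 2).trans (sq_sum_le_card_mul_sum_sq
    (s := asmFinset N) (f := fun M => ‖Complex.exp (Complex.I * (y M : ℝ)) - 1‖))
  simp only [hsq] at h2
  nlinarith [mul_le_mul_of_nonneg_right h2 hA.le]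

theorem eventually_add_mul_ne_zero (a : ℝ) {b : ℝ} (hb : b ≠ 0) :
    ∀ᶠ s in nhdsWithin (0 : ℝ) {0}ᶜ, a + s * b ≠ 0 := by
  rcases eq_or_ne a 0 with rfl | ha
  · filter_upwards [self_mem_nhdsWithin] with s hs
    rw [zero_add]
    exact mul_ne_zero hs hb
  · have h1 : Continuous fun s : ℝ => a + s * b := by fun_prop
    refine ((h1.tendsto 0).mono_left nhdsWithin_le_nhds).eventually_ne ?_
    simpa using ha

theorem eventually_injective_add (θ : Fin m → ℝ) :
    ∀ᶠ s in nhdsWithin (0 : ℝ) {0}ᶜ,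
      Function.Injective (θ + fun k : Fin m => s * ((k : ℕ) + 1 : ℝ)) ∧
        ∀ k, (θ + fun k : Fin m => s * ((k : ℕ) + 1 : ℝ)) k ≠ 0 := by
  refine Eventually.and ?_ (eventually_all.2 fun k =>
    eventually_add_mul_ne_zero (θ k) (Nat.cast_add_one_ne_zero _))
  have h1 : ∀ᶠ s in nhdsWithin (0 : ℝ) {0}ᶜ, ∀ i j : Fin m, i ≠ j →
      (θ i - θ j) + s * ((i : ℕ) - (j : ℕ) : ℝ) ≠ 0 := by
    refine eventually_all.2 fun i => eventually_all.2 fun j => ?_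
    by_cases hij : i = j
    · simp [hij]
    · refine (eventually_add_mul_ne_zero _ (sub_ne_zero.2 fun h => hij ?_)).mono fun s hs _ => hs
      exact Fin.ext (Nat.cast_injective h)
  filter_upwards [h1] with s hs i j hij
  by_contra hne
  refine hs i j hne ?_
  simp only [Pi.add_apply] at hij
  linear_combination hij

theorem tendsto_psiCharFun (θ : Fin m → ℝ) :
    Tendsto (fun N => psiCharFun N θ) atTop (nhds (∏ k, Complex.exp (-(θ k ^ 2 / 2 : ℝ)))) := by
  set g : (Fin m → ℝ) → ℂ := fun θ => ∏ k, Complex.exp (-(θ k ^ 2 / 2 : ℝ)) with hg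
  set d : ℝ → Fin m → ℝ := fun s k => s * ((k : ℕ) + 1 : ℝ) with hd
  have hgc : Continuous g := by fun_prop
  have hdc : Continuous d := by fun_prop
  have hd0 : d 0 = 0 := by
    ext k
    simp [hd]
  have hg0 : g 0 = 1 := by simp [hg]
  refine Metric.tendsto_nhds.2 fun η hη => ?_
  have h1 : ∀ᶠ s in nhdsWithin (0 : ℝ) {0}ᶜ, dist (g (θ + d s)) (g θ) < η / 3 := by
    have h : Continuous fun s => g (θ + d s) := by fun_prop
    have h' := h.tendsto 0
    rw [hd0, add_zero] at h'
    exact (h'.mono_left nhdsWithin_le_nhds).eventually (Metric.ball_mem_nhds _ (by positivity))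
  have h2 : ∀ᶠ s in nhdsWithin (0 : ℝ) {0}ᶜ, √(2 - 2 * (g (d s)).re) < η / 3 := by
    have h : Continuous fun s => √(2 - 2 * (g (d s)).re) := by fun_prop
    have h' := h.tendsto 0
    rw [hd0, hg0, Complex.one_re, mul_one, sub_self, Real.sqrt_zero] at h'
    exact (h'.mono_left nhdsWithin_le_nhds).eventually_lt_const (by positivity)
  have h3 : ∀ᶠ s in nhdsWithin (0 : ℝ) {0}ᶜ, Function.Injective (d s) ∧ ∀ k, d s k ≠ 0 := by
    simpa only [zero_add] using eventually_injective_add (0 : Fin m → ℝ)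
  obtain ⟨s, hs1, hs2, ⟨hi, hn⟩, ⟨hi0, hn0⟩⟩ :=
    (h1.and (h2.and ((eventually_injective_add θ).and h3))).exists
  have h4 := tendsto_psiCharFun_of_injective hi hn
  have h5 := ((Complex.continuous_re.tendsto _).comp
    (tendsto_psiCharFun_of_injective hi0 hn0)).const_mul 2 |>.const_sub 2 |>.sqrt
  filter_upwards [h4.eventually (Metric.ball_mem_nhds _ (by positivity : 0 < η / 3)),
    h5.eventually_lt_const hs2] with N hN1 hN2
  have h6 := (norm_psiCharFun_shift_sub_le N θ (d s)).trans_lt hN2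
  rw [← dist_eq_norm, dist_comm] at h6
  calc dist (psiCharFun N θ) (g θ)
      ≤ dist (psiCharFun N θ) (psiCharFun N (θ + d s)) +
          dist (psiCharFun N (θ + d s)) (g (θ + d s)) + dist (g (θ + d s)) (g θ) :=
        dist_triangle4 _ _ _ _
    _ < η / 3 + η / 3 + η / 3 := add_lt_add (add_lt_add h6 hN1) hs1
    _ = η := by ring

/-- The law of the first `m` scaled row sums of a uniform alternating sign matrix. -/
noncomputable def psiLaw (m N : ℕ) : Measure (EuclideanSpace ℝ (Fin m)) :=
  ((asmFinset N).card : ENNReal)⁻¹ •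
    ∑ M ∈ asmFinset N, Measure.dirac (WithLp.toLp 2 fun k : Fin m => psiScaled M k)

instance isProbabilityMeasure_psiLaw (N : ℕ) : IsProbabilityMeasure (psiLaw m N) := ⟨by
  simp [psiLaw, ENNReal.inv_mul_cancel (Nat.cast_ne_zero.2 (card_asmFinset_pos N).ne')
    (ENNReal.natCast_ne_top _)]⟩

theorem integral_psiLaw {E : Type*} [NormedAddCommGroup E] [NormedSpace ℝ E] [CompleteSpace E]
    (N : ℕ) (f : EuclideanSpace ℝ (Fin m) → E) :
    ∫ x, f x ∂psiLaw m N = ((asmFinset N).card : ℝ)⁻¹ •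
      ∑ M ∈ asmFinset N, f (WithLp.toLp 2 fun k : Fin m => psiScaled M k) := by
  rw [psiLaw, integral_smul_measure, integral_finsetSum_measure fun M _ => integrable_dirac
    enorm_lt_top]
  simp

theorem charFun_psiLaw (N : ℕ) (θ : EuclideanSpace ℝ (Fin m)) :
    charFun (psiLaw m N) θ = psiCharFun N θ := by
  rw [charFun, integral_psiLaw, psiCharFun, div_eq_inv_mul, Complex.real_smul, Complex.ofReal_inv,
    Complex.ofReal_natCast]
  congr 1
  refine Finset.sum_congr rfl fun M _ => ?_
  rw [mul_comm]
  simp [PiLp.inner_apply]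

theorem tendsto_sum_psiScaled (m : ℕ) (f : BoundedContinuousFunction (Fin m → ℝ) ℝ) :
    Tendsto (fun N : ℕ => (∑ᶠ M ∈ {M : Matrix (Fin N) (Fin N) ℤ | IsASM M},
        f (fun k : Fin m => psiScaled M (k : ℕ))) /
          (Nat.card {M : Matrix (Fin N) (Fin N) ℤ // IsASM M} : ℝ))
      atTop (nhds (∫ x, f x ∂(Measure.pi fun _ : Fin m => gaussianReal 0 1))) := by
  let μ : ℕ → ProbabilityMeasure (EuclideanSpace ℝ (Fin m)) :=
    fun N => ⟨psiLaw m N, inferInstance⟩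
  let ν : ProbabilityMeasure (EuclideanSpace ℝ (Fin m)) :=
    ⟨(Measure.pi fun _ : Fin m => gaussianReal 0 1).map (WithLp.toLp 2),
      Measure.isProbabilityMeasure_map (MeasurableEquiv.toLp 2 (Fin m → ℝ)).measurable.aemeasurable⟩
  have hT : Tendsto μ atTop (nhds ν) := by
    refine ProbabilityMeasure.tendsto_of_tendsto_charFun fun θ => ?_
    have h1 : charFun (ν : Measure (EuclideanSpace ℝ (Fin m))) θ =
        ∏ k, Complex.exp (-(θ k ^ 2 / 2 : ℝ)) := by
      refine (charFun_pi θ).trans (Finset.prod_congr rfl fun k _ => ?_)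
      rw [charFun_gaussianReal]
      congr 1
      push_cast
      ring
    rw [h1]
    exact (tendsto_psiCharFun fun k => θ k).congr fun N => (charFun_psiLaw N θ).symm
  have h1 : Tendsto (fun N => ∫ x, f (WithLp.ofLp x) ∂psiLaw m N) atTop
      (nhds (∫ x : EuclideanSpace ℝ (Fin m), f (WithLp.ofLp x)
        ∂(Measure.pi fun _ : Fin m => gaussianReal 0 1).map (MeasurableEquiv.toLp 2 _))) :=
    ProbabilityMeasure.tendsto_iff_forall_integral_tendsto.1 hT
      (f.compContinuous ⟨WithLp.ofLp, by fun_prop⟩)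
  rw [integral_map_equiv] at h1
  simp only [integral_psiLaw] at h1
  refine h1.congr fun N => ?_
  have h2 : {M : Matrix (Fin N) (Fin N) ℤ | IsASM M} = asmFinset N := by
    ext M
    simp [mem_asmFinset]
  have h3 : Nat.card {M : Matrix (Fin N) (Fin N) ℤ // IsASM M} = (asmFinset N).card := by
    rw [← Set.ncard_coe_finset, ← h2]
    rfl
  rw [h2, h3, finsum_mem_coe_finset, div_eq_inv_mul]
  rfl

end Convergence

/-- For a uniformly random ASM of size `N`: for each fixed `k ≥ 1` the random variable
`√(8/3)·(Ψ_k(N) − N/2)/√N` converges in distribution to a standard Gaussian as `N → ∞`;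
moreover, for any fixed `m`, the vector of these variables for `k = 1,…,m` converges in
distribution to `m` independent standard Gaussians.  (Expectations over the uniform measure
on ASMs are written as finite sums divided by the number of ASMs.) -/
theorem asm_psi_clt :
    (∀ k : ℕ, 1 ≤ k → ∀ f : BoundedContinuousFunction ℝ ℝ,
      Tendsto
        (fun N : ℕ =>
          (∑ᶠ M ∈ {M : Matrix (Fin N) (Fin N) ℤ | IsASM M}, f (psiScaled M (k - 1))) /
            (Nat.card {M : Matrix (Fin N) (Fin N) ℤ // IsASM M} : ℝ))
        atTop (nhds (∫ x, f x ∂(gaussianReal 0 1))))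
    ∧
    (∀ m : ℕ, ∀ f : BoundedContinuousFunction (Fin m → ℝ) ℝ,
      Tendsto
        (fun N : ℕ =>
          (∑ᶠ M ∈ {M : Matrix (Fin N) (Fin N) ℤ | IsASM M},
              f (fun k : Fin m => psiScaled M (k : ℕ))) /
            (Nat.card {M : Matrix (Fin N) (Fin N) ℤ // IsASM M} : ℝ))
        atTop (nhds (∫ x, f x ∂(Measure.pi fun _ : Fin m => gaussianReal 0 1)))) := by
  refine ⟨fun k hk f => ?_, tendsto_sum_psiScaled⟩
  let i : Fin k := ⟨k - 1, by omega⟩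
  have h1 := tendsto_sum_psiScaled k (f.compContinuous ⟨fun x => x i, by fun_prop⟩)
  have h2 := (measurePreserving_eval (fun _ : Fin k => gaussianReal 0 1) i).map_eq
  rw [← h2, integral_map (measurable_pi_apply i).aemeasurable f.continuous.aestronglyMeasurable]
  exact h1
end

section
/- The set of alternating sign matrices of size N is in bijection with 𝔾𝕋^{(N)}_{(1,2,…,N)}, the set of half-strict Gelfand–Tsetlin patterns with top row (1,2,…,N). The bijection sends an ASM with rows r^1,…,r^N to the pattern (μ^1 ≺ μ^2 ≺ … ≺ μ^N), where μ^k is the strictly increasing k-tuple of column numbers of the entries equal to 1 in the vector r^1 + r^2 + … + r^N restricted to the first k rows, i.e., of the partial sum r^1 + … + r^k. In particular, for every ASM and every k the vector r^1 + … + r^k has all entries in {0,1} with exactly k entries equal to 1, the resulting tuples interlace, μ^N = (1,2,…,N), and the map so defined is a bijection. -/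
/-- `μ ≺ lam`: interlacing, `lam_1 ≤ μ_1 ≤ lam_2 ≤ μ_2 ≤ … ≤ μ_n ≤ lam_{n+1}`. -/
def Interlaces {n : ℕ} (μ : Fin n → ℤ) (lam : Fin (n + 1) → ℤ) : Prop :=
  ∀ i : Fin n, lam i.castSucc ≤ μ i ∧ μ i ≤ lam i.succ

/-- A half-strict Gelfand–Tsetlin pattern of depth `N`: rows `μ^1, …, μ^N` with `μ^k` a
strictly increasing `k`-tuple of integers, consecutive rows interlacing. -/
def IsGTPattern {N : ℕ} (μ : ∀ k : Fin N, Fin ((k : ℕ) + 1) → ℤ) : Prop :=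
  (∀ k, StrictMono (μ k)) ∧
  ∀ k : Fin N, ∀ h : (k : ℕ) + 1 < N, Interlaces (μ k) (μ ⟨(k : ℕ) + 1, h⟩)

/-- The column numbers (numbered `1,…,N`) of the entries equal to `1` of the partial sum
`r^1 + … + r^{k+1}` of the first `k+1` rows of `M`, listed in increasing order;
the `b`-th such column number (with junk value `0` if there are not enough). -/
def asmToPattern {N : ℕ} (M : Matrix (Fin N) (Fin N) ℤ) :
    ∀ k : Fin N, Fin ((k : ℕ) + 1) → ℤ := fun k b =>
  ((((Finset.univ.filter
        (fun j : Fin N =>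
          (∑ i ∈ Finset.univ.filter (fun i : Fin N => i ≤ k), M i j) = 1)).sort (· ≤ ·)).map
      (fun j : Fin N => ((j : ℕ) + 1 : ℤ))).getD (b : ℕ) 0)

/-- Interlacing tuples have, below every threshold, counts differing by `0` or `1`. -/
theorem Interlaces.card_le_eq_or {n : ℕ} {f : Fin n → ℤ} {g : Fin (n + 1) → ℤ}
    (h : Interlaces f g) (hf : StrictMono f) (hg : StrictMono g) (a : ℤ) :
    (Finset.univ.filter (fun i => g i ≤ a)).card = (Finset.univ.filter (fun i => f i ≤ a)).card ∨
      (Finset.univ.filter (fun i => g i ≤ a)).card =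
        (Finset.univ.filter (fun i => f i ≤ a)).card + 1 := by
  have hF := fun j => Tuple.lt_card_le_iff_apply_le_of_monotone (j := j) (a := a) hf.monotone
  have hG := fun j => Tuple.lt_card_le_iff_apply_le_of_monotone (j := j) (a := a) hg.monotone
  have cF : (Finset.univ.filter (fun i => f i ≤ a)).card ≤ n := by
    simpa using Finset.card_filter_le Finset.univ (fun i => f i ≤ a)
  have cG : (Finset.univ.filter (fun i => g i ≤ a)).card ≤ n + 1 := by
    simpa using Finset.card_filter_le Finset.univ (fun i => g i ≤ a)
  generalize (Finset.univ.filter (fun i => f i ≤ a)).card = p at *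
  generalize (Finset.univ.filter (fun i => g i ≤ a)).card = q at *
  have h1 : p ≤ q := by
    by_contra! hlt
    have := (hF ⟨q, by omega⟩).1 hlt
    have := (hG (Fin.castSucc ⟨q, by omega⟩)).2 ((h _).1.trans this)
    simp at this
  have h2 : q ≤ p + 1 := by
    by_contra! hlt
    have := (hG (Fin.succ ⟨p, by omega⟩)).1 hlt
    have := (hF ⟨p, by omega⟩).2 ((h _).2.trans this)
    simp at this
  omega

/-- Tuples whose counts below every entry differ by `0` or `1` interlace. -/
theorem interlaces_of_card_le {n : ℕ} {f : Fin n → ℤ} {g : Fin (n + 1) → ℤ}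
    (hf : StrictMono f) (hg : StrictMono g)
    (h : ∀ a, (a ∈ Set.range f ∨ a ∈ Set.range g) →
      (Finset.univ.filter (fun i => g i ≤ a)).card = (Finset.univ.filter (fun i => f i ≤ a)).card ∨
        (Finset.univ.filter (fun i => g i ≤ a)).card =
          (Finset.univ.filter (fun i => f i ≤ a)).card + 1) :
    Interlaces f g := by
  intro i
  constructor
  · have h1 := (Tuple.lt_card_le_iff_apply_le_of_monotone (j := i) (a := f i) hf.monotone).2 le_rfl
    refine (Tuple.lt_card_le_iff_apply_le_of_monotone (a := f i) hg.monotone).1 ?_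
    have := h (f i) (Or.inl ⟨i, rfl⟩)
    simp only [Fin.val_castSucc]
    omega
  · have h1 := (Tuple.lt_card_le_iff_apply_le_of_monotone (j := i.succ) (a := g i.succ)
      hg.monotone).2 le_rfl
    refine (Tuple.lt_card_le_iff_apply_le_of_monotone (a := g i.succ) hf.monotone).1 ?_
    have := h (g i.succ) (Or.inr ⟨_, rfl⟩)
    simp only [Fin.val_succ] at h1
    omega

open Classical in
/-- Counting the entries of a tuple of positive integers by their values. -/
theorem sum_ite_exists_eq_card_le {n N : ℕ} {f : Fin n → ℤ} (hf : Function.Injective f)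
    (hpos : ∀ i, 1 ≤ f i) (m : Fin N) :
    ∑ j ∈ Finset.univ.filter (fun j : Fin N => j ≤ m),
        (if ∃ b, f b = ((j : ℕ) : ℤ) + 1 then (1 : ℤ) else 0) =
      (Finset.univ.filter (fun i => f i ≤ ((m : ℕ) : ℤ) + 1)).card := by
  rw [Finset.sum_boole, Finset.filter_filter,
    ← Finset.card_image_of_injective _ hf,
    ← Finset.card_image_of_injective (f := fun j : Fin N => ((j : ℕ) : ℤ) + 1) _
      (fun x y h => by simpa [Fin.ext_iff] using h)]
  congr 2
  ext z
  simp only [Finset.mem_image, Finset.mem_filter, Finset.mem_univ, true_and]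
  constructor
  · rintro ⟨j, ⟨hj, b, hb⟩, rfl⟩
    refine ⟨b, ?_, hb⟩
    have : (j : ℕ) ≤ m := hj
    omega
  · rintro ⟨b, hb, rfl⟩
    have h1 := hpos b
    have hm := m.2
    refine ⟨⟨(f b - 1).toNat, by omega⟩, ⟨?_, b, ?_⟩, ?_⟩
    · rw [Fin.le_def]
      simp only
      omega
    · simp only
      omega
    · simp only
      omega

theorem sum_filter_le_telescope {N : ℕ} (F : ℕ → ℤ) (k : Fin N) :
    ∑ i ∈ Finset.univ.filter (fun i : Fin N => i ≤ k), (F ((i : ℕ) + 1) - F i) =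
      F ((k : ℕ) + 1) - F 0 := by
  rw [← Finset.sum_range_sub F]
  refine Finset.sum_nbij (fun i : Fin N => (i : ℕ)) ?_ ?_ ?_ ?_
  · intro i hi
    have : (i : ℕ) ≤ k := by simpa using hi
    simp only [Finset.mem_range]
    omega
  · intro x _ y _ h
    exact Fin.ext h
  · intro i hi
    have : i < (k : ℕ) + 1 := by simpa using hi
    have := k.2
    refine ⟨⟨i, by omega⟩, ?_, rfl⟩
    simp only [Finset.coe_filter, Finset.mem_univ, true_and, Set.mem_ofPred_eq, Fin.le_def]
    omega
  · intros
    rfl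

theorem sum_filter_le_eq_add_sum_filter_lt {N : ℕ} (f : Fin N → ℤ) (k : Fin N) :
    ∑ i ∈ Finset.univ.filter (fun i : Fin N => i ≤ k), f i =
      f k + ∑ i ∈ Finset.univ.filter (fun i : Fin N => i < k), f i := by
  rw [← Finset.sum_insert (by simp)]
  congr 1
  ext i
  simp [le_iff_eq_or_lt]

theorem sum_filter_le_succ {N : ℕ} (f : Fin N → ℤ) (k : Fin N) (h : (k : ℕ) + 1 < N) :
    ∑ i ∈ Finset.univ.filter (fun i : Fin N => i ≤ ⟨(k : ℕ) + 1, h⟩), f i =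
      f ⟨(k : ℕ) + 1, h⟩ + ∑ i ∈ Finset.univ.filter (fun i : Fin N => i ≤ k), f i := by
  rw [sum_filter_le_eq_add_sum_filter_lt]
  congr 2
  ext i
  simp only [Finset.mem_filter, Finset.mem_univ, true_and, Fin.lt_def, Fin.le_def]
  omega

theorem filter_le_eq_univ_of_succ_eq {N : ℕ} {m : Fin N} (hm : (m : ℕ) + 1 = N) :
    Finset.univ.filter (fun j : Fin N => j ≤ m) = Finset.univ := by
  ext j
  have := j.2
  simp only [Finset.mem_filter, Finset.mem_univ, true_and, Fin.le_def, iff_true]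
  omega

theorem IsASM.card_filter {N : ℕ} {M : Matrix (Fin N) (Fin N) ℤ} (hM : IsASM M) (k : Fin N) :
    (Finset.univ.filter (fun j : Fin N =>
      (∑ i ∈ Finset.univ.filter (fun i : Fin N => i ≤ k), M i j) = 1)).card = (k : ℕ) + 1 := by
  obtain ⟨-, hrow, -, -, hcol⟩ := hM
  zify
  rw [← Finset.sum_boole]
  have : ∀ j, (if (∑ i ∈ Finset.univ.filter (fun i : Fin N => i ≤ k), M i j) = 1
      then (1 : ℤ) else 0) = ∑ i ∈ Finset.univ.filter (fun i : Fin N => i ≤ k), M i j := by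
    intro j
    rcases hcol j k with h | h <;> simp [h]
  rw [Finset.sum_congr rfl (fun j _ => this j), Finset.sum_comm,
    Finset.sum_congr rfl (fun i _ => hrow i)]
  have := sum_filter_le_telescope (fun i => (i : ℤ)) k
  simpa using this

theorem asmToPattern_eq_orderEmbOfFin {N : ℕ} {M : Matrix (Fin N) (Fin N) ℤ} {k : Fin N}
    (h : (Finset.univ.filter (fun j : Fin N =>
      (∑ i ∈ Finset.univ.filter (fun i : Fin N => i ≤ k), M i j) = 1)).card = (k : ℕ) + 1)
    (b : Fin ((k : ℕ) + 1)) :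
    asmToPattern M k b = ((Finset.orderEmbOfFin _ h b : ℕ) : ℤ) + 1 := by
  have hb : (b : ℕ) < (Finset.sort (Finset.univ.filter (fun j : Fin N =>
      (∑ i ∈ Finset.univ.filter (fun i : Fin N => i ≤ k), M i j) = 1)) (· ≤ ·)).length := by
    rw [Finset.length_sort, h]
    exact b.2
  rw [asmToPattern, List.getD_eq_getElem _ _ (by simpa using hb), List.getElem_map,
    Finset.orderEmbOfFin_apply]
  rfl

theorem IsASM.strictMono_asmToPattern {N : ℕ} {M : Matrix (Fin N) (Fin N) ℤ} (hM : IsASM M)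
    (k : Fin N) : StrictMono (asmToPattern M k) := by
  intro a b hab
  rw [asmToPattern_eq_orderEmbOfFin (hM.card_filter k),
    asmToPattern_eq_orderEmbOfFin (hM.card_filter k)]
  have := (Finset.orderEmbOfFin _ (hM.card_filter k)).strictMono hab
  rw [Fin.lt_def] at this
  omega

theorem IsASM.mem_range_asmToPattern {N : ℕ} {M : Matrix (Fin N) (Fin N) ℤ} (hM : IsASM M)
    (k : Fin N) (z : ℤ) : z ∈ Set.range (asmToPattern M k) ↔ ∃ j : Fin N,
      (∑ i ∈ Finset.univ.filter (fun i : Fin N => i ≤ k), M i j) = 1 ∧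
        z = ((j : ℕ) : ℤ) + 1 := by
  have hr := Finset.range_orderEmbOfFin _ (hM.card_filter k)
  constructor
  · rintro ⟨b, rfl⟩
    refine ⟨_, ?_, asmToPattern_eq_orderEmbOfFin (hM.card_filter k) b⟩
    exact (Finset.mem_filter.1 (Finset.orderEmbOfFin_mem _ (hM.card_filter k) b)).2
  · rintro ⟨j, hj, rfl⟩
    have : j ∈ Set.range (Finset.orderEmbOfFin _ (hM.card_filter k)) := by
      rw [hr]
      simpa using hj
    obtain ⟨b, rfl⟩ := this
    exact ⟨b, asmToPattern_eq_orderEmbOfFin (hM.card_filter k) b⟩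

theorem IsASM.exists_asmToPattern_eq_iff {N : ℕ} {M : Matrix (Fin N) (Fin N) ℤ} (hM : IsASM M)
    (k j : Fin N) : (∃ b, asmToPattern M k b = ((j : ℕ) : ℤ) + 1) ↔
      (∑ i ∈ Finset.univ.filter (fun i : Fin N => i ≤ k), M i j) = 1 := by
  refine (hM.mem_range_asmToPattern k _).trans ⟨?_, fun h => ⟨j, h, rfl⟩⟩
  rintro ⟨j', h, e⟩
  have : j = j' := Fin.ext (by omega)
  rwa [this]

open Classical in
theorem IsASM.sum_filter_le_eq_ite {N : ℕ} {M : Matrix (Fin N) (Fin N) ℤ} (hM : IsASM M)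
    (k j : Fin N) : ∑ i ∈ Finset.univ.filter (fun i : Fin N => i ≤ k), M i j =
      if ∃ b, asmToPattern M k b = ((j : ℕ) : ℤ) + 1 then 1 else 0 := by
  simp only [hM.exists_asmToPattern_eq_iff]
  rcases hM.2.2.2.2 j k with h | h <;> simp [h]

theorem IsASM.card_asmToPattern_le {N : ℕ} {M : Matrix (Fin N) (Fin N) ℤ} (hM : IsASM M)
    (k m : Fin N) :
    ((Finset.univ.filter (fun b => asmToPattern M k b ≤ ((m : ℕ) : ℤ) + 1)).card : ℤ) =
      ∑ j ∈ Finset.univ.filter (fun j : Fin N => j ≤ m),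
        ∑ i ∈ Finset.univ.filter (fun i : Fin N => i ≤ k), M i j := by
  rw [Finset.sum_congr rfl (fun j _ => hM.sum_filter_le_eq_ite k j),
    sum_ite_exists_eq_card_le (hM.strictMono_asmToPattern k).injective]
  intro b
  obtain ⟨j, -, hj⟩ := (hM.mem_range_asmToPattern k _).1 ⟨b, rfl⟩
  omega

theorem IsASM.isGTPattern_asmToPattern {N : ℕ} {M : Matrix (Fin N) (Fin N) ℤ} (hM : IsASM M) :
    IsGTPattern (asmToPattern M) := by
  refine ⟨hM.strictMono_asmToPattern, fun k h => ?_⟩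
  refine interlaces_of_card_le (hM.strictMono_asmToPattern k)
    (hM.strictMono_asmToPattern ⟨(k : ℕ) + 1, h⟩) fun a ha => ?_
  obtain ⟨m, rfl⟩ : ∃ m : Fin N, a = ((m : ℕ) : ℤ) + 1 := by
    rcases ha with ha | ha
    · obtain ⟨m, -, hm⟩ := (hM.mem_range_asmToPattern k a).1 ha
      exact ⟨m, hm⟩
    · obtain ⟨m, -, hm⟩ := (hM.mem_range_asmToPattern ⟨(k : ℕ) + 1, h⟩ a).1 ha
      exact ⟨m, hm⟩
  have h1 := hM.card_asmToPattern_le k m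
  have h2 := hM.card_asmToPattern_le ⟨(k : ℕ) + 1, h⟩ m
  rw [Finset.sum_congr rfl (fun j _ => sum_filter_le_succ (fun i => M i j) k h),
    Finset.sum_add_distrib, ← h1] at h2
  rcases hM.2.2.2.1 ⟨(k : ℕ) + 1, h⟩ m with h0 | h0 <;> rw [h0] at h2
  · left
    zify
    simpa using h2
  · right
    zify
    exact h2.trans (add_comm _ _)

theorem IsASM.asmToPattern_last {N : ℕ} {M : Matrix (Fin N) (Fin N) ℤ} (hM : IsASM M)
    {k : Fin N} (hk : (k : ℕ) + 1 = N) (b : Fin ((k : ℕ) + 1)) :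
    asmToPattern M k b = ((b : ℕ) : ℤ) + 1 := by
  have hmono : StrictMono fun b : Fin ((k : ℕ) + 1) => ((b : ℕ) : ℤ) + 1 := by
    intro x y hxy
    have : (x : ℕ) < y := hxy
    simp only
    omega
  refine congrFun (((hM.strictMono_asmToPattern k).range_inj hmono).1 ?_) b
  ext z
  rw [hM.mem_range_asmToPattern, Set.mem_range]
  constructor
  · rintro ⟨j, -, rfl⟩
    exact ⟨⟨j, by omega⟩, rfl⟩
  · rintro ⟨b, rfl⟩
    refine ⟨⟨b, by omega⟩, ?_, rfl⟩
    rw [filter_le_eq_univ_of_succ_eq hk]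
    exact hM.2.2.1 _

theorem injOn_asmToPattern (N : ℕ) :
    Set.InjOn (fun M : Matrix (Fin N) (Fin N) ℤ => asmToPattern M) {M | IsASM M} := by
  intro M hM M' hM' h
  have h : asmToPattern M = asmToPattern M' := h
  have hsum : ∀ k j, ∑ i ∈ Finset.univ.filter (fun i : Fin N => i ≤ k), M i j =
      ∑ i ∈ Finset.univ.filter (fun i : Fin N => i ≤ k), M' i j := by
    intro k j
    rw [IsASM.sum_filter_le_eq_ite hM, IsASM.sum_filter_le_eq_ite hM', h]
  ext i j
  induction i using WellFoundedLT.induction with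
  | ind i ih =>
    have := hsum i j
    rw [sum_filter_le_eq_add_sum_filter_lt (fun i => M i j),
      sum_filter_le_eq_add_sum_filter_lt (fun i => M' i j),
      Finset.sum_congr rfl (fun x hx => ih x (by simpa using hx))] at this
    exact add_right_cancel this

theorem IsGTPattern.mem_Icc {N : ℕ} {μ : ∀ k : Fin N, Fin ((k : ℕ) + 1) → ℤ}
    (hμ : IsGTPattern μ) {l : Fin N} (hl : (l : ℕ) + 1 = N)
    (htop : ∀ b, μ l b = ((b : ℕ) : ℤ) + 1) (k : Fin N) (b : Fin ((k : ℕ) + 1)) :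
    1 ≤ μ k b ∧ μ k b ≤ N := by
  obtain ⟨d, hd⟩ : ∃ d, (k : ℕ) + 1 + d = N := ⟨N - (k + 1), by omega⟩
  induction d generalizing k with
  | zero =>
    obtain rfl : k = l := Fin.ext (by omega)
    have := b.2
    rw [htop]
    omega
  | succ d ih =>
    have h : (k : ℕ) + 1 < N := by omega
    have hi := hμ.2 k h b
    have h1 := ih ⟨(k : ℕ) + 1, h⟩ b.castSucc (by simp only; omega)
    have h2 := ih ⟨(k : ℕ) + 1, h⟩ b.succ (by simp only; omega)
    exact ⟨h1.1.trans hi.1, hi.2.trans h2.2⟩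

open Classical in
/-- The indicator of the column numbers in row `k` of a pattern, rows being numbered from `1`,
with the zero vector as row `0`. -/
noncomputable def patternIndicator {N : ℕ} (μ : ∀ k : Fin N, Fin ((k : ℕ) + 1) → ℤ)
    (j : Fin N) : ℕ → ℤ
  | 0 => 0
  | k + 1 => if ∃ (h : k < N) (b : Fin (k + 1)), μ ⟨k, h⟩ b = ((j : ℕ) : ℤ) + 1 then 1 else 0

theorem patternIndicator_eq_zero_or_one {N : ℕ} (μ : ∀ k : Fin N, Fin ((k : ℕ) + 1) → ℤ)
    (j : Fin N) (k : ℕ) : patternIndicator μ j k = 0 ∨ patternIndicator μ j k = 1 := by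
  cases k with
  | zero => exact Or.inl rfl
  | succ k =>
    rw [patternIndicator]
    split_ifs <;> simp

theorem patternIndicator_succ_eq_one_iff {N : ℕ} (μ : ∀ k : Fin N, Fin ((k : ℕ) + 1) → ℤ)
    (j k : Fin N) : patternIndicator μ j ((k : ℕ) + 1) = 1 ↔
      ∃ b, μ k b = ((j : ℕ) : ℤ) + 1 := by
  rw [patternIndicator]
  simp

theorem IsGTPattern.sum_patternIndicator_succ {N : ℕ}
    {μ : ∀ k : Fin N, Fin ((k : ℕ) + 1) → ℤ} (hμ : IsGTPattern μ) (hpos : ∀ k b, 1 ≤ μ k b)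
    (k m : Fin N) :
    ∑ j ∈ Finset.univ.filter (fun j : Fin N => j ≤ m), patternIndicator μ j ((k : ℕ) + 1) =
      (Finset.univ.filter (fun b => μ k b ≤ ((m : ℕ) : ℤ) + 1)).card := by
  classical
  rw [← sum_ite_exists_eq_card_le (hμ.1 k).injective (hpos k)]
  refine Finset.sum_congr rfl fun j _ => ?_
  simp [patternIndicator]

/-- The matrix of differences of consecutive row indicators of a pattern. -/
noncomputable def patternToMatrix {N : ℕ} (μ : ∀ k : Fin N, Fin ((k : ℕ) + 1) → ℤ) :
    Matrix (Fin N) (Fin N) ℤ :=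
  fun i j => patternIndicator μ j ((i : ℕ) + 1) - patternIndicator μ j i

theorem sum_filter_le_patternToMatrix {N : ℕ} (μ : ∀ k : Fin N, Fin ((k : ℕ) + 1) → ℤ)
    (k j : Fin N) :
    ∑ i ∈ Finset.univ.filter (fun i : Fin N => i ≤ k), patternToMatrix μ i j =
      patternIndicator μ j ((k : ℕ) + 1) := by
  exact (sum_filter_le_telescope (patternIndicator μ j) k).trans (sub_zero _)

theorem IsGTPattern.sum_row_patternToMatrix {N : ℕ}
    {μ : ∀ k : Fin N, Fin ((k : ℕ) + 1) → ℤ} (hμ : IsGTPattern μ) (hpos : ∀ k b, 1 ≤ μ k b)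
    (i m : Fin N) :
    ∑ j ∈ Finset.univ.filter (fun j : Fin N => j ≤ m), patternToMatrix μ i j = 0 ∨
      ∑ j ∈ Finset.univ.filter (fun j : Fin N => j ≤ m), patternToMatrix μ i j = 1 := by
  simp only [patternToMatrix, Finset.sum_sub_distrib]
  rw [hμ.sum_patternIndicator_succ hpos]
  obtain ⟨_ | k, hi⟩ := i
  · have := Finset.card_filter_le Finset.univ
      (fun b => μ ⟨0, hi⟩ b ≤ ((m : ℕ) : ℤ) + 1)
    simp only [Finset.card_univ, Fintype.card_fin] at this
    simp only [patternIndicator, Finset.sum_const_zero]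
    omega
  · have h1 := hμ.sum_patternIndicator_succ hpos ⟨k, by omega⟩ m
    have h2 := (hμ.2 ⟨k, by omega⟩ hi).card_le_eq_or (hμ.1 _) (hμ.1 _) (((m : ℕ) : ℤ) + 1)
    simp only at h1 h2 ⊢
    rw [h1]
    omega

theorem IsGTPattern.isASM_patternToMatrix {N : ℕ} {μ : ∀ k : Fin N, Fin ((k : ℕ) + 1) → ℤ}
    (hμ : IsGTPattern μ) {l : Fin N} (hl : (l : ℕ) + 1 = N)
    (htop : ∀ b, μ l b = ((b : ℕ) : ℤ) + 1) : IsASM (patternToMatrix μ) := by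
  have hpos : ∀ k b, 1 ≤ μ k b := fun k b => (hμ.mem_Icc hl htop k b).1
  have hcount : ∀ k : Fin N, ∑ j, patternIndicator μ j ((k : ℕ) + 1) = (k : ℕ) + 1 := by
    intro k
    rw [← filter_le_eq_univ_of_succ_eq hl, hμ.sum_patternIndicator_succ hpos,
      Finset.filter_true_of_mem]
    · simp
    · intro b _
      have := (hμ.mem_Icc hl htop k b).2
      omega
  refine ⟨fun i j => ?_, fun i => ?_, fun j => ?_, hμ.sum_row_patternToMatrix hpos, fun j m => ?_⟩
  · have h1 := patternIndicator_eq_zero_or_one μ j ((i : ℕ) + 1)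
    have h2 := patternIndicator_eq_zero_or_one μ j i
    rw [patternToMatrix]
    omega
  · simp only [patternToMatrix, Finset.sum_sub_distrib]
    rw [hcount]
    obtain ⟨_ | k, hi⟩ := i
    · simp [patternIndicator]
    · have := hcount ⟨k, by omega⟩
      simp only at this ⊢
      rw [this]
      push_cast
      ring
  · rw [← filter_le_eq_univ_of_succ_eq hl, sum_filter_le_patternToMatrix,
      patternIndicator_succ_eq_one_iff]
    exact ⟨⟨j, by omega⟩, htop _⟩
  · rw [sum_filter_le_patternToMatrix]
    exact patternIndicator_eq_zero_or_one μ j _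

theorem IsGTPattern.asmToPattern_patternToMatrix {N : ℕ}
    {μ : ∀ k : Fin N, Fin ((k : ℕ) + 1) → ℤ} (hμ : IsGTPattern μ) {l : Fin N}
    (hl : (l : ℕ) + 1 = N) (htop : ∀ b, μ l b = ((b : ℕ) : ℤ) + 1) :
    asmToPattern (patternToMatrix μ) = μ := by
  have hM := hμ.isASM_patternToMatrix hl htop
  funext k
  refine ((hM.strictMono_asmToPattern k).range_inj (hμ.1 k)).1 ?_
  ext z
  simp only [hM.mem_range_asmToPattern, sum_filter_le_patternToMatrix,
    patternIndicator_succ_eq_one_iff]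
  constructor
  · rintro ⟨j, ⟨b, hb⟩, rfl⟩
    exact ⟨b, hb⟩
  · rintro ⟨b, rfl⟩
    obtain ⟨h1, h2⟩ := hμ.mem_Icc hl htop k b
    have h3 : (((μ k b - 1).toNat : ℕ) : ℤ) + 1 = μ k b := by omega
    exact ⟨⟨(μ k b - 1).toNat, by omega⟩, ⟨b, h3.symm⟩, h3.symm⟩

/-- ASMs of size `N` are in bijection with half-strict Gelfand–Tsetlin patterns with top row
`(1,2,…,N)`, via `μ^k` = column numbers of the `1`s in `r^1 + … + r^k`.  In particular, for an
ASM each partial sum of rows `r^1 + … + r^k` has all entries `0` or `1`, with exactly `k`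
entries equal to `1`; the resulting rows form a pattern with top row `(1,…,N)`; and the map is
a bijection onto the set of such patterns. -/
theorem asm_equiv_gt_patterns (N : ℕ) (hN : 0 < N) :
    (∀ M : Matrix (Fin N) (Fin N) ℤ, IsASM M →
      (∀ k j : Fin N,
          (∑ i ∈ Finset.univ.filter (fun i : Fin N => i ≤ k), M i j) = 0 ∨
          (∑ i ∈ Finset.univ.filter (fun i : Fin N => i ≤ k), M i j) = 1) ∧
      (∀ k : Fin N,
          (Finset.univ.filter
            (fun j : Fin N =>
              (∑ i ∈ Finset.univ.filter (fun i : Fin N => i ≤ k), M i j) = 1)).card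
            = (k : ℕ) + 1) ∧
      IsGTPattern (asmToPattern M) ∧
      (∀ b : Fin (N - 1 + 1), asmToPattern M ⟨N - 1, by omega⟩ b = ((b : ℕ) + 1 : ℤ)))
    ∧
    Set.BijOn (fun M : Matrix (Fin N) (Fin N) ℤ => asmToPattern M)
      {M | IsASM M}
      {μ : ∀ k : Fin N, Fin ((k : ℕ) + 1) → ℤ |
        IsGTPattern μ ∧ ∀ b : Fin (N - 1 + 1), μ ⟨N - 1, by omega⟩ b = ((b : ℕ) + 1 : ℤ)} := by
  have hl : N - 1 + 1 = N := by omega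
  refine ⟨fun M hM => ⟨fun k j => hM.2.2.2.2 j k, hM.card_filter, hM.isGTPattern_asmToPattern,
    hM.asmToPattern_last (k := ⟨N - 1, by omega⟩) hl⟩, ?_, injOn_asmToPattern N, ?_⟩
  · intro M hM
    exact ⟨IsASM.isGTPattern_asmToPattern hM,
      IsASM.asmToPattern_last hM (k := ⟨N - 1, by omega⟩) hl⟩
  · rintro μ ⟨hμ, htop⟩
    exact ⟨patternToMatrix μ, hμ.isASM_patternToMatrix (l := ⟨N - 1, by omega⟩) hl htop,
      hμ.asmToPattern_patternToMatrix (l := ⟨N - 1, by omega⟩) hl htop⟩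
end
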